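/- arXiv:2408.01237 — 5 statements merged into one kernel-verified Lean document; each statement's English description precedes it below -/
import Mathlib

section
/- Let X and Y be independent random variables, each with the Laplace distribution La(0, δ²). Then for every absolutely continuous function g : ℝ → ℝ with E[(g′(X+Y))²] < ∞ and E[g(X)²] < ∞, one has 2δ² · (E[g′(X+Y)])² ≤ Var(g(X)) ≤ 2δ² · E[(g′(X+Y))²]. -/
open MeasureTheory ProbabilityTheory Set

noncomputable def lap (δ x : ℝ) : ℝ := (1 / (2 * δ)) * Real.exp (-|x| / δ)
noncomputable def lap2 (δ x : ℝ) : ℝ := (1 / (4 * δ)) * (1 + |x| / δ) * Real.exp (-|x| / δ)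

lemma lap_cont (δ : ℝ) : Continuous (lap δ) := by unfold lap; fun_prop
lemma lap2_cont (δ : ℝ) : Continuous (lap2 δ) := by unfold lap2; fun_prop
lemma lap_pos {δ : ℝ} (hδ : 0 < δ) (x : ℝ) : 0 < lap δ x := by unfold lap; positivity
lemma lap2_pos {δ : ℝ} (hδ : 0 < δ) (x : ℝ) : 0 < lap2 δ x := by unfold lap2; positivity

lemma conv_nonneg_aux {δ : ℝ} (hδ : 0 < δ) {x : ℝ} (hx : 0 ≤ x) :
    Integrable (fun y => lap δ y * lap δ (-y + x)) ∧
      ∫ y, lap δ y * lap δ (-y + x) = lap2 δ x := by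
  set F : ℝ → ℝ := fun y => lap δ y * lap δ (-y + x) with hF
  have e1 : EqOn F (fun y => (1 / (4 * δ ^ 2) * Real.exp (-x / δ)) * Real.exp ((2 / δ) * y)) (Iic 0) := by
    intro y hy
    have hy : y ≤ 0 := hy
    simp only [hF, lap]
    rw [abs_of_nonpos hy, abs_of_nonneg (by linarith : 0 ≤ -y + x)]
    rw [mul_mul_mul_comm, ← Real.exp_add, mul_assoc (1 / (4 * δ ^ 2)), ← Real.exp_add]
    congr 1
    · field_simp; norm_num
    · congr 1; field_simp; ring
  have e2 : EqOn F (fun y => (1 / (4 * δ ^ 2) * Real.exp (-x / δ))) (Ioc 0 x) := by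
    intro y hy
    have hy1 : 0 ≤ y := hy.1.le
    have hy2 : y ≤ x := hy.2
    simp only [hF, lap]
    rw [abs_of_nonneg hy1, abs_of_nonneg (by linarith : 0 ≤ -y + x)]
    rw [mul_mul_mul_comm, ← Real.exp_add]
    congr 1
    · field_simp; norm_num
    · congr 1; field_simp; ring
  have e3 : EqOn F (fun y => (1 / (4 * δ ^ 2) * Real.exp (x / δ)) * Real.exp ((-(2 / δ)) * y)) (Ioi x) := by
    intro y hy
    have hy : x < y := hy
    simp only [hF, lap]
    rw [abs_of_nonneg (by linarith : 0 ≤ y), abs_of_nonpos (by linarith : -y + x ≤ 0)]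
    rw [mul_mul_mul_comm, ← Real.exp_add, mul_assoc (1 / (4 * δ ^ 2)), ← Real.exp_add]
    congr 1
    · field_simp; norm_num
    · congr 1; field_simp; ring
  have h2δ : 0 < 2 / δ := by positivity
  have i1 : IntegrableOn F (Iic 0) :=
    IntegrableOn.congr_fun (Integrable.const_mul (integrableOn_exp_mul_Iic h2δ 0) _) e1.symm measurableSet_Iic
  have i2 : IntegrableOn F (Ioc 0 x) :=
    (integrableOn_const (by simp)).congr_fun e2.symm measurableSet_Ioc
  have i3 : IntegrableOn F (Ioi x) :=
    IntegrableOn.congr_fun (Integrable.const_mul (integrableOn_exp_mul_Ioi (neg_lt_zero.2 h2δ) x) _) e3.symm measurableSet_Ioi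
  have i23 : IntegrableOn F (Ioi 0) := by
    rw [← Ioc_union_Ioi_eq_Ioi hx]; exact i2.union i3
  refine ⟨?_, ?_⟩
  · rw [← integrableOn_univ, ← Iic_union_Ioi (a := (0:ℝ))]
    exact i1.union i23
  · rw [← intervalIntegral.integral_Iic_add_Ioi i1 i23, ← Ioc_union_Ioi_eq_Ioi hx,
      setIntegral_union (Ioc_disjoint_Ioi le_rfl) measurableSet_Ioi i2 i3,
      setIntegral_congr_fun measurableSet_Iic e1, setIntegral_congr_fun measurableSet_Ioc e2,
      setIntegral_congr_fun measurableSet_Ioi e3, integral_const_mul, integral_const_mul, integral_const_mul,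
      integral_exp_mul_Iic h2δ, integral_exp_mul_Ioi (neg_lt_zero.2 h2δ)]
    simp only [lap2, setIntegral_const, abs_of_nonneg hx]
    have : Real.exp (-(2 / δ) * x) = Real.exp (-x / δ) * Real.exp (-x/δ) := by
      rw [← Real.exp_add]; congr 1; field_simp; ring
    rw [this]
    have h3 : Real.exp (x / δ) = (Real.exp (-x / δ))⁻¹ := by
      rw [← Real.exp_neg]; congr 1; ring
    rw [h3]
    have := Real.exp_pos (-x / δ)
    simp [Measure.real, hx]
    field_simp
    ring

lemma conv_aux {δ : ℝ} (hδ : 0 < δ) (x : ℝ) :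
    Integrable (fun y => lap δ y * lap δ (-y + x)) ∧
      ∫ y, lap δ y * lap δ (-y + x) = lap2 δ x := by
  rcases le_total 0 x with hx | hx
  · exact conv_nonneg_aux hδ hx
  · obtain ⟨h1, h2⟩ := conv_nonneg_aux hδ (neg_nonneg.2 hx)
    have e : ∀ y, lap δ (-y) * lap δ (-(-y) + -x) = lap δ y * lap δ (-y + x) := by
      intro y
      simp only [lap, abs_neg]
      rw [← abs_neg (-y + x)]; ring_nf
    constructor
    · exact h1.comp_neg.congr (Filter.Eventually.of_forall e)
    · rw [← integral_congr_ae (Filter.Eventually.of_forall e),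
        integral_neg_eq_self (fun y => lap δ y * lap δ (-y + -x)), h2]
      simp [lap2]

lemma sum_law {δ : ℝ} (hδ : 0 < δ) :
    (volume.withDensity (fun x => ENNReal.ofReal (lap δ x))).conv
      (volume.withDensity (fun x => ENNReal.ofReal (lap δ x)))
      = volume.withDensity (fun x => ENNReal.ofReal (lap2 δ x)) := by
  have hm : Measurable (fun x => ENNReal.ofReal (lap δ x)) :=
    (lap_cont δ).measurable.ennreal_ofReal
  rw [conv_withDensity_eq_lconvolution hm hm]
  congr 1
  ext x
  rw [lconvolution_def, ← (conv_aux hδ x).2,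
    ofReal_integral_eq_lintegral_ofReal (conv_aux hδ x).1
      (Filter.Eventually.of_forall fun y => (mul_pos (lap_pos hδ _) (lap_pos hδ _)).le)]
  refine lintegral_congr fun y => ?_
  rw [ENNReal.ofReal_mul (lap_pos hδ _).le]

lemma tail_pos {δ : ℝ} (hδ : 0 < δ) {t : ℝ} (ht : 0 ≤ t) :
    IntegrableOn (fun x => lap δ x * |x|) (Ioi t) ∧
      ∫ x in Ioi t, lap δ x * |x| = 2 * δ ^ 2 * lap2 δ t := by
  let G : ℝ → ℝ := fun x => - ((1/2) * (δ + x) * Real.exp (-x / δ))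
  have hd : ∀ x ∈ Ici t, HasDerivAt G ((1/(2*δ)) * Real.exp (-x/δ) * x) x := by
    intro x _
    have h1 : HasDerivAt (fun x : ℝ => Real.exp (-x / δ)) (Real.exp (-x/δ) * (-1/δ)) x :=
      (((hasDerivAt_id x).neg).div_const δ).exp
    have h2 : HasDerivAt (fun x : ℝ => (1/2) * (δ + x)) ((1/2) * 1) x :=
      ((hasDerivAt_id x).const_add δ).const_mul _
    refine (h2.mul h1).neg.congr_deriv ?_
    field_simp; ring
  have hlim : Filter.Tendsto G Filter.atTop (nhds 0) := by
    have h1 : Filter.Tendsto (fun x : ℝ => x / δ) Filter.atTop Filter.atTop :=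
      Filter.tendsto_id.atTop_div_const hδ
    have h2 := (Real.tendsto_pow_mul_exp_neg_atTop_nhds_zero 1).comp h1
    have h3 := (Real.tendsto_pow_mul_exp_neg_atTop_nhds_zero 0).comp h1
    have h4 := ((h3.add h2).const_mul (-(δ/2)))
    simp only [add_zero, mul_zero] at h4
    refine h4.congr fun x => ?_
    simp [G]
    rw [← neg_div]; field_simp
  have e : EqOn (fun x => (1/(2*δ)) * Real.exp (-x/δ) * x) (fun x => lap δ x * |x|) (Ioi t) := by
    intro x hx
    have : 0 ≤ x := ht.trans (le_of_lt hx)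
    simp [lap, abs_of_nonneg this]
  have hi : IntegrableOn (fun x => (1/(2*δ)) * Real.exp (-x/δ) * x) (Ioi t) := by
    refine integrableOn_Ioi_deriv_of_nonneg' hd (fun x hx => ?_) hlim
    have : 0 ≤ x := ht.trans (le_of_lt hx)
    positivity
  refine ⟨hi.congr_fun e measurableSet_Ioi, ?_⟩
  rw [← setIntegral_congr_fun measurableSet_Ioi e,
    integral_Ioi_of_hasDerivAt_of_tendsto' hd hi hlim]
  simp only [G, lap2, abs_of_nonneg ht]
  field_simp; ring

noncomputable def ker (δ x t : ℝ) : ℝ := (uIoc 0 x).indicator (fun _ => lap δ x * |x|) t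

lemma ker_aux {δ : ℝ} (hδ : 0 < δ) (t : ℝ) :
    Integrable (fun x => ker δ x t) ∧ ∫ x, ker δ x t = 2 * δ ^ 2 * lap2 δ t := by
  rcases lt_or_ge 0 t with ht | ht
  · have e : (fun x => ker δ x t) = (Ici t).indicator (fun x => lap δ x * |x|) := by
      ext x
      simp only [ker, indicator]
      congr 1
      rw [mem_uIoc]
      simp only [mem_Ici, eq_iff_iff]
      constructor
      · rintro (h | h) <;> linarith
      · intro h; left; exact ⟨ht, h⟩
    rw [e, integral_indicator measurableSet_Ici, integrable_indicator_iff measurableSet_Ici,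
      integral_Ici_eq_integral_Ioi, integrableOn_Ici_iff_integrableOn_Ioi]
    exact tail_pos hδ ht.le
  · have e : (fun x => ker δ x t) = fun x => (Ioi (-t)).indicator (fun x => lap δ x * |x|) (-x) := by
      ext x
      simp only [ker, indicator, lap, abs_neg]
      congr 1
      rw [mem_uIoc]
      simp only [mem_Ioi, eq_iff_iff]
      constructor
      · rintro (h | h) <;> linarith
      · intro h; right; exact ⟨by linarith, ht⟩
    obtain ⟨h1, h2⟩ := tail_pos hδ (neg_nonneg.2 ht)
    rw [e]
    constructor
    · exact ((integrable_indicator_iff measurableSet_Ioi).2 h1).comp_neg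
    · rw [integral_neg_eq_self ((Ioi (-t)).indicator (fun x => lap δ x * |x|)),
        integral_indicator measurableSet_Ioi, h2]
      simp [lap2]

lemma ker_meas (δ : ℝ) : Measurable (fun p : ℝ × ℝ => ker δ p.1 p.2) := by
  have : (fun p : ℝ × ℝ => ker δ p.1 p.2) = ({p : ℝ × ℝ | (0 < p.2 ∧ p.2 ≤ p.1) ∨ (p.1 < p.2 ∧ p.2 ≤ 0)}).indicator (fun p => lap δ p.1 * |p.1|) := by
    ext p
    simp only [ker, indicator, mem_uIoc, mem_ofPred_eq]
  rw [this]
  refine Measurable.indicator ?_ ?_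
  · have := lap_cont δ; fun_prop
  · refine MeasurableSet.union (MeasurableSet.inter ?_ ?_) (MeasurableSet.inter ?_ ?_)
    · exact measurableSet_lt measurable_const measurable_snd
    · exact measurableSet_le measurable_snd measurable_fst
    · exact measurableSet_lt measurable_fst measurable_snd
    · exact measurableSet_le measurable_snd measurable_const

lemma ker_nonneg {δ : ℝ} (hδ : 0 < δ) (x t : ℝ) : 0 ≤ ker δ x t :=
  indicator_nonneg (fun _ _ => mul_nonneg (lap_pos hδ _).le (abs_nonneg _)) _

lemma fub {δ : ℝ} (hδ : 0 < δ) {φ : ℝ → ℝ} (hφ : Measurable φ)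
    (hi : Integrable (fun t => lap2 δ t * φ t)) :
    Integrable (fun p : ℝ × ℝ => ker δ p.1 p.2 * φ p.2) (volume.prod volume) := by
  have hm : AEStronglyMeasurable (fun p : ℝ × ℝ => ker δ p.1 p.2 * φ p.2) (volume.prod volume) :=
    ((ker_meas δ).mul (hφ.comp measurable_snd)).aestronglyMeasurable
  rw [integrable_prod_iff' hm]
  constructor
  · exact Filter.Eventually.of_forall fun t => (ker_aux hδ t).1.mul_const (φ t)
  · refine (hi.norm.const_mul (2 * δ ^ 2)).congr (Filter.Eventually.of_forall fun t => ?_)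
    simp only [norm_mul, Real.norm_of_nonneg (ker_nonneg hδ _ _), Real.norm_of_nonneg (lap2_pos hδ _).le]
    rw [integral_mul_const, (ker_aux hδ t).2]
    ring

lemma ker_inner (δ x : ℝ) (φ : ℝ → ℝ) :
    ∫ t, ker δ x t * φ t = lap δ x * (|x| * ∫ t in uIoc 0 x, φ t) := by
  rw [← mul_assoc, ← integral_const_mul, ← integral_indicator measurableSet_uIoc]
  congr 1; ext t
  simp only [ker, indicator]
  split_ifs <;> simp

lemma fub_int {δ : ℝ} (hδ : 0 < δ) {φ : ℝ → ℝ} (hφ : Measurable φ)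
    (hi : Integrable (fun t => lap2 δ t * φ t)) :
    Integrable (fun x => lap δ x * (|x| * ∫ t in uIoc 0 x, φ t)) ∧
    ∫ x, lap δ x * (|x| * ∫ t in uIoc 0 x, φ t) = 2 * δ ^ 2 * ∫ t, lap2 δ t * φ t := by
  have h := fub hδ hφ hi
  simp only [← ker_inner]
  refine ⟨h.integral_prod_left, ?_⟩
  rw [integral_integral_swap (f := fun x t => ker δ x t * φ t) h, ← integral_const_mul]
  congr 1; ext t
  rw [integral_mul_const, (ker_aux hδ t).2]; ring

lemma fub_on {δ : ℝ} (hδ : 0 < δ) {φ : ℝ → ℝ} (hφ : Measurable φ)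
    (hi : Integrable (fun t => lap2 δ t * φ t)) :
    ∀ᵐ x : ℝ, IntegrableOn φ (uIoc 0 x) := by
  filter_upwards [(fub hδ hφ hi).prod_right_ae] with x hx
  by_cases h0 : x = 0
  · simp [h0]
  have hc : lap δ x * |x| ≠ 0 := mul_ne_zero (lap_pos hδ x).ne' (abs_ne_zero.2 h0)
  rw [← integrable_indicator_iff measurableSet_uIoc]
  refine (hx.const_mul (lap δ x * |x|)⁻¹).congr (Filter.Eventually.of_forall fun t => ?_)
  simp only [ker, indicator]
  split_ifs
  · rw [← mul_assoc, inv_mul_cancel₀ hc, one_mul]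
  · simp

lemma x_mul_int (x : ℝ) (φ : ℝ → ℝ) :
    |x| * ∫ t in uIoc 0 x, φ t = x * ∫ t in (0:ℝ)..x, φ t := by
  rcases le_total 0 x with h | h
  · rw [uIoc_of_le h, intervalIntegral.integral_of_le h, abs_of_nonneg h]
  · rw [uIoc_of_ge h, intervalIntegral.integral_of_ge h, abs_of_nonpos h]; ring

lemma cs_aux (x : ℝ) {φ : ℝ → ℝ} (h1 : IntegrableOn φ (uIoc 0 x))
    (h2 : IntegrableOn (fun t => φ t ^ 2) (uIoc 0 x)) :
    (∫ t in (0:ℝ)..x, φ t) ^ 2 ≤ |x| * ∫ t in uIoc 0 x, φ t ^ 2 := by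
  have ea : (∫ t in (0:ℝ)..x, φ t) ^ 2 = (∫ t in uIoc 0 x, φ t) ^ 2 := by
    rw [← sq_abs, intervalIntegral.abs_integral_eq_abs_integral_uIoc, sq_abs]
  rw [ea]
  set a := ∫ t in uIoc 0 x, φ t with ha
  rcases eq_or_ne x 0 with h0 | h0
  · subst h0; simp [ha]
  have hx : 0 < |x| := abs_pos.2 h0
  have hpos : 0 ≤ ∫ t in uIoc 0 x, (|x| * φ t - a) ^ 2 := integral_nonneg fun _ => sq_nonneg _
  have hex : ∫ t in uIoc 0 x, (|x| * φ t - a) ^ 2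
      = |x| ^ 2 * (∫ t in uIoc 0 x, φ t ^ 2) - 2 * |x| * a * a + a ^ 2 * |x| := by
    have : ∀ t, (|x| * φ t - a) ^ 2 = |x| ^ 2 * φ t ^ 2 - 2 * |x| * a * φ t + a ^ 2 := by
      intro t; ring
    simp_rw [this]
    have hc : IntegrableOn (fun _ : ℝ => a ^ 2) (uIoc 0 x) := integrableOn_const (by simp [uIoc])
    have i2 : IntegrableOn (fun t => |x| ^ 2 * φ t ^ 2) (uIoc 0 x) := Integrable.const_mul h2 _
    have i1 : IntegrableOn (fun t => 2 * |x| * a * φ t) (uIoc 0 x) := Integrable.const_mul h1 _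
    have i12 : IntegrableOn (fun t => |x| ^ 2 * φ t ^ 2 - 2 * |x| * a * φ t) (uIoc 0 x) :=
      Integrable.sub i2 i1
    rw [integral_add i12 hc, integral_sub i2 i1, integral_const_mul, integral_const_mul, ← ha]
    have hv : volume.real (uIoc 0 x) = |x| := by
      rcases le_total 0 x with h | h
      · simp [Measure.real, uIoc_of_le h, abs_of_nonneg h, h]
      · simp [Measure.real, uIoc_of_ge h, abs_of_nonpos h, h]
    simp [hv]; ring
  rw [hex] at hpos
  have : 0 ≤ |x| * (|x| * (∫ t in uIoc 0 x, φ t ^ 2) - a ^ 2) := by nlinarith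
  have := nonneg_of_mul_nonneg_right this hx
  linarith

lemma iadd {u v : ℝ → ℝ} (hu : Integrable u) (hv : Integrable v) :
    Integrable (fun x => u x + v x) := hu.add hv

lemma core {δ : ℝ} (hδ : 0 < δ) {g ψ : ℝ → ℝ} (hψm : Measurable ψ)
    (hψl : ∀ a b, IntervalIntegrable ψ volume a b)
    (hg : ∀ x : ℝ, g x = g 0 + ∫ t in (0:ℝ)..x, ψ t)
    (hgm : Measurable g)
    (l1 : Integrable (lap δ)) (l1' : ∫ x, lap δ x = 1)
    (l2 : Integrable (lap2 δ)) (l2' : ∫ x, lap2 δ x = 1)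
    (h1 : Integrable (fun t => lap2 δ t * ψ t ^ 2))
    (h2 : Integrable (fun x => lap δ x * g x ^ 2)) :
    2 * δ ^ 2 * (∫ t, lap2 δ t * ψ t) ^ 2
        ≤ (∫ x, lap δ x * g x ^ 2) - (∫ x, lap δ x * g x) ^ 2
      ∧ (∫ x, lap δ x * g x ^ 2) - (∫ x, lap δ x * g x) ^ 2
        ≤ 2 * δ ^ 2 * ∫ t, lap2 δ t * ψ t ^ 2 := by
  have hlm := (lap_cont δ).measurable
  have hl2m := (lap2_cont δ).measurable
  have dom : ∀ {w φ : ℝ → ℝ}, Measurable w → Measurable φ → (∀ x, 0 < w x) → Integrable w →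
      Integrable (fun x => w x * φ x ^ 2) → Integrable (fun x => w x * φ x) := by
    intro w φ hw hφ hw0 hwi hi
    refine (hwi.add hi).mono' (hw.mul hφ).aestronglyMeasurable
      (Filter.Eventually.of_forall fun x => ?_)
    have := hw0 x
    simp only [Pi.add_apply, norm_mul, Real.norm_eq_abs, abs_of_pos this]
    have h3 : |φ x| ≤ 1 + φ x ^ 2 := by
      rw [← sq_abs (φ x)]; nlinarith [sq_nonneg (|φ x| - 1), abs_nonneg (φ x)]
    nlinarith
  have hg1 : Integrable (fun x => lap δ x * g x) := dom hlm hgm (lap_pos hδ) l1 h2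
  have hψ1 : Integrable (fun x => lap2 δ x * ψ x) := dom hl2m hψm (lap2_pos hδ) l2 h1
  -- second moment
  obtain ⟨q1, q2⟩ := fub_int hδ (φ := fun _ => 1) measurable_const (by simpa using l2)
  simp only [x_mul_int] at q1 q2
  simp only [intervalIntegral.integral_const, sub_zero, smul_eq_mul, mul_one, l2', ← sq] at q1 q2
  have hx1 : Integrable (fun x => lap δ x * x) := dom hlm measurable_id (lap_pos hδ) l1 q1
  have hx0 : ∫ x, lap δ x * x = 0 := by
    have := integral_neg_eq_self (fun x => lap δ x * x) volume
    have e : ∀ x, lap δ (-x) * -x = - (lap δ x * x) := by intro x; simp [lap]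
    simp only [e, integral_neg] at this
    linarith
  -- covariance
  obtain ⟨c1, c2⟩ := fub_int hδ hψm hψ1
  have hgd : ∀ x, ∫ t in (0:ℝ)..x, ψ t = g x - g 0 := fun x => by rw [hg x]; ring
  simp only [x_mul_int, hgd] at c1 c2
  have c3 : Integrable (fun x => lap δ x * (x * g x)) := by
    refine (c1.add (hx1.const_mul (g 0))).congr (Filter.Eventually.of_forall fun x => ?_)
    simp only [Pi.add_apply]; ring
  have c4 : ∫ x, lap δ x * (x * g x) = 2 * δ ^ 2 * ∫ t, lap2 δ t * ψ t := by
    rw [← c2]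
    have : ∀ x, lap δ x * (x * (g x - g 0)) = lap δ x * (x * g x) - g 0 * (lap δ x * x) := by
      intro x; ring
    simp only [this]
    rw [integral_sub c3 (hx1.const_mul _), integral_const_mul, hx0]; ring
  set E := ∫ t, lap2 δ t * ψ t with hE
  set m := ∫ x, lap δ x * g x with hm
  set S := ∫ x, lap δ x * g x ^ 2 with hS
  constructor
  · have hpos : 0 ≤ ∫ x, lap δ x * (g x - m - E * x) ^ 2 :=
      integral_nonneg fun x => mul_nonneg (lap_pos hδ x).le (sq_nonneg _)
    have e : ∀ x, lap δ x * (g x - m - E * x) ^ 2 = lap δ x * g x ^ 2 + (-(2 * m) * (lap δ x * g x)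
        + (m ^ 2 * lap δ x + (E ^ 2 * (lap δ x * x ^ 2) + (-(2 * E) * (lap δ x * (x * g x))
        + 2 * m * E * (lap δ x * x))))) := by intro x; ring
    simp only [e] at hpos
    have j1 := iadd (c3.const_mul (-(2 * E))) (hx1.const_mul (2 * m * E))
    have j2 := iadd (q1.const_mul (E ^ 2)) j1
    have j3 := iadd (l1.const_mul (m ^ 2)) j2
    have j4 := iadd (hg1.const_mul (-(2 * m))) j3
    rw [integral_add h2 j4, integral_add (hg1.const_mul _) j3, integral_add (l1.const_mul _) j2,
      integral_add (q1.const_mul _) j1, integral_add (c3.const_mul _) (hx1.const_mul _)] at hpos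
    simp only [integral_const_mul, l1', hx0, q2, c4, ← hm, ← hS] at hpos
    linarith
  · obtain ⟨u1, u2⟩ := fub_int hδ (hψm.pow_const 2) h1
    have k1 : Integrable (fun x => lap δ x * (g x - g 0) ^ 2) := by
      refine ((h2.add (hg1.const_mul (-(2 * g 0)))).add (l1.const_mul (g 0 ^ 2))).congr
        (Filter.Eventually.of_forall fun x => ?_)
      simp only [Pi.add_apply]; ring
    have k2 : ∫ x, lap δ x * (g x - g 0) ^ 2 = S - 2 * g 0 * m + g 0 ^ 2 := by
      have e : ∀ x, lap δ x * (g x - g 0) ^ 2 = lap δ x * g x ^ 2 + (-(2 * g 0) * (lap δ x * g x)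
        + g 0 ^ 2 * lap δ x) := by intro x; ring
      simp only [e]
      rw [integral_add h2 (iadd (hg1.const_mul _) (l1.const_mul _)),
        integral_add (hg1.const_mul _) (l1.const_mul _)]
      simp only [integral_const_mul, l1', ← hm, ← hS]; ring
    have k3 : ∫ x, lap δ x * (g x - g 0) ^ 2 ≤ 2 * δ ^ 2 * ∫ t, lap2 δ t * ψ t ^ 2 := by
      rw [← u2]
      refine integral_mono_ae k1 u1 ?_
      filter_upwards [fub_on hδ (hψm.pow_const 2) h1] with x hx
      refine mul_le_mul_of_nonneg_left ?_ (lap_pos hδ x).le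
      rw [← hgd]
      exact cs_aux x (intervalIntegrable_iff.1 (hψl 0 x)) hx
    rw [k2] at k3
    nlinarith [sq_nonneg (m - g 0)]

lemma toReal_int {Ω : Type*} [MeasurableSpace Ω] {P : Measure Ω} [IsProbabilityMeasure P]
    {Z : Ω → ℝ} (hZ : Measurable Z) {w : ℝ → ℝ} (hw : Continuous w) (hw0 : ∀ x, 0 < w x)
    (hlaw : P.map Z = volume.withDensity (fun x => ENNReal.ofReal (w x)))
    {φ : ℝ → ℝ} (hφ : Measurable φ) :
    (Integrable (fun ω => φ (Z ω)) P ↔ Integrable (fun x => w x * φ x)) ∧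
      ∫ ω, φ (Z ω) ∂P = ∫ x, w x * φ x := by
  have hwm : Measurable (fun x => ENNReal.ofReal (w x)) := hw.measurable.ennreal_ofReal
  have ht : ∀ᵐ x : ℝ, ENNReal.ofReal (w x) < ⊤ :=
    Filter.Eventually.of_forall fun x => ENNReal.ofReal_lt_top
  constructor
  · have := integrable_map_measure (μ := P) (f := Z) (g := φ) hφ.aestronglyMeasurable hZ.aemeasurable
    change Integrable (φ ∘ Z) P ↔ _
    rw [← this, hlaw, integrable_withDensity_iff_integrable_smul' hwm ht]
    simp [ENNReal.toReal_ofReal (hw0 _).le]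
  · rw [← integral_map hZ.aemeasurable hφ.aestronglyMeasurable, hlaw,
      integral_withDensity_eq_integral_toReal_smul hwm ht]
    simp [ENNReal.toReal_ofReal (hw0 _).le]

/-- **Cacoullos-type variance bounds for the Laplace distribution.**
If `X` and `Y` are independent, each Laplace `La(0, δ²)`, then
`2δ² (E[g'(X+Y)])² ≤ Var(g(X)) ≤ 2δ² E[(g'(X+Y))²]`. -/
theorem cacoullos_variance_bounds_laplace
    {Ω : Type*} [MeasureSpace Ω] [IsProbabilityMeasure (ℙ : Measure Ω)]
    (δ : ℝ) (hδ : 0 < δ)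
    (X Y : Ω → ℝ) (hX : Measurable X) (hY : Measurable Y)
    (hindep : IndepFun X Y ℙ)
    -- X and Y both have the Laplace distribution La(0, δ²)
    (hXlaw : Measure.map X ℙ
      = volume.withDensity (fun x => ENNReal.ofReal ((1 / (2 * δ)) * Real.exp (-|x| / δ))))
    (hYlaw : Measure.map Y ℙ
      = volume.withDensity (fun x => ENNReal.ofReal ((1 / (2 * δ)) * Real.exp (-|x| / δ))))
    -- g is absolutely continuous with derivative g'
    (g g' : ℝ → ℝ)
    (hg'loc : LocallyIntegrable g' volume)
    (hg : ∀ x : ℝ, g x = g 0 + ∫ t in (0:ℝ)..x, g' t)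
    -- integrability assumptions : E[(g'(X+Y))²] < ∞ and E[g(X)²] < ∞
    (hint1 : Integrable (fun ω => (g' (X ω + Y ω)) ^ 2) ℙ)
    (hint2 : Integrable (fun ω => (g (X ω)) ^ 2) ℙ) :
    2 * δ ^ 2 * (∫ ω, g' (X ω + Y ω) ∂ℙ) ^ 2
        ≤ (∫ ω, (g (X ω)) ^ 2 ∂ℙ) - (∫ ω, g (X ω) ∂ℙ) ^ 2
      ∧ (∫ ω, (g (X ω)) ^ 2 ∂ℙ) - (∫ ω, g (X ω) ∂ℙ) ^ 2
        ≤ 2 * δ ^ 2 * ∫ ω, (g' (X ω + Y ω)) ^ 2 ∂ℙ := by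
  have hXlaw' : Measure.map X ℙ = volume.withDensity (fun x => ENNReal.ofReal (lap δ x)) := hXlaw
  have hYlaw' : Measure.map Y ℙ = volume.withDensity (fun x => ENNReal.ofReal (lap δ x)) := hYlaw
  have hZ : Measurable (fun ω => X ω + Y ω) := hX.add hY
  have hZlaw : Measure.map (fun ω => X ω + Y ω) ℙ
      = volume.withDensity (fun x => ENNReal.ofReal (lap2 δ x)) := by
    have := hindep.map_add_eq_map_conv_map hX hY
    rw [hXlaw', hYlaw', sum_law hδ] at this
    exact this
  have hae : AEMeasurable g' volume := hg'loc.aestronglyMeasurable.aemeasurable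
  set ψ := hae.mk g' with hψ
  have hψm : Measurable ψ := hae.measurable_mk
  have heq : g' =ᵐ[volume] ψ := hae.ae_eq_mk
  have heqZ : ∀ᵐ ω, g' (X ω + Y ω) = ψ (X ω + Y ω) := by
    have h1 : ∀ᵐ z ∂(Measure.map (fun ω => X ω + Y ω) ℙ), g' z = ψ z := by
      rw [hZlaw]
      exact (withDensity_absolutelyContinuous _ _).ae_le heq
    exact ae_of_ae_map hZ.aemeasurable h1
  have hloc : ∀ a b, IntervalIntegrable g' volume a b := fun a b =>
    (hg'loc.integrableOn_isCompact isCompact_uIcc).intervalIntegrable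
  have hψl : ∀ a b, IntervalIntegrable ψ volume a b := fun a b =>
    (hloc a b).congr_ae (ae_restrict_of_ae heq)
  have hgψ : ∀ x : ℝ, g x = g 0 + ∫ t in (0:ℝ)..x, ψ t := by
    intro x
    rw [hg x]
    congr 1
    exact intervalIntegral.integral_congr_ae (heq.mono fun t ht _ => ht)
  have hgm : Measurable g := by
    have : g = fun x => g 0 + ∫ t in (0:ℝ)..x, ψ t := funext hgψ
    rw [this]
    exact (continuous_const.add (intervalIntegral.continuous_primitive hψl 0)).measurable
  have hA := fun (φ : ℝ → ℝ) (hφ : Measurable φ) =>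
    toReal_int hX (lap_cont δ) (lap_pos hδ) hXlaw' hφ
  have hB := fun (φ : ℝ → ℝ) (hφ : Measurable φ) =>
    toReal_int hZ (lap2_cont δ) (lap2_pos hδ) hZlaw hφ
  have a1 := hA (fun _ => 1) measurable_const
  have b1 := hB (fun _ => 1) measurable_const
  simp only [mul_one] at a1 b1
  have a2 := hA (fun x => g x ^ 2) (hgm.pow_const 2)
  have b2 := hB (fun x => ψ x ^ 2) (hψm.pow_const 2)
  have e2 : (fun ω => g' (X ω + Y ω) ^ 2) =ᵐ[ℙ] fun ω => ψ (X ω + Y ω) ^ 2 :=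
    heqZ.mono fun ω h => by simp only [h]
  rw [integral_congr_ae heqZ, integral_congr_ae e2, (hA g hgm).2, (hB ψ hψm).2, a2.2, b2.2]
  exact core hδ hψm hψl hgψ hgm (a1.1.1 (integrable_const _)) (by rw [← a1.2]; simp)
    (b1.1.1 (integrable_const _)) (by rw [← b1.2]; simp) (b2.1.1 (hint1.congr e2)) (a2.1.1 hint2)
end

section
/- Let a, b > 0, let X be a random variable with the two-sided exponential density f_X(x) = (ab/(a+b)) (e^{−ax} 1_{(0,∞)}(x) + e^{bx} 1_{(−∞,0)}(x)), and let Y₁ be independent of X with density f₁(y) = (a²b²/(a²+b²)) ( (e^{−ay}/a) 1_{(0,∞)}(y) + (e^{by}/b) 1_{(−∞,0)}(y) ). Then for every absolutely continuous function g : ℝ → ℝ with E[(g′(X+Y₁))²] < ∞ and E[g(X)²] < ∞, one has ((a²+b²)/(a²b²)) · (E[g′(X+Y₁)])² ≤ Var(g(X)) ≤ ((a²+b²)/(a²b²)) · E[(g′(X+Y₁))²]. -/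
open MeasureTheory ProbabilityTheory Set

namespace CacoullosAux

/-- unnormalised density of `X` -/
noncomputable def fR (a b x : ℝ) : ℝ := if 0 < x then Real.exp (-a * x) else Real.exp (b * x)

/-- unnormalised density of `Y₁` -/
noncomputable def kR (a b y : ℝ) : ℝ :=
  if 0 < y then Real.exp (-a * y) / a else if y < 0 then Real.exp (b * y) / b else 0

lemma fR_neg (a b x : ℝ) : fR a b (-x) = fR b a x := by
  unfold fR
  rcases lt_trichotomy x 0 with h | h | h
  · have h1 : 0 < -x := by linarith
    have h2 : ¬ 0 < x := by linarith
    simp [h, h2]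
  · subst h; simp
  · have h1 : ¬ 0 < -x := by linarith
    simp [h, h1]

lemma kR_neg (a b x : ℝ) : kR a b (-x) = kR b a x := by
  unfold kR
  rcases lt_trichotomy x 0 with h | h | h
  · have h1 : 0 < -x := by linarith
    have h2 : ¬ 0 < x := by linarith
    simp [h, h2]
  · subst h; simp
  · have h1 : ¬ 0 < -x := by linarith
    simp [h, h1]

lemma fR_nonneg (a b x : ℝ) : 0 ≤ fR a b x := by
  unfold fR; split_ifs <;> positivity

lemma kR_nonneg {a b : ℝ} (ha : 0 < a) (hb : 0 < b) (x : ℝ) : 0 ≤ kR a b x := by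
  unfold kR; split_ifs <;> positivity

@[fun_prop]
lemma measurable_fR (a b : ℝ) : Measurable (fR a b) := by
  unfold fR
  exact Measurable.ite measurableSet_Ioi (by fun_prop) (by fun_prop)

@[fun_prop]
lemma measurable_kR (a b : ℝ) : Measurable (kR a b) := by
  unfold kR
  exact Measurable.ite measurableSet_Ioi (by fun_prop)
    (Measurable.ite measurableSet_Iio (by fun_prop) (by fun_prop))

lemma lint_Ioi (H h : ℝ → ℝ) (t : ℝ) (hd : ∀ x, HasDerivAt H (h x) x)
    (hn : ∀ x ∈ Ioi t, 0 ≤ h x) (l : ℝ) (hl : Filter.Tendsto H Filter.atTop (nhds l)) :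
    ∫⁻ x in Ioi t, ENNReal.ofReal (h x) = ENNReal.ofReal (l - H t) := by
  rw [← integral_Ioi_of_hasDerivAt_of_nonneg' (fun x _ => hd x) hn hl,
    ofReal_integral_eq_lintegral_ofReal
      (integrableOn_Ioi_deriv_of_nonneg' (fun x _ => hd x) hn hl)]
  exact (ae_restrict_iff' measurableSet_Ioi).2 (Filter.Eventually.of_forall hn)

lemma lint_Ioc (H h : ℝ → ℝ) (s t : ℝ) (hst : s ≤ t) (hd : ∀ x, HasDerivAt H (h x) x)
    (hc : Continuous h) (hn : ∀ x ∈ Ioc s t, 0 ≤ h x) :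
    ∫⁻ x in Ioc s t, ENNReal.ofReal (h x) = ENNReal.ofReal (H t - H s) := by
  rw [← intervalIntegral.integral_eq_sub_of_hasDerivAt (fun x _ => hd x)
    (hc.intervalIntegrable _ _), intervalIntegral.integral_of_le hst,
    ofReal_integral_eq_lintegral_ofReal]
  · exact hc.integrableOn_Ioc
  · exact (ae_restrict_iff' measurableSet_Ioc).2 (Filter.Eventually.of_forall hn)

lemma tendsto_exp {a : ℝ} (ha : 0 < a) :
    Filter.Tendsto (fun x => Real.exp (-a * x)) Filter.atTop (nhds 0) := by
  have := tendsto_rpow_mul_exp_neg_mul_atTop_nhds_zero 0 a ha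
  simpa using this

lemma tendsto_lin_exp {a : ℝ} (ha : 0 < a) (p q : ℝ) :
    Filter.Tendsto (fun x => (p * x + q) * Real.exp (-a * x)) Filter.atTop (nhds 0) := by
  have h1 := tendsto_rpow_mul_exp_neg_mul_atTop_nhds_zero 1 a ha
  simp only [Real.rpow_one] at h1
  have := (h1.const_mul p).add ((tendsto_exp ha).const_mul q)
  simp only [mul_zero, add_zero] at this
  refine this.congr (fun x => by ring)

lemma deriv_lin_exp (a p q x : ℝ) :
    HasDerivAt (fun x => (p * x + q) * Real.exp (a * x))
      (p * Real.exp (a * x) + (p * x + q) * (Real.exp (a * x) * a)) x := by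
  have h1 : HasDerivAt (fun x : ℝ => p * x + q) p x := by
    simpa using ((hasDerivAt_id x).const_mul p).add_const q
  have h2 : HasDerivAt (fun x : ℝ => Real.exp (a * x)) (Real.exp (a * x) * a) x := by
    simpa using ((hasDerivAt_id x).const_mul a).exp
  exact h1.mul h2

/-- `∫ (p x + q) e^{-a x}` over `(t, ∞)`. -/
lemma lint_Ioi_exp {a : ℝ} (ha : 0 < a) (p q t : ℝ) (hn : ∀ x ∈ Ioi t, 0 ≤ p * x + q) :
    ∫⁻ x in Ioi t, ENNReal.ofReal ((p * x + q) * Real.exp (-a * x))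
      = ENNReal.ofReal ((p * t / a + p / a ^ 2 + q / a) * Real.exp (-a * t)) := by
  rw [lint_Ioi (fun x => (-(p / a) * x + -(p / a ^ 2 + q / a)) * Real.exp (-a * x)) _ t _ _ 0
    (tendsto_lin_exp ha _ _)]
  · congr 1; ring
  · intro x
    convert! deriv_lin_exp (-a) (-(p / a)) (-(p / a ^ 2 + q / a)) x using 1
    field_simp; ring
  · intro x hx
    exact mul_nonneg (hn x hx) (Real.exp_pos _).le

/-- `∫ (p x + q) e^{b x}` over `(s, t]`. -/
lemma lint_Ioc_exp {b : ℝ} (hb : 0 < b) (p q s t : ℝ) (hst : s ≤ t)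
    (hn : ∀ x ∈ Ioc s t, 0 ≤ p * x + q) :
    ∫⁻ x in Ioc s t, ENNReal.ofReal ((p * x + q) * Real.exp (b * x))
      = ENNReal.ofReal ((p * t / b - p / b ^ 2 + q / b) * Real.exp (b * t)
        - (p * s / b - p / b ^ 2 + q / b) * Real.exp (b * s)) := by
  rw [lint_Ioc (fun x => ((p / b) * x + (q / b - p / b ^ 2)) * Real.exp (b * x)) _ s t hst]
  · congr 1; ring
  · intro x
    convert! deriv_lin_exp b (p / b) (q / b - p / b ^ 2) x using 1
    field_simp; ring
  · fun_prop
  · intro x hx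
    exact mul_nonneg (hn x hx) (Real.exp_pos _).le

lemma lint_split (h : ℝ → ENNReal) (s t : ℝ) (hst : s ≤ t) :
    ∫⁻ x in Ioi s, h x = (∫⁻ x in Ioc s t, h x) + ∫⁻ x in Ioi t, h x := by
  rw [← lintegral_union measurableSet_Ioi, Ioc_union_Ioi_eq_Ioi hst]
  exact Set.disjoint_left.2 (fun x hx hx' => absurd hx.2 (not_le.2 hx'))

/-- lintegral of `(p x + q) f` beyond `t ≥ 0` -/
lemma tail_pos {a b : ℝ} (ha : 0 < a) (p q t : ℝ) (ht : 0 ≤ t)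
    (hn : ∀ x ∈ Ioi t, 0 ≤ p * x + q) :
    ∫⁻ x in Ioi t, ENNReal.ofReal ((p * x + q) * fR a b x)
      = ENNReal.ofReal ((p * t / a + p / a ^ 2 + q / a) * Real.exp (-a * t)) := by
  rw [← lint_Ioi_exp ha p q t hn]
  refine setLIntegral_congr_fun measurableSet_Ioi (fun x hx => ?_)
  have : 0 < x := lt_of_le_of_lt ht hx
  simp [fR, this]

lemma tail_neg {a b : ℝ} (ha : 0 < a) (hb : 0 < b) (p q t : ℝ) (ht : t ≤ 0)
    (hn : ∀ x ∈ Ioi t, 0 ≤ p * x + q)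
    (h1 : 0 ≤ (p * 0 / b - p / b ^ 2 + q / b) * Real.exp (b * 0)
        - (p * t / b - p / b ^ 2 + q / b) * Real.exp (b * t))
    (h2 : 0 ≤ (p * 0 / a + p / a ^ 2 + q / a) * Real.exp (-a * 0)) :
    ∫⁻ x in Ioi t, ENNReal.ofReal ((p * x + q) * fR a b x)
      = ENNReal.ofReal (((p * 0 / b - p / b ^ 2 + q / b) * Real.exp (b * 0)
        - (p * t / b - p / b ^ 2 + q / b) * Real.exp (b * t)) +
          ((p * 0 / a + p / a ^ 2 + q / a) * Real.exp (-a * 0))) := by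
  rw [lint_split _ t 0 ht, tail_pos ha p q 0 le_rfl (fun x hx => hn x (lt_of_le_of_lt ht hx)),
    ENNReal.ofReal_add h1 h2, ← lint_Ioc_exp hb p q t 0 ht (fun x hx => hn x hx.1)]
  congr 1
  refine setLIntegral_congr_fun measurableSet_Ioc (fun x hx => ?_)
  have : ¬ 0 < x := not_lt.2 hx.2
  simp [fR, this]

/-- tail -/
noncomputable def S (a b t : ℝ) : ENNReal := ∫⁻ x in Ioi t, ENNReal.ofReal (fR a b x)
/-- integrated tail -/
noncomputable def A (a b t : ℝ) : ENNReal :=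
  ∫⁻ x in Ioi t, ENNReal.ofReal ((x - t) * fR a b x)

lemma S_pos {a b t : ℝ} (ha : 0 < a) (ht : 0 ≤ t) :
    S a b t = ENNReal.ofReal (Real.exp (-a * t) / a) := by
  have := tail_pos (b := b) ha 0 1 t ht (by simp)
  unfold S
  simp only [zero_mul, zero_add, one_mul, zero_div] at this
  rw [this]; congr 1; ring

lemma A_pos {a b t : ℝ} (ha : 0 < a) (ht : 0 ≤ t) :
    A a b t = ENNReal.ofReal (Real.exp (-a * t) / a ^ 2) := by
  have := tail_pos (b := b) ha 1 (-t) t ht (by intro x hx; simp only [mem_Ioi] at hx; linarith)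
  unfold A
  simp only [one_mul, ← sub_eq_add_neg] at this
  rw [this]; congr 1; ring

lemma S_neg {a b t : ℝ} (ha : 0 < a) (hb : 0 < b) (ht : t ≤ 0) :
    S a b t = ENNReal.ofReal ((1 - Real.exp (b * t)) / b + 1 / a) := by
  have hE : Real.exp (b * t) ≤ 1 := Real.exp_le_one_iff.2 (by nlinarith)
  have := tail_neg ha hb 0 1 t ht (by simp) (by
    simp
    have := mul_le_mul_of_nonneg_left hE (inv_pos.2 hb).le
    linarith) (by simp; positivity)
  unfold S
  simp only [zero_mul, zero_add, one_mul, zero_div] at this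
  rw [this]; congr 1; simp; ring

lemma A_neg {a b t : ℝ} (ha : 0 < a) (hb : 0 < b) (ht : t ≤ 0) :
    A a b t = ENNReal.ofReal ((-t / b - 1 / b ^ 2 + Real.exp (b * t) / b ^ 2)
      + (1 / a ^ 2 - t / a)) := by
  have hE : b * t + 1 ≤ Real.exp (b * t) := Real.add_one_le_exp _
  have := tail_neg ha hb 1 (-t) t ht
    (by intro x hx; simp only [mem_Ioi] at hx; linarith) (by
    have e : (1 * 0 / b - 1 / b ^ 2 + -t / b) * Real.exp (b * 0)
      - (1 * t / b - 1 / b ^ 2 + -t / b) * Real.exp (b * t)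
      = (Real.exp (b * t) - (b * t + 1)) / b ^ 2 := by
      simp; field_simp; ring
    rw [e]
    exact div_nonneg (by linarith) (by positivity)) (by
    have : 0 ≤ -t := by linarith
    have := div_nonneg this ha.le
    simp; positivity)
  unfold A
  simp only [one_mul, ← sub_eq_add_neg] at this
  rw [this]; congr 1; simp; ring

lemma W_pos {a b t : ℝ} (ha : 0 < a) (hb : 0 < b) (ht : 0 ≤ t) :
    A a b t * S b a (-t) + S a b t * A b a (-t)
      = ENNReal.ofReal ((a + b) / (a * b) * (Real.exp (-a * t) * (1 + b * t) / (a * b))) := by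
  have hE : Real.exp (-a * t) ≤ 1 := Real.exp_le_one_iff.2 (by nlinarith)
  have hE' : -a * t + 1 ≤ Real.exp (-a * t) := Real.add_one_le_exp _
  have ht' : -t ≤ 0 := by linarith
  rw [A_pos ha ht, S_pos ha ht, S_neg hb ha ht', A_neg hb ha ht',
    ← ENNReal.ofReal_mul (by positivity), ← ENNReal.ofReal_mul (by positivity),
    ← ENNReal.ofReal_add]
  · congr 1
    rw [show a * -t = -a * t by ring]
    generalize Real.exp (-a * t) = E
    field_simp; ring
  · rw [show a * -t = -a * t by ring]
    have : 0 ≤ 1 - Real.exp (-a * t) := by linarith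
    positivity
  · rw [show a * -t = -a * t by ring]
    have h0 : 0 ≤ (Real.exp (-a * t) - (-a * t + 1)) / a ^ 2 :=
      div_nonneg (by linarith) (by positivity)
    have h1 : - -t / a - 1 / a ^ 2 + Real.exp (-a * t) / a ^ 2
      = (Real.exp (-a * t) - (-a * t + 1)) / a ^ 2 := by field_simp; ring
    rw [h1]
    have h2 : 0 ≤ 1 / b ^ 2 - -t / b := by
      rw [neg_div, sub_neg_eq_add]; positivity
    positivity

/-- convolution -/
noncomputable def Q (a b t : ℝ) : ENNReal :=
  ∫⁻ x, ENNReal.ofReal (fR a b x) * ENNReal.ofReal (kR a b (t - x))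

lemma Q_neg (a b t : ℝ) : Q a b (-t) = Q b a t := by
  unfold Q
  rw [← lintegral_neg_eq_self]
  refine lintegral_congr (fun x => ?_)
  rw [fR_neg, show -t - -x = -(t - x) by ring, kR_neg]

lemma Q_pos {a b t : ℝ} (ha : 0 < a) (hb : 0 < b) (ht : 0 < t) :
    Q a b t = ENNReal.ofReal (Real.exp (-a * t) * (1 + b * t) / (a * b)) := by
  unfold Q
  rw [← lintegral_add_compl _ (measurableSet_Iic (a := (0:ℝ))), compl_Iic, lint_split _ 0 t ht.le]
  have h1 : ∫⁻ x in Iic (0:ℝ), ENNReal.ofReal (fR a b x) * ENNReal.ofReal (kR a b (t - x))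
      = ENNReal.ofReal (Real.exp (-a * t) / a / (a + b)) := by
    rw [← lintegral_indicator measurableSet_Iic, ← lintegral_neg_eq_self]
    have e : ∀ x, (Iic (0:ℝ)).indicator (fun x => ENNReal.ofReal (fR a b x) *
        ENNReal.ofReal (kR a b (t - x))) (-x) = (Ici (0:ℝ)).indicator
        (fun x => ENNReal.ofReal ((0 * x + Real.exp (-a * t) / a) * Real.exp (-(a + b) * x))) x := by
      intro x
      by_cases hx : 0 ≤ x
      · rw [indicator_of_mem (by simpa using hx), indicator_of_mem (by simpa using hx),
          ← ENNReal.ofReal_mul (fR_nonneg _ _ _)]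
        have h1 : ¬ (0 < -x) := by linarith
        have h2 : 0 < t - -x := by linarith
        simp only [fR, kR, h1, h2, if_true, if_false]
        congr 1
        rw [zero_mul, zero_add, div_mul_eq_mul_div, ← Real.exp_add, ← mul_div_assoc, ← Real.exp_add]
        ring_nf
      · rw [indicator_of_notMem (by simpa using hx), indicator_of_notMem (by simpa using hx)]
    rw [lintegral_congr e, lintegral_indicator measurableSet_Ici, setLIntegral_congr Ioi_ae_eq_Ici.symm,
      lint_Ioi_exp (by positivity) _ _ _ (by intro x _; rw [zero_mul, zero_add]; positivity)]
    congr 1; simp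
  have h2 : ∫⁻ x in Ioc (0:ℝ) t, ENNReal.ofReal (fR a b x) * ENNReal.ofReal (kR a b (t - x))
      = ENNReal.ofReal (t * (Real.exp (-a * t) / a)) := by
    rw [setLIntegral_congr Ioo_ae_eq_Ioc.symm]
    have : ∫⁻ x in Ioo (0:ℝ) t, ENNReal.ofReal (fR a b x) * ENNReal.ofReal (kR a b (t - x))
      = ∫⁻ x in Ioo (0:ℝ) t, ENNReal.ofReal (Real.exp (-a * t) / a) := by
      refine setLIntegral_congr_fun measurableSet_Ioo (fun x hx => ?_)
      have h1 : 0 < x := hx.1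
      have h2 : 0 < t - x := by linarith [hx.2]
      simp only [fR, kR, h1, h2, if_true]
      rw [← ENNReal.ofReal_mul (by positivity), ← mul_div_assoc, ← Real.exp_add]
      ring_nf
    rw [this, setLIntegral_const, Real.volume_Ioo, sub_zero, ENNReal.ofReal_mul ht.le, mul_comm]
  have h3 : ∫⁻ x in Ioi t, ENNReal.ofReal (fR a b x) * ENNReal.ofReal (kR a b (t - x))
      = ENNReal.ofReal (Real.exp (-a * t) / b / (a + b)) := by
    have : ∫⁻ x in Ioi t, ENNReal.ofReal (fR a b x) * ENNReal.ofReal (kR a b (t - x))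
      = ∫⁻ x in Ioi t,
        ENNReal.ofReal ((0 * x + Real.exp (b * t) / b) * Real.exp (-(a + b) * x)) := by
      refine setLIntegral_congr_fun measurableSet_Ioi (fun x hx => ?_)
      have h1 : 0 < x := lt_trans ht hx
      have h3 : t - x < 0 := by simp only [mem_Ioi] at hx; linarith
      have h2 : ¬ 0 < t - x := by linarith
      simp only [fR, kR, h1, h2, h3, if_true, if_false]
      rw [← ENNReal.ofReal_mul (by positivity), zero_mul, zero_add, div_mul_eq_mul_div,
        ← Real.exp_add, ← mul_div_assoc, ← Real.exp_add]
      ring_nf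
    rw [this, lint_Ioi_exp (by positivity) _ _ _ (by intro x _; rw [zero_mul, zero_add]; positivity)]
    congr 1
    rw [show -a * t = b * t + -(a + b) * t by ring, Real.exp_add]
    simp; ring
  rw [h1, h2, h3, ← ENNReal.ofReal_add (by positivity) (by positivity),
    ← ENNReal.ofReal_add (by positivity) (by positivity)]
  congr 1
  field_simp; ring

lemma W_eq_Q_pos {a b t : ℝ} (ha : 0 < a) (hb : 0 < b) (ht : 0 < t) :
    A a b t * S b a (-t) + S a b t * A b a (-t)
      = ENNReal.ofReal ((a + b) / (a * b)) * Q a b t := by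
  rw [W_pos ha hb ht.le, Q_pos ha hb ht, ENNReal.ofReal_mul (by positivity)]

lemma W_eq_Q {a b t : ℝ} (ha : 0 < a) (hb : 0 < b) (ht : t ≠ 0) :
    A a b t * S b a (-t) + S a b t * A b a (-t)
      = ENNReal.ofReal ((a + b) / (a * b)) * Q a b t := by
  rcases lt_or_gt_of_ne ht with h | h
  · have := W_eq_Q_pos hb ha (t := -t) (by linarith)
    rw [neg_neg, Q_neg, add_comm b a, mul_comm b a] at this
    rw [← this]; ring
  · exact W_eq_Q_pos ha hb h


section Core

variable {ν lam : Measure ℝ} [IsProbabilityMeasure ν] [IsProbabilityMeasure lam]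

lemma pair_formula {G : ℝ → ℝ} (hG : MemLp G 2 ν) :
    ∫⁻ x, ∫⁻ x', ENNReal.ofReal ((G x - G x') ^ 2) ∂ν ∂ν
      = ENNReal.ofReal (2 * (∫ x, G x ^ 2 ∂ν - (∫ x, G x ∂ν) ^ 2)) := by
  have i1 : Integrable G ν := hG.integrable (by norm_num)
  have i2 : Integrable (fun x => G x ^ 2) ν := hG.integrable_sq
  have inner : ∀ x, ∫⁻ x', ENNReal.ofReal ((G x - G x') ^ 2) ∂ν
      = ENNReal.ofReal (G x ^ 2 - 2 * G x * (∫ x, G x ∂ν) + ∫ x, G x ^ 2 ∂ν) := by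
    intro x
    have j0 : Integrable (fun x' => G x ^ 2 - 2 * G x * G x') ν :=
      (integrable_const _).sub (i1.const_mul _)
    have j : Integrable (fun x' => (G x ^ 2 - 2 * G x * G x') + G x' ^ 2) ν := j0.add i2
    have e : (fun x' => (G x - G x') ^ 2) = fun x' => (G x ^ 2 - 2 * G x * G x') + G x' ^ 2 := by
      funext x'; ring
    rw [← ofReal_integral_eq_lintegral_ofReal (by rw [e]; exact j)
      (Filter.Eventually.of_forall fun x' => sq_nonneg _), e,
      integral_add j0 i2,
      integral_sub (integrable_const _) (i1.const_mul _), integral_const_mul]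
    simp
  have hnn : ∀ x, 0 ≤ G x ^ 2 - 2 * G x * (∫ x, G x ∂ν) + ∫ x, G x ^ 2 ∂ν := by
    intro x
    have : 0 ≤ ∫ x, (G x - ∫ x, G x ∂ν) ^ 2 ∂ν := integral_nonneg fun x => sq_nonneg _
    have e : (fun x' => (G x' - ∫ x, G x ∂ν) ^ 2)
        = fun x' => (G x' ^ 2 - 2 * (∫ x, G x ∂ν) * G x') + (∫ x, G x ∂ν) ^ 2 := by
      funext x'; ring
    have j0 : Integrable (fun x' => G x' ^ 2 - 2 * (∫ x, G x ∂ν) * G x') ν :=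
      i2.sub (i1.const_mul _)
    rw [e, integral_add j0 (integrable_const _),
      integral_sub i2 (i1.const_mul _), integral_const_mul] at this
    simp at this
    nlinarith [sq_nonneg (G x - ∫ x, G x ∂ν)]
  simp_rw [inner]
  have j : Integrable (fun x => G x ^ 2 - 2 * G x * (∫ x, G x ∂ν)) ν :=
    i2.sub ((i1.const_mul 2).mul_const _)
  have j2 : Integrable (fun x => G x ^ 2 - 2 * G x * (∫ x, G x ∂ν) + ∫ x, G x ^ 2 ∂ν) ν :=
    j.add (integrable_const _)
  rw [← ofReal_integral_eq_lintegral_ofReal j2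
    (Filter.Eventually.of_forall hnn), integral_add j (integrable_const _),
    integral_sub i2 ((i1.const_mul 2).mul_const _), integral_mul_const, integral_const_mul]
  congr 1
  simp; ring

lemma var_nn {G : ℝ → ℝ} (hG : MemLp G 2 ν) :
    0 ≤ ∫ x, G x ^ 2 ∂ν - (∫ x, G x ∂ν) ^ 2 := by
  have := variance_nonneg G ν
  rwa [variance_eq_sub hG] at this

lemma sq_lint_le (h : ℝ → ENNReal) (hh : Measurable h) (s t : ℝ) :
    (∫⁻ x in Ioo s t, h x) ^ 2 ≤ ENNReal.ofReal (t - s) * ∫⁻ x in Ioo s t, h x ^ 2 := by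
  have := ENNReal.lintegral_mul_le_Lp_mul_Lq (volume.restrict (Ioo s t))
    (Real.HolderConjugate.two_two) (f := fun _ => 1) (g := h) (by fun_prop) hh.aemeasurable
  simp only [Pi.mul_apply, one_mul, lintegral_const, Measure.restrict_apply_univ,
    Real.volume_Ioo, ENNReal.rpow_ofNat] at this
  calc _ ≤ _ := pow_le_pow_left' this 2
    _ = _ := by
      have hq : ∀ z : ENNReal, (z ^ (1 / 2 : ℝ)) ^ 2 = z := fun z => by
        rw [← ENNReal.rpow_natCast, ← ENNReal.rpow_mul]; norm_num
      rw [mul_pow, hq, hq, one_pow, one_mul]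

lemma incr {g g' : ℝ → ℝ} (hl : LocallyIntegrable g' volume)
    (hg : ∀ x : ℝ, g x = g 0 + ∫ t in (0:ℝ)..x, g' t) (hm : Measurable g') {x y : ℝ}
    (hxy : y ≤ x) :
    ENNReal.ofReal ((g x - g y) ^ 2)
      ≤ ENNReal.ofReal (x - y) * ∫⁻ t in Ioo y x, ENNReal.ofReal (g' t ^ 2) := by
  have ii : ∀ u v, IntervalIntegrable g' volume u v := fun u v =>
    (hl.integrableOn_isCompact isCompact_uIcc).intervalIntegrable
  have e : g x - g y = ∫ t in Ioo y x, g' t := by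
    rw [hg x, hg y, add_sub_add_left_eq_sub,
      intervalIntegral.integral_interval_sub_left (ii _ _) (ii _ _),
      intervalIntegral.integral_of_le hxy, integral_Ioc_eq_integral_Ioo]
  have h1 : ENNReal.ofReal ((g x - g y) ^ 2) = ‖g x - g y‖ₑ ^ 2 := by
    rw [← sq_abs, ENNReal.ofReal_pow (abs_nonneg _), Real.enorm_eq_ofReal_abs]
  have h2 : ∀ t, ENNReal.ofReal (g' t ^ 2) = ‖g' t‖ₑ ^ 2 := fun t => by
    rw [← sq_abs, ENNReal.ofReal_pow (abs_nonneg _), Real.enorm_eq_ofReal_abs]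
  simp_rw [h2]
  rw [h1]
  refine le_trans (pow_le_pow_left' ?_ 2) (sq_lint_le _ (by fun_prop) y x)
  rw [e]
  exact enorm_integral_le_lintegral_enorm _

/-- The one-sided kernel. -/
noncomputable def wp (φ : ℝ → ENNReal) (x y : ℝ) : ENNReal :=
  ENNReal.ofReal (x - y) * ∫⁻ t in Ioo y x, φ t

/-- The integrand of the kernel. -/
noncomputable def wi (φ : ℝ → ENNReal) (t x y : ℝ) : ENNReal :=
  φ t * (ENNReal.ofReal (x - t) * (Ioi (0:ℝ)).indicator 1 (t - y)
    + (Ioi (0:ℝ)).indicator 1 (x - t) * ENNReal.ofReal (t - y))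

lemma wp_eq (φ : ℝ → ENNReal) (hφ : Measurable φ) (x y : ℝ) : wp φ x y = ∫⁻ t, wi φ t x y := by
  unfold wp
  rw [← lintegral_const_mul _ hφ, ← lintegral_indicator measurableSet_Ioo]
  refine lintegral_congr fun t => ?_
  unfold wi
  by_cases h1 : y < t
  · by_cases h2 : t < x
    · rw [indicator_of_mem (show t ∈ Ioo y x from ⟨h1, h2⟩),
        indicator_of_mem (show t - y ∈ Ioi 0 from sub_pos.2 h1),
        indicator_of_mem (show x - t ∈ Ioi 0 from sub_pos.2 h2)]
      simp only [Pi.one_apply, mul_one, one_mul]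
      rw [← ENNReal.ofReal_add (by linarith) (by linarith), mul_comm]
      ring_nf
    · rw [indicator_of_notMem (fun h => h2 h.2),
        indicator_of_notMem (show x - t ∉ Ioi 0 from fun h => h2 (sub_pos.1 h)),
        ENNReal.ofReal_of_nonpos (by linarith : x - t ≤ 0)]
      simp
  · rw [indicator_of_notMem (fun h => h1 h.1),
        indicator_of_notMem (show t - y ∉ Ioi 0 from fun h => h1 (sub_pos.1 h)),
        ENNReal.ofReal_of_nonpos (by linarith : t - y ≤ 0)]
    simp

lemma measurable_ind : Measurable ((Ioi (0:ℝ)).indicator (1 : ℝ → ENNReal)) :=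
  measurable_one.indicator measurableSet_Ioi

lemma measurable_wi (φ : ℝ → ENNReal) (hφ : Measurable φ) :
    Measurable (fun p : ℝ × ℝ × ℝ => wi φ p.1 p.2.1 p.2.2) := by
  unfold wi
  have := measurable_ind
  fun_prop

lemma measurable_wp (φ : ℝ → ENNReal) (hφ : Measurable φ) :
    Measurable (fun p : ℝ × ℝ => wp φ p.1 p.2) := by
  simp_rw [wp_eq φ hφ]
  have h := measurable_wi φ hφ
  exact Measurable.lintegral_prod_right' (f := fun q : (ℝ × ℝ) × ℝ => wi φ q.2 q.1.1 q.1.2)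
    (h.comp (by fun_prop : Measurable fun q : (ℝ × ℝ) × ℝ => (q.2, q.1.1, q.1.2)))

lemma wp_tonelli (φ : ℝ → ENNReal) (hφ : Measurable φ) :
    ∫⁻ x, ∫⁻ y, wp φ x y ∂ν ∂ν = ∫⁻ t, φ t *
      ((∫⁻ x, ENNReal.ofReal (x - t) ∂ν) * (∫⁻ y, (Ioi (0:ℝ)).indicator 1 (t - y) ∂ν)
      + (∫⁻ x, (Ioi (0:ℝ)).indicator 1 (x - t) ∂ν) * (∫⁻ y, ENNReal.ofReal (t - y) ∂ν)) := by
  have h := measurable_wi φ hφ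
  have hi := measurable_ind
  simp_rw [wp_eq φ hφ]
  have s1 : ∀ x, ∫⁻ y, (∫⁻ t, wi φ t x y) ∂ν = ∫⁻ t, (∫⁻ y, wi φ t x y ∂ν) := fun x =>
    lintegral_lintegral_swap (f := fun y t => wi φ t x y)
      (h.comp (by fun_prop : Measurable fun q : ℝ × ℝ => (q.2, x, q.1))).aemeasurable
  simp_rw [s1]
  rw [lintegral_lintegral_swap]
  · refine lintegral_congr fun t => ?_
    unfold wi
    have : ∀ x, ∫⁻ y, φ t * (ENNReal.ofReal (x - t) * (Ioi (0:ℝ)).indicator 1 (t - y)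
      + (Ioi (0:ℝ)).indicator 1 (x - t) * ENNReal.ofReal (t - y)) ∂ν =
      φ t * (ENNReal.ofReal (x - t) * (∫⁻ y, (Ioi (0:ℝ)).indicator 1 (t - y) ∂ν)
      + (Ioi (0:ℝ)).indicator 1 (x - t) * ∫⁻ y, ENNReal.ofReal (t - y) ∂ν) := by
      intro x
      rw [lintegral_const_mul _ (by fun_prop), lintegral_add_left (by fun_prop),
        lintegral_const_mul _ (by fun_prop), lintegral_const_mul _ (by fun_prop)]
    simp_rw [this]
    rw [lintegral_const_mul _ (by fun_prop), lintegral_add_left (by fun_prop),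
        lintegral_mul_const _ (by fun_prop), lintegral_mul_const _ (by fun_prop)]
  · refine Measurable.aemeasurable ?_
    exact Measurable.lintegral_prod_right' (f := fun q : (ℝ × ℝ) × ℝ => wi φ q.1.2 q.1.1 q.2)
      (h.comp (by fun_prop : Measurable fun q : (ℝ × ℝ) × ℝ => (q.1.2, q.1.1, q.2)))

lemma wp_symm (φ : ℝ → ENNReal) (hφ : Measurable φ) :
    ∫⁻ x, ∫⁻ y, (wp φ x y + wp φ y x) ∂ν ∂ν = 2 * ∫⁻ x, ∫⁻ y, wp φ x y ∂ν ∂ν := by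
  have h := measurable_wp φ hφ
  have h' : Measurable (fun p : ℝ × ℝ => wp φ p.2 p.1) := h.comp measurable_swap
  have e : ∀ x, ∫⁻ y, (wp φ x y + wp φ y x) ∂ν = ∫⁻ y, wp φ x y ∂ν + ∫⁻ y, wp φ y x ∂ν :=
    fun x => lintegral_add_left (h.comp (by fun_prop : Measurable fun y : ℝ => (x, y))) _
  simp_rw [e]
  rw [lintegral_add_left h.lintegral_prod_right', two_mul]
  congr 1
  rw [lintegral_lintegral_swap h'.aemeasurable]

lemma core_upper (s : ℝ) (hs : 0 ≤ s)
    (key : ∀ φ : ℝ → ENNReal, Measurable φ →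
      ∫⁻ x, ∫⁻ y, wp φ x y ∂ν ∂ν = ENNReal.ofReal s * ∫⁻ t, φ t ∂lam)
    {g g' : ℝ → ℝ} (hl : LocallyIntegrable g' volume)
    (hg : ∀ x : ℝ, g x = g 0 + ∫ t in (0:ℝ)..x, g' t) (hm : Measurable g')
    (h1 : MemLp g 2 ν) (h2 : Integrable (fun t => g' t ^ 2) lam) :
    ∫ x, g x ^ 2 ∂ν - (∫ x, g x ∂ν) ^ 2 ≤ s * ∫ t, g' t ^ 2 ∂lam := by
  have hφ : Measurable fun t => ENNReal.ofReal (g' t ^ 2) := by fun_prop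
  have hle : ∫⁻ x, ∫⁻ x', ENNReal.ofReal ((g x - g x') ^ 2) ∂ν ∂ν ≤
      ∫⁻ x, ∫⁻ y, (wp (fun t => ENNReal.ofReal (g' t ^ 2)) x y
        + wp (fun t => ENNReal.ofReal (g' t ^ 2)) y x) ∂ν ∂ν := by
    refine lintegral_mono fun x => lintegral_mono fun y => ?_
    rcases le_total y x with h | h
    · exact le_add_right (incr hl hg hm h)
    · rw [show (g x - g y) ^ 2 = (g y - g x) ^ 2 by ring]
      exact le_add_left (incr hl hg hm h)
  rw [pair_formula h1, wp_symm _ hφ, key _ hφ,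
    ← ofReal_integral_eq_lintegral_ofReal h2 (Filter.Eventually.of_forall fun x => sq_nonneg _),
    ← ENNReal.ofReal_mul hs, show (2 : ENNReal) = ENNReal.ofReal 2 by simp,
    ← ENNReal.ofReal_mul (by norm_num)] at hle
  have hnn : 0 ≤ ∫ t, g' t ^ 2 ∂lam := integral_nonneg fun t => sq_nonneg _
  have := (ENNReal.ofReal_le_ofReal_iff (by positivity)).1 hle
  linarith

lemma core_id_lint (s : ℝ) 
    (key : ∀ φ : ℝ → ENNReal, Measurable φ →
      ∫⁻ x, ∫⁻ y, wp φ x y ∂ν ∂ν = ENNReal.ofReal s * ∫⁻ t, φ t ∂lam) :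
    ∫⁻ x, ∫⁻ y, ENNReal.ofReal ((x - y) ^ 2) ∂ν ∂ν = ENNReal.ofReal (2 * s) := by
  have := key (fun _ => 1) measurable_const
  simp only [lintegral_const, measure_univ, mul_one] at this
  rw [ENNReal.ofReal_mul (by norm_num), ← this, show ENNReal.ofReal 2 = 2 by simp,
    ← wp_symm _ measurable_const]
  refine lintegral_congr fun x => lintegral_congr fun y => ?_
  unfold wp
  simp only [lintegral_const, Measure.restrict_apply_univ, Real.volume_Ioo, one_mul]
  rcases le_total y x with h | h
  · rw [ENNReal.ofReal_of_nonpos (by linarith : y - x ≤ 0), mul_zero, add_zero,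
      ← ENNReal.ofReal_mul (by linarith)]
    ring_nf
  · rw [ENNReal.ofReal_of_nonpos (by linarith : x - y ≤ 0), mul_zero, zero_add,
      ← ENNReal.ofReal_mul (by linarith)]
    ring_nf

lemma core_id_memLp (s : ℝ) 
    (key : ∀ φ : ℝ → ENNReal, Measurable φ →
      ∫⁻ x, ∫⁻ y, wp φ x y ∂ν ∂ν = ENNReal.ofReal s * ∫⁻ t, φ t ∂lam) :
    MemLp (fun x : ℝ => x) 2 ν := by
  have h := core_id_lint s key
  have hm : Measurable fun x : ℝ => ∫⁻ y, ENNReal.ofReal ((x - y) ^ 2) ∂ν :=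
    Measurable.lintegral_prod_right' (f := fun p : ℝ × ℝ => ENNReal.ofReal ((p.1 - p.2) ^ 2))
      (by fun_prop)
  have h2 := ae_lt_top hm (by rw [h]; exact ENNReal.ofReal_ne_top)
  obtain ⟨x, hx⟩ := h2.exists
  have hi : Integrable (fun y => (x - y) ^ 2) ν := by
    refine ⟨by fun_prop, ?_⟩
    rw [hasFiniteIntegral_iff_ofReal (Filter.Eventually.of_forall fun y => sq_nonneg _)]
    exact hx
  have h3 : MemLp (fun y => x - y) 2 ν :=
    (memLp_two_iff_integrable_sq (by fun_prop)).2 hi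
  have h4 := (memLp_const x).sub h3
  refine h4.congr_norm (by fun_prop) ?_
  exact Filter.Eventually.of_forall fun y => by simp

lemma core (s : ℝ) (hs : 0 ≤ s)
    (key : ∀ φ : ℝ → ENNReal, Measurable φ →
      ∫⁻ x, ∫⁻ y, wp φ x y ∂ν ∂ν = ENNReal.ofReal s * ∫⁻ t, φ t ∂lam)
    {g g' : ℝ → ℝ} (hl : LocallyIntegrable g' volume)
    (hg : ∀ x : ℝ, g x = g 0 + ∫ t in (0:ℝ)..x, g' t) (hm : Measurable g')
    (h1 : MemLp g 2 ν) (h2 : Integrable (fun t => g' t ^ 2) lam) :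
    s * (∫ t, g' t ∂lam) ^ 2 ≤ ∫ x, g x ^ 2 ∂ν - (∫ x, g x ∂ν) ^ 2 ∧
    ∫ x, g x ^ 2 ∂ν - (∫ x, g x ∂ν) ^ 2 ≤ s * ∫ t, g' t ^ 2 ∂lam := by
  refine ⟨?_, core_upper s hs key hl hg hm h1 h2⟩
  have hid := core_id_memLp s key
  have hvid : ∫ x, x ^ 2 ∂ν - (∫ x, x ∂ν) ^ 2 = s := by
    have e1 := core_id_lint s key
    rw [pair_formula hid] at e1
    have := (ENNReal.ofReal_eq_ofReal_iff (mul_nonneg zero_le_two (var_nn hid))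
      (by positivity)).1 e1
    linarith
  have hg'2 : MemLp g' 2 lam := (memLp_two_iff_integrable_sq (by fun_prop)).2 h2
  have i' : Integrable g' lam := hg'2.integrable (by norm_num)
  have ii : ∀ u v, IntervalIntegrable g' volume u v := fun u v =>
    (hl.integrableOn_isCompact isCompact_uIcc).intervalIntegrable
  have ig : Integrable g ν := h1.integrable (by norm_num)
  have ix : Integrable (fun x : ℝ => x) ν := hid.integrable (by norm_num)
  have ixg : Integrable (fun x => x * g x) ν := hid.integrable_mul h1
  have mL : ∀ r : ℝ, MemLp (fun x => g x + r * x) 2 ν := fun r => h1.add (hid.const_mul r)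
  have varL : ∀ r : ℝ, ∫ x, (g x + r * x) ^ 2 ∂ν - (∫ x, (g x + r * x) ∂ν) ^ 2
      = (∫ x, g x ^ 2 ∂ν - (∫ x, g x ∂ν) ^ 2)
        + 2 * r * (∫ x, x * g x ∂ν - (∫ x, x ∂ν) * ∫ x, g x ∂ν) + r ^ 2 * s := by
    intro r
    have e : (fun x => (g x + r * x) ^ 2)
        = fun x => (g x ^ 2 + 2 * r * (x * g x)) + r ^ 2 * x ^ 2 := by funext x; ring
    have j0 : Integrable (fun x => g x ^ 2 + 2 * r * (x * g x)) ν :=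
      h1.integrable_sq.add (ixg.const_mul _)
    rw [e, integral_add j0 (hid.integrable_sq.const_mul _),
      integral_add h1.integrable_sq (ixg.const_mul _), integral_add ig (ix.const_mul _),
      integral_const_mul, integral_const_mul, integral_const_mul, ← hvid]
    ring
  have up : ∀ r : ℝ, (∫ x, g x ^ 2 ∂ν - (∫ x, g x ∂ν) ^ 2)
        + 2 * r * (∫ x, x * g x ∂ν - (∫ x, x ∂ν) * ∫ x, g x ∂ν) + r ^ 2 * s
      ≤ s * (∫ t, g' t ^ 2 ∂lam + 2 * r * ∫ t, g' t ∂lam + r ^ 2) := by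
    intro r
    have e : (fun t => (g' t + r) ^ 2) = fun t => (g' t ^ 2 + 2 * r * g' t) + r ^ 2 := by
      funext t; ring
    have j0 : Integrable (fun t => g' t ^ 2 + 2 * r * g' t) lam := h2.add (i'.const_mul _)
    have hi : Integrable (fun t => (g' t ^ 2 + 2 * r * g' t) + r ^ 2) lam :=
      j0.add (integrable_const _)
    have := core_upper (g := fun x => g x + r * x) (g' := fun t => g' t + r) s hs key
      (hl.add (locallyIntegrable_const r)) (by
        intro x
        rw [intervalIntegral.integral_add (ii _ _) (by simp), hg x]
        simp; ring) (by fun_prop) (mL r) (by rw [e]; exact hi)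
    rw [varL, e, integral_add j0 (integrable_const _),
      integral_add h2 (i'.const_mul _), integral_const_mul] at this
    simpa using this
  have low := var_nn (mL (-(∫ t, g' t ∂lam)))
  rw [varL] at low
  generalize (∫ x, g x ^ 2 ∂ν - (∫ x, g x ∂ν) ^ 2) = V at *
  generalize (∫ x, x * g x ∂ν - (∫ x, x ∂ν) * ∫ x, g x ∂ν) = C at *
  generalize (∫ t, g' t ∂lam) = m at *
  generalize (∫ t, g' t ^ 2 ∂lam) = P at *
  have hC : C = s * m := by
    by_contra hne
    have hd : C - s * m ≠ 0 := sub_ne_zero.2 hne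
    have := up ((s * P - V + 1) / (2 * (C - s * m)))
    have e : 2 * ((s * P - V + 1) / (2 * (C - s * m))) * (C - s * m) = s * P - V + 1 := by
      field_simp
    nlinarith
  subst hC
  nlinarith

end Core


lemma conv_law {a b c d : ℝ} (hc : 0 ≤ c) (hd : 0 ≤ d) (φ : ℝ → ENNReal) (hφ : Measurable φ) :
    ∫⁻ x, ∫⁻ y, φ (x + y) ∂(volume.withDensity fun y => ENNReal.ofReal (d * kR a b y))
      ∂(volume.withDensity fun x => ENNReal.ofReal (c * fR a b x))
      = ENNReal.ofReal c * ENNReal.ofReal d * ∫⁻ t, φ t * Q a b t := by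
  have inner : ∀ x, ∫⁻ y, φ (x + y) ∂(volume.withDensity fun y => ENNReal.ofReal (d * kR a b y))
      = ∫⁻ t, ENNReal.ofReal (d * kR a b (t - x)) * φ t := by
    intro x
    rw [lintegral_withDensity_eq_lintegral_mul _ (by fun_prop) (by fun_prop),
      ← lintegral_add_left_eq_self (fun t => ENNReal.ofReal (d * kR a b (t - x)) * φ t) x]
    refine lintegral_congr fun y => ?_
    simp
  simp_rw [inner]
  have hm : Measurable fun p : ℝ × ℝ => ENNReal.ofReal (d * kR a b (p.2 - p.1)) * φ p.2 := by
    have := measurable_kR a b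
    fun_prop
  rw [lintegral_withDensity_eq_lintegral_mul _ (by fun_prop) hm.lintegral_prod_right']
  simp only [Pi.mul_apply]
  have e : ∀ x, ENNReal.ofReal (c * fR a b x) * ∫⁻ t, ENNReal.ofReal (d * kR a b (t - x)) * φ t
      = ∫⁻ t, ENNReal.ofReal (c * fR a b x) * (ENNReal.ofReal (d * kR a b (t - x)) * φ t) :=
    fun x => (lintegral_const_mul _
      (hm.comp (by fun_prop : Measurable fun t : ℝ => (x, t)))).symm
  simp_rw [e]
  rw [lintegral_lintegral_swap]
  · have hq : Measurable fun t => φ t * Q a b t := by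
      refine hφ.mul ?_
      refine Measurable.lintegral_prod_right'
        (f := fun p : ℝ × ℝ => ENNReal.ofReal (fR a b p.2) * ENNReal.ofReal (kR a b (p.1 - p.2))) ?_
      have := measurable_kR a b
      have := measurable_fR a b
      fun_prop
    rw [← lintegral_const_mul _ hq]
    refine lintegral_congr fun t => ?_
    unfold Q
    have hk := measurable_kR a b
    rw [← mul_assoc, ← lintegral_const_mul _ (by fun_prop)]
    refine lintegral_congr fun x => ?_
    rw [ENNReal.ofReal_mul hc, ENNReal.ofReal_mul hd]
    ring
  · refine Measurable.aemeasurable ?_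
    have := measurable_fR a b
    exact Measurable.mul (by fun_prop) hm

lemma tails {a b c : ℝ} (hc : 0 ≤ c) (t : ℝ) :
    (∫⁻ x, ENNReal.ofReal (x - t) ∂(volume.withDensity fun x => ENNReal.ofReal (c * fR a b x))
      = ENNReal.ofReal c * A a b t) ∧
    (∫⁻ x, (Ioi (0:ℝ)).indicator 1 (x - t)
        ∂(volume.withDensity fun x => ENNReal.ofReal (c * fR a b x))
      = ENNReal.ofReal c * S a b t) := by
  have hi := measurable_ind
  constructor
  · rw [lintegral_withDensity_eq_lintegral_mul _ (by fun_prop) (by fun_prop)]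
    unfold A
    rw [← lintegral_const_mul _ (by fun_prop), ← lintegral_indicator measurableSet_Ioi]
    refine lintegral_congr fun x => ?_
    by_cases h : t < x
    · rw [indicator_of_mem (show x ∈ Ioi t from h), ENNReal.ofReal_mul (by linarith)]
      simp only [Pi.mul_apply]
      rw [ENNReal.ofReal_mul hc]
      ring
    · rw [indicator_of_notMem (show x ∉ Ioi t from h)]
      simp only [Pi.mul_apply]
      rw [ENNReal.ofReal_of_nonpos (by linarith : x - t ≤ 0), mul_zero]
  · rw [lintegral_withDensity_eq_lintegral_mul _ (by fun_prop) (by fun_prop)]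
    unfold S
    rw [← lintegral_const_mul _ (by fun_prop), ← lintegral_indicator measurableSet_Ioi]
    refine lintegral_congr fun x => ?_
    simp only [Pi.mul_apply]
    by_cases h : t < x
    · rw [indicator_of_mem (show x ∈ Ioi t from h),
        indicator_of_mem (show x - t ∈ Ioi 0 from sub_pos.2 h), ENNReal.ofReal_mul hc]
      simp
    · rw [indicator_of_notMem (show x ∉ Ioi t from h),
        indicator_of_notMem (show x - t ∉ Ioi 0 from fun h' => h (sub_pos.1 h')), mul_zero]

lemma density_neg {a b c : ℝ} (h : ℝ → ENNReal) (hh : Measurable h) :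
    ∫⁻ y, h y ∂(volume.withDensity fun x => ENNReal.ofReal (c * fR a b x))
      = ∫⁻ y, h (-y) ∂(volume.withDensity fun x => ENNReal.ofReal (c * fR b a x)) := by
  rw [lintegral_withDensity_eq_lintegral_mul _ (by fun_prop) hh,
    lintegral_withDensity_eq_lintegral_mul _ (by fun_prop) (by fun_prop),
    ← lintegral_neg_eq_self]
  refine lintegral_congr fun x => ?_
  simp only [Pi.mul_apply, fR_neg]

lemma tails' {a b c : ℝ} (hc : 0 ≤ c) (t : ℝ) :
    (∫⁻ x, ENNReal.ofReal (t - x) ∂(volume.withDensity fun x => ENNReal.ofReal (c * fR a b x))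
      = ENNReal.ofReal c * A b a (-t)) ∧
    (∫⁻ x, (Ioi (0:ℝ)).indicator 1 (t - x)
        ∂(volume.withDensity fun x => ENNReal.ofReal (c * fR a b x))
      = ENNReal.ofReal c * S b a (-t)) := by
  have hi := measurable_ind
  rw [← (tails (a := b) (b := a) hc (-t)).1, ← (tails (a := b) (b := a) hc (-t)).2,
    density_neg _ (by fun_prop), density_neg (a := a) _ (by fun_prop)]
  simp only [sub_neg_eq_add, add_comm, and_self]

lemma main_aux {Ω : Type*} [MeasureSpace Ω] [IsProbabilityMeasure (ℙ : Measure Ω)]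
    (a b : ℝ) (ha : 0 < a) (hb : 0 < b)
    (X Y₁ : Ω → ℝ) (hX : Measurable X) (hY₁ : Measurable Y₁)
    (hindep : IndepFun X Y₁ ℙ)
    (hXlaw : Measure.map X ℙ
      = volume.withDensity (fun x => ENNReal.ofReal ((a * b / (a + b)) * fR a b x)))
    (hY₁law : Measure.map Y₁ ℙ
      = volume.withDensity (fun y => ENNReal.ofReal
          ((a ^ 2 * b ^ 2 / (a ^ 2 + b ^ 2)) * kR a b y)))
    (g g' : ℝ → ℝ)
    (hg'loc : LocallyIntegrable g' volume)
    (hg : ∀ x : ℝ, g x = g 0 + ∫ t in (0:ℝ)..x, g' t)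
    (hint1 : Integrable (fun ω => (g' (X ω + Y₁ ω)) ^ 2) ℙ)
    (hint2 : Integrable (fun ω => (g (X ω)) ^ 2) ℙ) :
    ((a ^ 2 + b ^ 2) / (a ^ 2 * b ^ 2)) * (∫ ω, g' (X ω + Y₁ ω) ∂ℙ) ^ 2
        ≤ (∫ ω, (g (X ω)) ^ 2 ∂ℙ) - (∫ ω, g (X ω) ∂ℙ) ^ 2
      ∧ (∫ ω, (g (X ω)) ^ 2 ∂ℙ) - (∫ ω, g (X ω) ∂ℙ) ^ 2
        ≤ ((a ^ 2 + b ^ 2) / (a ^ 2 * b ^ 2)) * ∫ ω, (g' (X ω + Y₁ ω)) ^ 2 ∂ℙ := by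
  have hXY : Measurable fun ω => X ω + Y₁ ω := hX.add hY₁
  set c := a * b / (a + b) with hcdef
  set d := a ^ 2 * b ^ 2 / (a ^ 2 + b ^ 2) with hddef
  have hc : 0 ≤ c := by positivity
  have hd : 0 ≤ d := by positivity
  have hprobX : IsProbabilityMeasure (Measure.map X ℙ) :=
    Measure.isProbabilityMeasure_map hX.aemeasurable
  have hprobY : IsProbabilityMeasure (Measure.map Y₁ ℙ) :=
    Measure.isProbabilityMeasure_map hY₁.aemeasurable
  have hprobZ : IsProbabilityMeasure (Measure.map (fun ω => X ω + Y₁ ω) ℙ) :=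
    Measure.isProbabilityMeasure_map hXY.aemeasurable
  -- the law of the sum
  have lawZ : ∀ φ : ℝ → ENNReal, Measurable φ →
      ∫⁻ t, φ t ∂(Measure.map (fun ω => X ω + Y₁ ω) ℙ)
        = ENNReal.ofReal c * ENNReal.ofReal d * ∫⁻ t, φ t * Q a b t := by
    intro φ hφ
    have hprod := (indepFun_iff_map_prod_eq_prod_map_map hX.aemeasurable hY₁.aemeasurable).1 hindep
    have hφ2 : Measurable fun p : ℝ × ℝ => φ (p.1 + p.2) := by fun_prop
    rw [lintegral_map hφ hXY]
    have := lintegral_map (μ := (ℙ : Measure Ω)) hφ2 (hX.prodMk hY₁)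
    rw [← this, hprod, lintegral_prod _ hφ2.aemeasurable]
    simp only
    rw [hXlaw, hY₁law, conv_law hc hd φ hφ]
  have hac : Measure.map (fun ω => X ω + Y₁ ω) ℙ ≪ volume := by
    refine Measure.AbsolutelyContinuous.mk fun s hs h0 => ?_
    rw [← lintegral_indicator_one hs, lawZ _ (measurable_one.indicator hs)]
    have : ∫⁻ t, s.indicator 1 t * Q a b t = 0 := by
      have e : ∀ᵐ t, s.indicator 1 t * Q a b t = 0 := by
        filter_upwards [measure_eq_zero_iff_ae_notMem.1 h0] with t ht
        simp [ht]
      rw [lintegral_congr_ae e]; simp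
    rw [this, mul_zero]
  have key : ∀ φ : ℝ → ENNReal, Measurable φ →
      ∫⁻ x, ∫⁻ y, wp φ x y ∂(Measure.map X ℙ) ∂(Measure.map X ℙ)
        = ENNReal.ofReal ((a ^ 2 + b ^ 2) / (a ^ 2 * b ^ 2))
          * ∫⁻ t, φ t ∂(Measure.map (fun ω => X ω + Y₁ ω) ℙ) := by
    intro φ hφ
    rw [lawZ φ hφ, wp_tonelli φ hφ, hXlaw]
    have e : ∀ᵐ t : ℝ, φ t *
      ((∫⁻ x, ENNReal.ofReal (x - t) ∂(volume.withDensity fun x => ENNReal.ofReal (c * fR a b x)))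
        * (∫⁻ y, (Ioi (0:ℝ)).indicator 1 (t - y)
          ∂(volume.withDensity fun x => ENNReal.ofReal (c * fR a b x)))
      + (∫⁻ x, (Ioi (0:ℝ)).indicator 1 (x - t)
          ∂(volume.withDensity fun x => ENNReal.ofReal (c * fR a b x)))
        * (∫⁻ y, ENNReal.ofReal (t - y)
          ∂(volume.withDensity fun x => ENNReal.ofReal (c * fR a b x))))
      = ENNReal.ofReal c * (φ t * Q a b t) := by
      filter_upwards [Measure.ae_ne volume (0:ℝ)] with t ht
      rw [(tails hc t).1, (tails hc t).2, (tails' hc t).1, (tails' hc t).2]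
      have h1 : ENNReal.ofReal c * ENNReal.ofReal ((a + b) / (a * b)) = 1 := by
        rw [← ENNReal.ofReal_mul hc, hcdef]
        rw [show a * b / (a + b) * ((a + b) / (a * b)) = 1 by field_simp]
        simp
      calc _ = ENNReal.ofReal c * ENNReal.ofReal c * φ t *
            (A a b t * S b a (-t) + S a b t * A b a (-t)) := by ring
        _ = (ENNReal.ofReal c * ENNReal.ofReal ((a + b) / (a * b))) *
            (ENNReal.ofReal c * (φ t * Q a b t)) := by rw [W_eq_Q ha hb ht]; ring
        _ = _ := by rw [h1, one_mul]
    rw [lintegral_congr_ae e, lintegral_const_mul' _ _ ENNReal.ofReal_ne_top]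
    have h2 : ENNReal.ofReal ((a ^ 2 + b ^ 2) / (a ^ 2 * b ^ 2)) * ENNReal.ofReal d = 1 := by
      rw [← ENNReal.ofReal_mul (by positivity), hddef]
      rw [show (a ^ 2 + b ^ 2) / (a ^ 2 * b ^ 2) * (a ^ 2 * b ^ 2 / (a ^ 2 + b ^ 2)) = 1 by
        field_simp]
      simp
    calc _ = (ENNReal.ofReal ((a ^ 2 + b ^ 2) / (a ^ 2 * b ^ 2)) * ENNReal.ofReal d) *
          (ENNReal.ofReal c * ∫⁻ t, φ t * Q a b t) := by rw [h2, one_mul]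
      _ = _ := by ring
  -- measurable version of `g'`
  have hsm := hg'loc.aestronglyMeasurable
  set h' := hsm.mk g' with hh'
  have hm : Measurable h' := hsm.stronglyMeasurable_mk.measurable
  have hae : g' =ᵐ[volume] h' := hsm.ae_eq_mk
  have haeZ : ∀ᵐ ω ∂(ℙ : Measure Ω), g' (X ω + Y₁ ω) = h' (X ω + Y₁ ω) :=
    ae_of_ae_map hXY.aemeasurable (hac.ae_le hae)
  have hl' : LocallyIntegrable h' volume := fun x => by
    obtain ⟨u, hu, hi⟩ := hg'loc x
    exact ⟨u, hu, hi.congr (ae_restrict_of_ae hae)⟩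
  have hg2 : ∀ x : ℝ, g x = g 0 + ∫ t in (0:ℝ)..x, h' t := by
    intro x
    rw [hg x]
    congr 1
    exact intervalIntegral.integral_congr_ae (hae.mono fun t ht _ => ht)
  have ii : ∀ u v, IntervalIntegrable g' volume u v := fun u v =>
    (hg'loc.integrableOn_isCompact isCompact_uIcc).intervalIntegrable
  have hgc : Continuous g := by
    have : g = fun x => g 0 + ∫ t in (0:ℝ)..x, g' t := funext hg
    rw [this]
    exact continuous_const.add (intervalIntegral.continuous_primitive ii 0)
  have hgm : Measurable g := hgc.measurable
  have hg1 : MemLp g 2 (Measure.map X ℙ) := by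
    rw [memLp_two_iff_integrable_sq (by fun_prop)]
    exact (integrable_map_measure (by fun_prop) hX.aemeasurable).2 hint2
  have hi1 : Integrable (fun t => h' t ^ 2) (Measure.map (fun ω => X ω + Y₁ ω) ℙ) := by
    refine (integrable_map_measure (by fun_prop) hXY.aemeasurable).2 ?_
    exact hint1.congr (haeZ.mono fun ω hω => by simp [hω])
  have := core ((a ^ 2 + b ^ 2) / (a ^ 2 * b ^ 2)) (by positivity) key hl' hg2 hm hg1 hi1
  rw [integral_map hXY.aemeasurable (by fun_prop), integral_map hXY.aemeasurable (by fun_prop),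
    integral_map hX.aemeasurable (by fun_prop), integral_map hX.aemeasurable (by fun_prop)] at this
  rw [integral_congr_ae haeZ, integral_congr_ae
    (haeZ.mono fun ω hω => by simp only [hω] :
      (fun ω => g' (X ω + Y₁ ω) ^ 2) =ᵐ[ℙ] fun ω => h' (X ω + Y₁ ω) ^ 2)]
  exact this

end CacoullosAux

/-- **Cacoullos-type variance bounds for the two-sided exponential distribution.**
If `X` has density `(ab/(a+b))(e^{-ax} 1_{(0,∞)}(x) + e^{bx} 1_{(-∞,0)}(x))` and `Y₁`,
independent of `X`, has density
`(a²b²/(a²+b²))((e^{-ay}/a) 1_{(0,∞)}(y) + (e^{by}/b) 1_{(-∞,0)}(y))`, then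
`((a²+b²)/(a²b²)) (E[g'(X+Y₁)])² ≤ Var(g(X)) ≤ ((a²+b²)/(a²b²)) E[(g'(X+Y₁))²]`. -/
theorem cacoullos_variance_bounds_two_sided_exponential
    {Ω : Type*} [MeasureSpace Ω] [IsProbabilityMeasure (ℙ : Measure Ω)]
    (a b : ℝ) (ha : 0 < a) (hb : 0 < b)
    (X Y₁ : Ω → ℝ) (hX : Measurable X) (hY₁ : Measurable Y₁)
    (hindep : IndepFun X Y₁ ℙ)
    -- X has the two-sided exponential density
    (hXlaw : Measure.map X ℙ
      = volume.withDensity (fun x => ENNReal.ofReal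
          ((a * b / (a + b)) *
            (Ioi (0:ℝ)).indicator (fun x => Real.exp (-a * x)) x
           + (a * b / (a + b)) *
            (Iio (0:ℝ)).indicator (fun x => Real.exp (b * x)) x)))
    -- Y₁ has the density f₁
    (hY₁law : Measure.map Y₁ ℙ
      = volume.withDensity (fun y => ENNReal.ofReal
          ((a ^ 2 * b ^ 2 / (a ^ 2 + b ^ 2)) *
            (Ioi (0:ℝ)).indicator (fun y => Real.exp (-a * y) / a) y
           + (a ^ 2 * b ^ 2 / (a ^ 2 + b ^ 2)) *
            (Iio (0:ℝ)).indicator (fun y => Real.exp (b * y) / b) y)))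
    -- g is absolutely continuous with derivative g'
    (g g' : ℝ → ℝ)
    (hg'loc : LocallyIntegrable g' volume)
    (hg : ∀ x : ℝ, g x = g 0 + ∫ t in (0:ℝ)..x, g' t)
    -- integrability assumptions : E[(g'(X+Y₁))²] < ∞ and E[g(X)²] < ∞
    (hint1 : Integrable (fun ω => (g' (X ω + Y₁ ω)) ^ 2) ℙ)
    (hint2 : Integrable (fun ω => (g (X ω)) ^ 2) ℙ) :
    ((a ^ 2 + b ^ 2) / (a ^ 2 * b ^ 2)) * (∫ ω, g' (X ω + Y₁ ω) ∂ℙ) ^ 2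
        ≤ (∫ ω, (g (X ω)) ^ 2 ∂ℙ) - (∫ ω, g (X ω) ∂ℙ) ^ 2
      ∧ (∫ ω, (g (X ω)) ^ 2 ∂ℙ) - (∫ ω, g (X ω) ∂ℙ) ^ 2
        ≤ ((a ^ 2 + b ^ 2) / (a ^ 2 * b ^ 2)) * ∫ ω, (g' (X ω + Y₁ ω)) ^ 2 ∂ℙ := by
  have hX2 : Measure.map X ℙ = volume.withDensity
      (fun x => ENNReal.ofReal ((a * b / (a + b)) * CacoullosAux.fR a b x)) := by
    rw [hXlaw]
    refine withDensity_congr_ae ?_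
    filter_upwards [Measure.ae_ne volume (0:ℝ)] with x hx
    congr 1
    rcases lt_or_gt_of_ne hx with h | h
    · have h' : ¬ 0 < x := by linarith
      simp [CacoullosAux.fR, h, h', indicator, mem_Ioi, mem_Iio]
    · have h' : ¬ x < 0 := by linarith
      simp [CacoullosAux.fR, h, h', indicator, mem_Ioi, mem_Iio]
  have hY2 : Measure.map Y₁ ℙ = volume.withDensity (fun y => ENNReal.ofReal
      ((a ^ 2 * b ^ 2 / (a ^ 2 + b ^ 2)) * CacoullosAux.kR a b y)) := by
    rw [hY₁law]
    refine withDensity_congr_ae ?_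
    filter_upwards [Measure.ae_ne volume (0:ℝ)] with x hx
    congr 1
    rcases lt_or_gt_of_ne hx with h | h
    · have h' : ¬ 0 < x := by linarith
      simp [CacoullosAux.kR, h, h', indicator, mem_Ioi, mem_Iio]
    · have h' : ¬ x < 0 := by linarith
      simp [CacoullosAux.kR, h, h', indicator, mem_Ioi, mem_Iio]
  exact CacoullosAux.main_aux a b ha hb X Y₁ hX hY₁ hindep hX2 hY2 g g' hg'loc hg hint1 hint2
end

section
/- Let X have the Laplace distribution La(μ₀, δ²) and let Y be independent of X with the Laplace distribution La(0, δ²). Then for every absolutely continuous function g : ℝ → ℝ with E[|g′(X+Y)|] < ∞ and E[|X g(X)|] < ∞, one has Cov(X, g(X)) = 2δ² · E[g′(X+Y)]. -/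
open MeasureTheory ProbabilityTheory Set

lemma lap_tail (δ : ℝ) (hδ : 0 < δ) (u : ℝ) (hu : 0 ≤ u) :
    IntegrableOn (fun s : ℝ => s * Real.exp (-s / δ)) (Ioi u) ∧
      ∫ s in Ioi u, s * Real.exp (-s / δ) = δ * (u + δ) * Real.exp (-u / δ) := by
  have hd : ∀ x ∈ Ici u, HasDerivAt (fun s : ℝ => -(δ * (s + δ) * Real.exp (-s / δ)))
      (x * Real.exp (-x / δ)) x := by
    intro x _
    have h1 : HasDerivAt (fun s : ℝ => -s / δ) (-1 / δ) x := ((hasDerivAt_id x).neg).div_const δ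
    have h2 := ((((hasDerivAt_id x).add_const δ).const_mul δ).mul h1.exp).neg
    refine h2.congr_deriv ?_
    simp only [id]
    field_simp
    ring
  have hpos : ∀ x ∈ Ioi u, 0 ≤ x * Real.exp (-x / δ) := fun x hx =>
    mul_nonneg (hu.trans (le_of_lt hx)) (Real.exp_pos _).le
  have ht : Filter.Tendsto (fun s : ℝ => -(δ * (s + δ) * Real.exp (-s / δ))) Filter.atTop (nhds 0) := by
    have h0 := Real.tendsto_pow_mul_exp_neg_atTop_nhds_zero 0
    have h1 := Real.tendsto_pow_mul_exp_neg_atTop_nhds_zero 1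
    have hs : Filter.Tendsto (fun s : ℝ => s / δ) Filter.atTop Filter.atTop :=
      Filter.tendsto_id.atTop_div_const hδ
    have := (((h1.comp hs).const_mul (δ^2)).add ((h0.comp hs).const_mul (δ^2))).neg
    simp only [mul_zero, add_zero, neg_zero] at this
    refine this.congr fun s => ?_
    simp only [Function.comp, neg_div]
    field_simp
    try ring
  refine ⟨integrableOn_Ioi_deriv_of_nonneg' hd hpos ht, ?_⟩
  rw [integral_Ioi_of_hasDerivAt_of_nonneg' hd hpos ht]
  ring

lemma lap_half (δ : ℝ) (hδ : 0 < δ) (G' : ℝ → ℝ) (hm : AEStronglyMeasurable G' volume)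
    (hi : IntegrableOn (fun u => G' u * ((u + δ) * Real.exp (-u / δ))) (Ioi 0)) :
    IntegrableOn (fun s => s * Real.exp (-s / δ) * ∫ u in (0:ℝ)..s, G' u) (Ioi 0) ∧
    ∫ s in Ioi 0, s * Real.exp (-s / δ) * (∫ u in (0:ℝ)..s, G' u)
      = δ * ∫ u in Ioi 0, G' u * ((u + δ) * Real.exp (-u / δ)) := by
  set μ : Measure ℝ := volume.restrict (Ioi 0) with hμ
  let F : ℝ → ℝ → ℝ := fun u s => (Ioi u).indicator (fun s => s * Real.exp (-s / δ)) s * G' u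
  have hFm : AEStronglyMeasurable (Function.uncurry F) (μ.prod μ) := by
    refine AEStronglyMeasurable.mul ?_ (hm.restrict.comp_fst)
    have : (fun p : ℝ × ℝ => (Ioi p.1).indicator (fun s => s * Real.exp (-s / δ)) p.2)
      = {p : ℝ × ℝ | p.1 < p.2}.indicator (fun p => p.2 * Real.exp (-p.2 / δ)) := by
      ext p
      simp [indicator]
    change AEStronglyMeasurable (fun p : ℝ × ℝ => (Ioi p.1).indicator (fun s => s * Real.exp (-s / δ)) p.2) _
    rw [this]
    refine (Measurable.indicator (by fun_prop) (measurableSet_lt measurable_fst measurable_snd)).aestronglyMeasurable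
  have hinter : ∀ u : ℝ, 0 < u → Ioi 0 ∩ Ioi u = Ioi u := fun u hu => by
    rw [Ioi_inter_Ioi, sup_eq_right.2 hu.le]
  have hin : ∀ u : ℝ, 0 < u → ∫ s, (Ioi u).indicator (fun s => s * Real.exp (-s / δ)) s ∂μ
      = δ * (u + δ) * Real.exp (-u / δ) := fun u hu => by
    rw [hμ, setIntegral_indicator measurableSet_Ioi, hinter u hu, (lap_tail δ hδ u hu.le).2]
  have hnorm : ∀ u : ℝ, 0 < u → ∫ s, ‖F u s‖ ∂μ = δ * ‖G' u * ((u + δ) * Real.exp (-u / δ))‖ := by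
    intro u hu
    have : ∀ s, ‖F u s‖ = (Ioi u).indicator (fun s => s * Real.exp (-s / δ)) s * ‖G' u‖ := by
      intro s
      simp only [F, norm_mul]
      congr 1
      rw [Real.norm_of_nonneg]
      refine indicator_nonneg (fun x hx => ?_) s
      exact mul_nonneg (hu.trans hx).le (Real.exp_pos _).le
    simp_rw [this]
    rw [integral_mul_const, hin u hu, norm_mul,
      Real.norm_of_nonneg (r := (u + δ) * Real.exp (-u / δ)) (by positivity)]
    ring
  have hFi : Integrable (Function.uncurry F) (μ.prod μ) := by
    rw [integrable_prod_iff hFm]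
    constructor
    · refine (ae_restrict_mem measurableSet_Ioi).mono fun u hu => ?_
      have h0 : Integrable (fun s : ℝ => s * Real.exp (-s / δ)) μ := (lap_tail δ hδ 0 le_rfl).1
      exact (h0.indicator (measurableSet_Ioi (a := u))).mul_const (G' u)
    · refine (hi.norm.const_mul δ).congr ?_
      refine (ae_restrict_mem measurableSet_Ioi).mono fun u hu => ?_
      exact (hnorm u hu).symm
  have hout : ∀ s : ℝ, 0 < s → ∫ u, F u s ∂μ = s * Real.exp (-s / δ) * ∫ u in (0:ℝ)..s, G' u := by
    intro s hs
    have : ∀ u, F u s = s * Real.exp (-s / δ) * (Iio s).indicator G' u := by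
      intro u
      by_cases h : u < s <;> simp [F, h, indicator]
    simp_rw [this]
    rw [integral_const_mul, hμ, setIntegral_indicator measurableSet_Iio, Ioi_inter_Iio,
      intervalIntegral.integral_of_le hs.le, integral_Ioc_eq_integral_Ioo]
  constructor
  · refine hFi.integral_prod_right.congr ?_
    refine (ae_restrict_mem measurableSet_Ioi).mono fun s hs => ?_
    exact hout s hs
  · have := integral_integral_swap hFi
    rw [← integral_const_mul]
    calc _ = ∫ s, ∫ u, F u s ∂μ ∂μ := by
          refine setIntegral_congr_fun measurableSet_Ioi fun s hs => (hout s hs).symm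
      _ = ∫ u, ∫ s, F u s ∂μ ∂μ := this.symm
      _ = _ := by
          refine setIntegral_congr_fun measurableSet_Ioi fun u hu => ?_
          simp only [F]
          rw [integral_mul_const, hin u hu]
          ring

lemma int_split (F : ℝ → ℝ) (h1 : IntegrableOn F (Ioi 0))
    (h2 : IntegrableOn (fun x => F (-x)) (Ioi 0)) :
    Integrable F ∧ ∫ x, F x = (∫ x in Ioi 0, F x) + ∫ x in Ioi 0, F (-x) := by
  have h3 : IntegrableOn F (Iic 0) := by
    have := ((integrableOn_Ici_iff_integrableOn_Ioi (by simp)).2 h2)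
    have h := IntegrableOn.comp_neg_Iic (c := 0) (f := fun x => F (-x)) (by simpa using this)
    simpa using h
  constructor
  · rw [← integrableOn_univ, ← Iic_union_Ioi (a := (0:ℝ))]
    exact h3.union h1
  · rw [← intervalIntegral.integral_Iic_add_Ioi h3 h1, integral_comp_neg_Ioi]
    simp [add_comm]

lemma lap_core (δ : ℝ) (hδ : 0 < δ) (G G' : ℝ → ℝ) (hm : AEStronglyMeasurable G' volume)
    (hG : ∀ x : ℝ, G x = G 0 + ∫ t in (0:ℝ)..x, G' t)
    (hi : Integrable (fun u => G' u * ((|u| + δ) * Real.exp (-|u| / δ)))) :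
    ∫ x, x * (G x - G 0) * Real.exp (-|x| / δ)
      = δ * ∫ u, G' u * ((|u| + δ) * Real.exp (-|u| / δ)) := by
  have e1 : ∀ H : ℝ → ℝ, EqOn (fun u => H u * ((|u| + δ) * Real.exp (-|u| / δ)))
      (fun u => H u * ((u + δ) * Real.exp (-u / δ))) (Ioi 0) := by
    intro H u hu
    simp only [abs_of_pos (mem_Ioi.1 hu)]
  have hin := hi.comp_neg
  simp only [abs_neg] at hin
  have a1 := lap_half δ hδ G' hm ((hi.integrableOn).congr_fun (e1 _) measurableSet_Ioi)
  have a2 := lap_half δ hδ (fun x => G' (-x))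
    (hm.comp_quasiMeasurePreserving (Measure.measurePreserving_neg volume).quasiMeasurePreserving)
    ((hin.integrableOn).congr_fun (e1 fun x => G' (-x)) measurableSet_Ioi)
  have b1 : EqOn (fun s => s * Real.exp (-s / δ) * ∫ u in (0:ℝ)..s, G' u)
      (fun x => x * (G x - G 0) * Real.exp (-|x| / δ)) (Ioi 0) := by
    intro u hu
    simp only [abs_of_pos (mem_Ioi.1 hu)]
    rw [hG u]; ring
  have b2 : EqOn (fun s => s * Real.exp (-s / δ) * ∫ u in (0:ℝ)..s, G' (-u))
      (fun x => (-x) * (G (-x) - G 0) * Real.exp (-|(-x)| / δ)) (Ioi 0) := by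
    intro u hu
    simp only [abs_neg, abs_of_pos (mem_Ioi.1 hu)]
    rw [hG (-u), intervalIntegral.integral_comp_neg, intervalIntegral.integral_symm, neg_zero]; ring
  rw [(int_split _ (a1.1.congr_fun b1 measurableSet_Ioi) (a2.1.congr_fun b2 measurableSet_Ioi)).2,
    ← setIntegral_congr_fun measurableSet_Ioi b1, ← setIntegral_congr_fun measurableSet_Ioi b2,
    a1.2, a2.2, (int_split _ hi.integrableOn (by simpa using hin.integrableOn)).2, mul_add]
  congr 2
  · exact (setIntegral_congr_fun measurableSet_Ioi (e1 _)).symm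
  · simp only [abs_neg]
    exact (setIntegral_congr_fun measurableSet_Ioi (e1 fun x => G' (-x))).symm

lemma lap_conv_nonneg (δ : ℝ) (hδ : 0 < δ) (w : ℝ) (hw : 0 ≤ w) :
    Integrable (fun x : ℝ => Real.exp (-(|x| + |w - x|) / δ)) ∧
    ∫ x : ℝ, Real.exp (-(|x| + |w - x|) / δ) = (|w| + δ) * Real.exp (-|w| / δ) := by
  have k1 : EqOn (fun x : ℝ => Real.exp (-w / δ) * Real.exp ((2 / δ) * x))
      (fun x : ℝ => Real.exp (-(|x| + |w - x|) / δ)) (Iic 0) := by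
    intro x hx
    have hx : x ≤ 0 := hx
    simp only [abs_of_nonpos hx, abs_of_nonneg (by linarith : 0 ≤ w - x)]
    rw [← Real.exp_add]; congr 1; field_simp; ring
  have k2 : EqOn (fun _ : ℝ => Real.exp (-w / δ))
      (fun x : ℝ => Real.exp (-(|x| + |w - x|) / δ)) (Ioc 0 w) := by
    intro x hx
    simp only [abs_of_pos hx.1, abs_of_nonneg (by linarith [hx.2] : 0 ≤ w - x)]
    congr 1; ring
  have k3 : EqOn (fun x : ℝ => Real.exp (w / δ) * Real.exp ((-2 / δ) * x))
      (fun x : ℝ => Real.exp (-(|x| + |w - x|) / δ)) (Ioi w) := by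
    intro x hx
    have hx : w < x := hx
    simp only [abs_of_pos (lt_of_le_of_lt hw hx), abs_of_nonpos (by linarith : w - x ≤ 0)]
    rw [← Real.exp_add]; congr 1; field_simp; ring
  have p2 : 0 < 2 / δ := by positivity
  have n2 : -2 / δ < 0 := by rw [neg_div]; linarith
  have i1 := IntegrableOn.congr_fun ((integrableOn_exp_mul_Iic p2 0).const_mul (Real.exp (-w / δ))) k1 measurableSet_Iic
  have i2 := IntegrableOn.congr_fun (μ := volume) (integrableOn_const (by simp)) k2 measurableSet_Ioc
  have i3 := IntegrableOn.congr_fun ((integrableOn_exp_mul_Ioi n2 w).const_mul (Real.exp (w / δ))) k3 measurableSet_Ioi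
  have i23 := i2.union i3
  rw [Ioc_union_Ioi_eq_Ioi hw] at i23
  refine ⟨?_, ?_⟩
  · rw [← integrableOn_univ, ← Iic_union_Ioi (a := (0:ℝ))]
    exact i1.union i23
  · rw [← intervalIntegral.integral_Iic_add_Ioi i1 i23, ← Ioc_union_Ioi_eq_Ioi hw,
      setIntegral_union (by rw [Set.disjoint_left]; intro x hx hx'; exact absurd hx.2 (not_le.2 hx')) measurableSet_Ioi i2 i3,
      ← setIntegral_congr_fun measurableSet_Iic k1,
      ← setIntegral_congr_fun measurableSet_Ioc k2,
      ← setIntegral_congr_fun measurableSet_Ioi k3, integral_const_mul, integral_const_mul,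
      integral_exp_mul_Iic p2, integral_exp_mul_Ioi n2, setIntegral_const, abs_of_nonneg hw]
    have : Real.exp (w / δ) * (-Real.exp (-2 / δ * w) / (-2 / δ)) = δ / 2 * Real.exp (-w / δ) := by
      have : Real.exp (-w / δ) = Real.exp (w / δ) * Real.exp (-2 / δ * w) := by
        rw [← Real.exp_add]; congr 1; ring
      rw [this]; field_simp
    rw [this]
    simp [hw]
    field_simp
    ring

lemma lap_conv (δ : ℝ) (hδ : 0 < δ) (w : ℝ) :
    Integrable (fun x : ℝ => Real.exp (-(|x| + |w - x|) / δ)) ∧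
    ∫ x : ℝ, Real.exp (-(|x| + |w - x|) / δ) = (|w| + δ) * Real.exp (-|w| / δ) := by
  rcases le_total 0 w with hw | hw
  · exact lap_conv_nonneg δ hδ w hw
  · have h := lap_conv_nonneg δ hδ (-w) (by linarith)
    have e : ∀ x, Real.exp (-(|x| + |w - x|) / δ) = Real.exp (-(|-x| + |-w - -x|) / δ) := by
      intro x
      rw [abs_neg, show -w - -x = -(w - x) by ring, abs_neg]
    simp_rw [e]
    refine ⟨h.1.comp_neg, ?_⟩
    rw [integral_neg_eq_self (fun x => Real.exp (-(|x| + |-w - x|) / δ)), h.2, abs_neg]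

lemma lap_lconv (μ₀ δ : ℝ) (hδ : 0 < δ) (z : ℝ) :
    ∫⁻ x : ℝ, ENNReal.ofReal ((1 / (2 * δ)) * Real.exp (-|x - μ₀| / δ)) *
      ENNReal.ofReal ((1 / (2 * δ)) * Real.exp (-|(-x + z)| / δ))
    = ENNReal.ofReal ((1 / (4 * δ ^ 2)) * ((|z - μ₀| + δ) * Real.exp (-|z - μ₀| / δ))) := by
  have h := lap_conv δ hδ (z - μ₀)
  have e : ∀ x : ℝ, ENNReal.ofReal ((1 / (2 * δ)) * Real.exp (-|x - μ₀| / δ)) *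
      ENNReal.ofReal ((1 / (2 * δ)) * Real.exp (-|(-x + z)| / δ)) =
      ENNReal.ofReal ((1 / (4 * δ ^ 2)) * Real.exp (-(|x - μ₀| + |z - μ₀ - (x - μ₀)|) / δ)) := by
    intro x
    rw [← ENNReal.ofReal_mul (by positivity)]
    congr 1
    rw [show -x + z = z - μ₀ - (x - μ₀) by ring, neg_add, add_div, Real.exp_add]
    field_simp
    ring
  simp_rw [e]
  rw [← ofReal_integral_eq_lintegral_ofReal, integral_const_mul,
    integral_sub_right_eq_self (fun x => Real.exp (-(|x| + |z - μ₀ - x|) / δ)), h.2]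
  · exact (h.1.comp_sub_right μ₀).const_mul _
  · exact Filter.Eventually.of_forall fun x => by positivity

theorem covariance_identity_laplace
    {Ω : Type*} [MeasureSpace Ω] [IsProbabilityMeasure (ℙ : Measure Ω)]
    (μ₀ δ : ℝ) (hδ : 0 < δ)
    (X Y : Ω → ℝ) (hX : Measurable X) (hY : Measurable Y)
    (hindep : IndepFun X Y ℙ)
    -- X ~ La(μ₀, δ²)
    (hXlaw : Measure.map X ℙ
      = volume.withDensity
          (fun x => ENNReal.ofReal ((1 / (2 * δ)) * Real.exp (-|x - μ₀| / δ))))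
    -- Y ~ La(0, δ²)
    (hYlaw : Measure.map Y ℙ
      = volume.withDensity
          (fun x => ENNReal.ofReal ((1 / (2 * δ)) * Real.exp (-|x| / δ))))
    -- g is absolutely continuous with derivative g'
    (g g' : ℝ → ℝ)
    (hg'loc : LocallyIntegrable g' volume)
    (hg : ∀ x : ℝ, g x = g 0 + ∫ t in (0:ℝ)..x, g' t)
    -- integrability assumptions : E[|g'(X+Y)|] < ∞ and E[|X g(X)|] < ∞
    (hint1 : Integrable (fun ω => g' (X ω + Y ω)) ℙ)
    (hint2 : Integrable (fun ω => X ω * g (X ω)) ℙ) :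
    (∫ ω, X ω * g (X ω) ∂ℙ) - (∫ ω, X ω ∂ℙ) * (∫ ω, g (X ω) ∂ℙ)
      = 2 * δ ^ 2 * ∫ ω, g' (X ω + Y ω) ∂ℙ := by
  have hii : ∀ a b, IntervalIntegrable g' volume a b := fun a b =>
    (hg'loc.integrableOn_isCompact isCompact_uIcc).intervalIntegrable
  have hm : AEStronglyMeasurable g' volume := hg'loc.aestronglyMeasurable
  have hgc : Continuous g := by
    have : g = fun x => g 0 + ∫ t in (0:ℝ)..x, g' t := funext hg
    rw [this]
    exact continuous_const.add (intervalIntegral.continuous_primitive hii 0)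
  -- law of the sum
  have hSlaw : Measure.map (fun ω => X ω + Y ω) ℙ = volume.withDensity (fun z : ℝ =>
      ENNReal.ofReal ((1 / (4 * δ ^ 2)) * ((|z - μ₀| + δ) * Real.exp (-|z - μ₀| / δ)))) := by
    have h := hindep.map_add_eq_map_conv_map hX hY
    rw [hXlaw, hYlaw, conv_withDensity_eq_lconvolution (by fun_prop) (by fun_prop)] at h
    refine Eq.trans h ?_
    congr 1
    funext z
    exact lap_lconv μ₀ δ hδ z
  have hmS : AEStronglyMeasurable g' (Measure.map (fun ω => X ω + Y ω) ℙ) := by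
    rw [hSlaw]
    exact hm.mono_ac (withDensity_absolutelyContinuous _ _)
  have hSm : AEMeasurable (fun ω => X ω + Y ω) ℙ := (hX.add hY).aemeasurable
  have hSint : Integrable (fun z => (1 / (4 * δ ^ 2)) *
      ((|z - μ₀| + δ) * Real.exp (-|z - μ₀| / δ)) * g' z) := by
    have h := (integrable_map_measure hmS hSm).2 hint1
    rw [hSlaw, integrable_withDensity_iff_integrable_smul' (by fun_prop) (by simp)] at h
    refine h.congr (Filter.Eventually.of_forall fun z => ?_)
    simp only [smul_eq_mul]
    rw [ENNReal.toReal_ofReal (by positivity)]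
  have hSE : ∫ ω, g' (X ω + Y ω) ∂ℙ = ∫ z, (1 / (4 * δ ^ 2)) *
      ((|z - μ₀| + δ) * Real.exp (-|z - μ₀| / δ)) * g' z := by
    rw [← integral_map hSm hmS, hSlaw,
      integral_withDensity_eq_integral_toReal_smul (by fun_prop) (by simp)]
    refine integral_congr_ae (Filter.Eventually.of_forall fun z => ?_)
    simp only [smul_eq_mul]
    rw [ENNReal.toReal_ofReal (by positivity)]
  -- expectations of functions of X
  have hXE : ∀ φ : ℝ → ℝ, Continuous φ → ∫ ω, φ (X ω) ∂ℙ =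
      (1 / (2 * δ)) * ∫ x, φ (x + μ₀) * Real.exp (-|x| / δ) := by
    intro φ hφ
    rw [← integral_map hX.aemeasurable hφ.aestronglyMeasurable, hXlaw,
      integral_withDensity_eq_integral_toReal_smul (by fun_prop) (by simp),
      ← integral_add_right_eq_self _ μ₀, ← integral_const_mul]
    refine integral_congr_ae (Filter.Eventually.of_forall fun z => ?_)
    simp only [smul_eq_mul]
    rw [ENNReal.toReal_ofReal (by positivity), add_sub_cancel_right]
    ring
  have hodd : Integrable (fun x : ℝ => x * Real.exp (-|x| / δ)) := by
    have h0 : IntegrableOn (fun x : ℝ => x * Real.exp (-|x| / δ)) (Ioi 0) := by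
      refine (lap_tail δ hδ 0 le_rfl).1.congr_fun (fun x hx => ?_) measurableSet_Ioi
      simp only [abs_of_pos (mem_Ioi.1 hx)]
    refine (int_split _ h0 ?_).1
    simpa using h0.neg
  have hodd0 : ∫ x : ℝ, x * Real.exp (-|x| / δ) = 0 := by
    have h := integral_neg_eq_self (fun x : ℝ => x * Real.exp (-|x| / δ)) volume
    simp only [abs_neg, neg_mul, integral_neg] at h
    linarith
  have hXc : Integrable (fun ω => X ω - μ₀) ℙ := by
    have h : Integrable (fun x : ℝ => x - μ₀) (Measure.map X ℙ) := by
      rw [hXlaw, integrable_withDensity_iff_integrable_smul' (by fun_prop) (by simp)]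
      refine ((hodd.comp_sub_right μ₀).const_mul (1 / (2 * δ))).congr
        (Filter.Eventually.of_forall fun z => ?_)
      simp only [smul_eq_mul]
      rw [ENNReal.toReal_ofReal (by positivity)]
      ring
    exact h.comp_measurable hX
  have hXi : Integrable X ℙ := by
    refine (hXc.add (integrable_const μ₀)).congr (Filter.Eventually.of_forall fun ω => ?_)
    simp
  have hEX : ∫ ω, X ω ∂ℙ = μ₀ := by
    have h := hXE (fun x => x - μ₀) (by fun_prop)
    simp only [add_sub_cancel_right, hodd0, mul_zero] at h
    rw [integral_sub hXi (integrable_const _)] at h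
    simp at h
    linarith
  have hgi : Integrable (fun ω => g (X ω)) ℙ := by
    obtain ⟨C, hC⟩ := (isCompact_Icc (a := (-1:ℝ)) (b := 1)).exists_bound_of_continuousOn
      hgc.continuousOn
    refine ((integrable_const C).add hint2.norm).mono'
      (hgc.measurable.comp hX).aestronglyMeasurable (Filter.Eventually.of_forall fun ω => ?_)
    have hC0 : 0 ≤ C := (norm_nonneg _).trans (hC 0 (by simp))
    simp only [Pi.add_apply, norm_mul]
    by_cases h : |X ω| ≤ 1
    · have := hC (X ω) (abs_le.1 h)
      have h2 : 0 ≤ ‖X ω‖ * ‖g (X ω)‖ := by positivity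
      linarith
    · have h1 : 1 ≤ ‖X ω‖ := (not_le.1 h).le
      have := le_mul_of_one_le_left (norm_nonneg (g (X ω))) h1
      linarith
  have hcov : (∫ ω, X ω * g (X ω) ∂ℙ) - (∫ ω, X ω ∂ℙ) * (∫ ω, g (X ω) ∂ℙ)
      = ∫ ω, (X ω - μ₀) * (g (X ω) - g μ₀) ∂ℙ := by
    have e : ∀ ω, (X ω - μ₀) * (g (X ω) - g μ₀)
        = (X ω * g (X ω) - μ₀ * g (X ω)) - g μ₀ * (X ω - μ₀) := fun ω => by ring
    simp_rw [e]
    rw [integral_sub (f := fun ω => X ω * g (X ω) - μ₀ * g (X ω))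
        (hint2.sub (hgi.const_mul μ₀)) (hXc.const_mul _),
      integral_sub hint2 (hgi.const_mul μ₀), integral_const_mul, integral_const_mul,
      integral_sub hXi (integrable_const _), hEX]
    simp
  have hcore := lap_core δ hδ (fun x => g (x + μ₀)) (fun x => g' (x + μ₀))
    (hm.comp_quasiMeasurePreserving
      (measurePreserving_add_right volume μ₀).quasiMeasurePreserving)
    (fun x => by
      rw [intervalIntegral.integral_comp_add_right, hg (x + μ₀), hg (0 + μ₀), add_assoc,
        intervalIntegral.integral_add_adjacent_intervals (hii _ _) (hii _ _)])
    (by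
      refine ((hSint.comp_add_right μ₀).const_mul (4 * δ ^ 2)).congr
        (Filter.Eventually.of_forall fun z => ?_)
      simp only [add_sub_cancel_right]
      field_simp)
  rw [hcov, hXE (fun x => (x - μ₀) * (g x - g μ₀)) (by fun_prop), hSE,
    ← integral_add_right_eq_self (fun z => (1 / (4 * δ ^ 2)) *
      ((|z - μ₀| + δ) * Real.exp (-|z - μ₀| / δ)) * g' z) μ₀]
  simp only [add_sub_cancel_right, zero_add] at hcore ⊢
  rw [hcore]
  simp_rw [mul_assoc (1 / (4 * δ ^ 2))]
  rw [integral_const_mul]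
  simp_rw [mul_comm (g' _)]
  field_simp
  ring
end

section
/- Let α, λ⁺, λ⁻ > 0 and μ₀ ∈ ℝ, let G₁ and G₂ be independent gamma random variables with G₁ ~ Ga(α, λ⁺) and G₂ ~ Ga(α, λ⁻), and set X = μ₀ + G₁ − G₂ (so X has the variance-gamma distribution VGD₀(μ₀, α, λ⁺, λ⁻)). Let Y₁ be independent of X with density f₁(y) = (λ⁺²λ⁻²/(λ⁺² + λ⁻²)) ( (e^{−λ⁺y}/λ⁺) 1_{(0,∞)}(y) + (e^{λ⁻y}/λ⁻) 1_{(−∞,0)}(y) ). Then for every absolutely continuous function g : ℝ → ℝ with E[|g′(X+Y₁)|] < ∞ and E[|X g(X)|] < ∞, one has Cov(X, g(X)) = (α(λ⁺² + λ⁻²)/(λ⁺²λ⁻²)) · E[g′(X+Y₁)]. -/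
open MeasureTheory ProbabilityTheory Set

lemma vg_gint (a r : ℝ) (ha : 0 < a) (hr : 0 < r) (F : ℝ → ℝ) :
    ∫ u, F u ∂(gammaMeasure a r)
      = ∫ u in Ioi 0, (r ^ a / Real.Gamma a * u ^ (a - 1) * Real.exp (-(r * u))) * F u := by
  unfold gammaMeasure
  rw [integral_withDensity_eq_integral_toReal_smul
    (f := gammaPDF a r) ((measurable_gammaPDFReal a r).ennreal_ofReal) (by simp [gammaPDF])]
  rw [← integral_Ici_eq_integral_Ioi, ← integral_indicator measurableSet_Ici]
  congr 1; ext u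
  by_cases hu : 0 ≤ u
  · simp only [gammaPDF, smul_eq_mul]
    rw [ENNReal.toReal_ofReal (gammaPDFReal_nonneg ha hr u), indicator_of_mem (by simpa using hu),
      gammaPDFReal, if_pos hu]
  · rw [indicator_of_notMem (by simpa using hu), gammaPDF_of_neg (by simpa using hu)]; simp

lemma vg_int1 (a r : ℝ) (ha : 0 < a) (hr : 0 < r) :
    IntegrableOn (fun u : ℝ => u ^ (a-1) * Real.exp (-(r * u))) (Ioi 0) := by
  have := integrableOn_rpow_mul_exp_neg_mul_rpow (p := 1) (s := a - 1) (b := r) (by linarith) one_pos hr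
  refine this.congr_fun (fun u hu => ?_) measurableSet_Ioi
  simp

lemma vg_gamma_integrable (a r : ℝ) (ha : 0 < a) (hr : 0 < r) :
    Integrable (fun u : ℝ => u) (gammaMeasure a r) := by
  unfold gammaMeasure
  rw [integrable_withDensity_iff_integrable_smul' 
    (f := gammaPDF a r) ((measurable_gammaPDFReal a r).ennreal_ofReal) (by simp [gammaPDF])]
  have h := (vg_int1 (a+1) r (by linarith) hr).const_mul (r ^ a / Real.Gamma a)
  rw [← IntegrableOn, ← integrableOn_Ici_iff_integrableOn_Ioi, ← integrable_indicator_iff measurableSet_Ici] at h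
  refine h.congr (Filter.Eventually.of_forall fun u => ?_)
  by_cases hu : 0 ≤ u
  · simp only [gammaPDF, smul_eq_mul]
    rw [ENNReal.toReal_ofReal (gammaPDFReal_nonneg ha hr u), indicator_of_mem (by simpa using hu),
      gammaPDFReal, if_pos hu]
    rcases hu.eq_or_lt with h0 | h0
    · subst h0; simp [Real.zero_rpow ha.ne']
    · rw [show a + 1 - 1 = (a - 1) + 1 by ring, Real.rpow_add_one h0.ne']; ring
  · simp only [smul_eq_mul]
    rw [indicator_of_notMem (by simpa using hu), gammaPDF_of_neg (by simpa using hu)]; simp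

lemma vg_ftc (a r s : ℝ) (ha : 0 < a) (hr : 0 < r) (hs : 0 ≤ s) :
    ∫ u in Ioi s, (u - a / r) * (u ^ (a-1) * Real.exp (-(r * u)))
      = s ^ a * Real.exp (-(r * s)) / r := by
  have key := integral_Ioi_of_hasDerivAt_of_tendsto (a := s) (m := 0)
    (f := fun u : ℝ => - (u ^ a * Real.exp (-(r * u)) / r))
    (f' := fun u => (u - a / r) * (u ^ (a-1) * Real.exp (-(r * u)))) ?_ ?_ ?_ ?_
  · rw [key]; ring
  · have : Continuous (fun u : ℝ => - (u ^ a * Real.exp (-(r * u)) / r)) := by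
      have := Real.continuous_rpow_const ha.le
      fun_prop
    exact this.continuousWithinAt
  · intro u hu
    have hu0 : 0 < u := lt_of_le_of_lt hs hu
    have h1 := Real.hasDerivAt_rpow_const (x := u) (p := a) (Or.inl hu0.ne')
    have h2 : HasDerivAt (fun u : ℝ => Real.exp (-(r * u))) (Real.exp (-(r * u)) * (-(r * 1))) u :=
      (((hasDerivAt_id u).const_mul r).neg).exp
    have h3 := ((h1.mul h2).div_const r).neg
    refine h3.congr_deriv ?_
    have : u ^ a = u ^ (a-1) * u := by
      rw [← Real.rpow_add_one hu0.ne']; ring_nf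
    rw [this]; field_simp; ring
  · have h1 := (vg_int1 (a+1) r (by linarith) hr).mono_set (Ioi_subset_Ioi hs)
    have h2 := ((vg_int1 a r ha hr).mono_set (Ioi_subset_Ioi hs)).const_mul (a/r)
    refine (h1.sub h2).congr_fun (fun u hu => ?_) measurableSet_Ioi
    have hu0 : 0 < u := lt_of_le_of_lt hs hu
    simp only [Pi.sub_apply]
    rw [show a + 1 - 1 = (a - 1) + 1 by ring, Real.rpow_add_one hu0.ne']; ring
  · have := (tendsto_rpow_mul_exp_neg_mul_atTop_nhds_zero a r hr).div_const r |>.neg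
    simpa using this

lemma vg_gamma_tail (a r s : ℝ) (ha : 0 < a) (hr : 0 < r) :
    ∫ u, (if s < u then u - a / r else 0) ∂(gammaMeasure a r)
      = ∫ u, (if u ≤ s then a / r * Real.exp (-r * (s - u)) else 0) ∂(gammaMeasure a r) := by
  rw [vg_gint a r ha hr, vg_gint a r ha hr]
  rcases le_or_gt 0 s with hs | hs
  · have e1 : ∫ u in Ioi (0:ℝ), (r ^ a / Real.Gamma a * u ^ (a - 1) * Real.exp (-(r * u))) *
        (if s < u then u - a / r else 0) = r ^ a / Real.Gamma a * (s ^ a * Real.exp (-(r * s)) / r) := by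
      rw [← vg_ftc a r s ha hr hs, ← integral_const_mul, ← integral_indicator measurableSet_Ioi,
        ← integral_indicator measurableSet_Ioi]
      congr 1; ext u
      by_cases h : s < u
      · rw [indicator_of_mem (by simpa using hs.trans_lt h), indicator_of_mem (by simpa using h), if_pos h]
        ring
      · rw [indicator_of_notMem (s := Ioi s) (by simpa using h)]
        simp [h]
    have e2 : ∫ u in Ioi (0:ℝ), (r ^ a / Real.Gamma a * u ^ (a - 1) * Real.exp (-(r * u))) *
        (if u ≤ s then a / r * Real.exp (-r * (s - u)) else 0)
        = ∫ u in (0:ℝ)..s, (r ^ a / Real.Gamma a * (a / r) * Real.exp (-(r * s))) * u ^ (a-1) := by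
      rw [intervalIntegral.integral_of_le hs, ← integral_indicator measurableSet_Ioi,
        ← integral_indicator measurableSet_Ioc]
      congr 1; ext u
      by_cases h0 : 0 < u
      · by_cases h : u ≤ s
        · rw [indicator_of_mem (by simpa using h0), indicator_of_mem (by simp [h, h0]), if_pos h]
          rw [show -(r*s) = -(r*u) + (-r*(s-u)) by ring, Real.exp_add]; ring
        · rw [indicator_of_notMem (s := Ioc 0 s) (by simp [h])]
          simp [h]
      · rw [indicator_of_notMem (by simpa using h0), indicator_of_notMem (by simp [h0])]
    rw [e1, e2, intervalIntegral.integral_const_mul, integral_rpow (Or.inl (by linarith))]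
    rw [show a - 1 + 1 = a by ring, Real.zero_rpow ha.ne']
    field_simp; ring
  · have h0 := vg_ftc a r 0 ha hr le_rfl
    rw [Real.zero_rpow ha.ne'] at h0
    have e1 : ∫ u in Ioi (0:ℝ), (r ^ a / Real.Gamma a * u ^ (a - 1) * Real.exp (-(r * u))) *
        (if s < u then u - a / r else 0) = r ^ a / Real.Gamma a * ∫ u in Ioi (0:ℝ), (u - a / r) * (u ^ (a-1) * Real.exp (-(r * u))) := by
      rw [← integral_const_mul]
      refine setIntegral_congr_fun measurableSet_Ioi fun u hu => ?_
      rw [if_pos (hs.trans hu)]; ring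
    rw [e1, h0]
    rw [setIntegral_congr_fun (g := fun _ => (0:ℝ)) measurableSet_Ioi]
    · simp
    · intro u hu
      show _ = (0:ℝ)
      beta_reduce
      rw [if_neg (not_le.2 (hs.trans hu)), mul_zero]

lemma vg_gamma_mean (a r : ℝ) (ha : 0 < a) (hr : 0 < r) :
    ∫ u, (u - a / r) ∂(gammaMeasure a r) = 0 := by
  rw [vg_gint a r ha hr]
  have h0 := vg_ftc a r 0 ha hr le_rfl
  rw [Real.zero_rpow ha.ne'] at h0
  have := congrArg (fun z => r ^ a / Real.Gamma a * z) h0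
  simp only [← integral_const_mul] at this
  have h3 : r ^ a / Real.Gamma a * (0 * Real.exp (-(r * 0)) / r) = 0 := by simp
  rw [h3] at this
  refine Eq.trans ?_ this
  refine setIntegral_congr_fun measurableSet_Ioi fun u _ => ?_
  ring

lemma vg_gamma_tail' (a r s : ℝ) (ha : 0 < a) (hr : 0 < r) :
    ∫ u, (if u < s then -(u - a / r) else 0) ∂(gammaMeasure a r)
      = ∫ u, (if u ≤ s then a / r * Real.exp (-r * (s - u)) else 0) ∂(gammaMeasure a r) := by
  have := isProbabilityMeasure_gammaMeasure ha hr
  have hi : Integrable (fun u : ℝ => u - a / r) (gammaMeasure a r) :=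
    (vg_gamma_integrable a r ha hr).sub (integrable_const _)
  have hi2 : Integrable (fun u : ℝ => if s < u then u - a / r else 0) (gammaMeasure a r) := by
    refine (hi.indicator (measurableSet_Ioi (a := s))).congr (Filter.Eventually.of_forall fun u => ?_)
    simp [indicator]
  have e : ∫ u, (if s < u then u - a / r else 0) ∂(gammaMeasure a r)
      = ∫ u, ((if s < u then u - a / r else 0) - (u - a / r)) ∂(gammaMeasure a r) := by
    rw [integral_sub hi2 hi, vg_gamma_mean a r ha hr, sub_zero]
  rw [← vg_gamma_tail a r s ha hr, e]
  apply integral_congr_ae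
  have hac : gammaMeasure a r ≪ volume := withDensity_absolutelyContinuous _ _
  have : ∀ᵐ u ∂(gammaMeasure a r), u ≠ s := hac.ae_le (Measure.ae_ne volume s)
  filter_upwards [this] with u hu
  rcases lt_or_gt_of_ne hu with h | h
  · simp [h, h.le.not_gt]
  · simp [h, h.le.not_gt]

/-- unnormalised density of `Y₁` (values at `0` are immaterial). -/
noncomputable def vgf (α lp lm y : ℝ) : ℝ :=
  (if 0 ≤ y then α / lp * Real.exp (-lp * y) else 0) +
    (if y ≤ 0 then α / lm * Real.exp (lm * y) else 0)

lemma vg_ite_meas {β : Type*} [MeasurableSpace β] {q f : β → ℝ} (hq : Measurable q)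
    (hf : Measurable f) : Measurable (fun b => if 0 ≤ q b then f b else 0) :=
  Measurable.ite (measurableSet_le measurable_const hq) hf measurable_const

lemma vg_ite_meas' {β : Type*} [MeasurableSpace β] {q f : β → ℝ} (hq : Measurable q)
    (hf : Measurable f) : Measurable (fun b => if q b ≤ 0 then f b else 0) :=
  Measurable.ite (measurableSet_le hq measurable_const) hf measurable_const

lemma vgf_meas (α lp lm : ℝ) : Measurable (vgf α lp lm) := by
  unfold vgf
  exact (vg_ite_meas measurable_id (by fun_prop)).add (vg_ite_meas' measurable_id (by fun_prop))

lemma vg_int_pos {β : Type*} [MeasurableSpace β] (μ : Measure β) [IsFiniteMeasure μ]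
    (c l : ℝ) (hl : 0 < l) (q : β → ℝ) (hq : Measurable q) :
    Integrable (fun b => if 0 ≤ q b then c * Real.exp (-l * q b) else 0) μ := by
  refine Integrable.of_bound (vg_ite_meas hq (by fun_prop)).aestronglyMeasurable |c|
    (Filter.Eventually.of_forall fun b => ?_)
  split_ifs with h
  · rw [Real.norm_eq_abs, abs_mul, Real.abs_exp]
    have : Real.exp (-l * q b) ≤ 1 := Real.exp_le_one_iff.2 (by nlinarith)
    exact mul_le_of_le_one_right (abs_nonneg _) this
  · simp

lemma vg_int_neg {β : Type*} [MeasurableSpace β] (μ : Measure β) [IsFiniteMeasure μ]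
    (c l : ℝ) (hl : 0 < l) (q : β → ℝ) (hq : Measurable q) :
    Integrable (fun b => if q b ≤ 0 then c * Real.exp (l * q b) else 0) μ := by
  have := vg_int_pos μ c l hl (fun b => - q b) hq.neg
  simpa using this

lemma vgf_nonneg (α lp lm y : ℝ) (hα : 0 < α) (hlp : 0 < lp) (hlm : 0 < lm) :
    0 ≤ vgf α lp lm y := by
  unfold vgf
  split_ifs <;> positivity

lemma vgf_integrable {β : Type*} [MeasurableSpace β] (μ : Measure β) [IsFiniteMeasure μ]
    (α lp lm : ℝ) (hlp : 0 < lp) (hlm : 0 < lm) (q : β → ℝ) (hq : Measurable q) :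
    Integrable (fun b => vgf α lp lm (q b)) μ :=
  (vg_int_pos μ _ lp hlp q hq).add (vg_int_neg μ _ lm hlm q hq)

lemma vg_tail (α lp lm μ₀ t : ℝ) (hα : 0 < α) (hlp : 0 < lp) (hlm : 0 < lm) :
    ∫ p : ℝ × ℝ, (if t < μ₀ + p.1 - p.2 then μ₀ + p.1 - p.2 - (μ₀ + α / lp - α / lm) else 0)
        ∂((gammaMeasure α lp).prod (gammaMeasure α lm))
      = ∫ p : ℝ × ℝ, vgf α lp lm (t - (μ₀ + p.1 - p.2))
        ∂((gammaMeasure α lp).prod (gammaMeasure α lm)) := by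
  have i1 := isProbabilityMeasure_gammaMeasure hα hlp
  have i2 := isProbabilityMeasure_gammaMeasure hα hlm
  set γ₁ := gammaMeasure α lp with hγ₁
  set γ₂ := gammaMeasure α lm with hγ₂
  have j1 : Integrable (fun p : ℝ × ℝ => p.1 - α / lp) (γ₁.prod γ₂) :=
    ((vg_gamma_integrable α lp hα hlp).comp_fst γ₂).sub (integrable_const _)
  have j2 : Integrable (fun p : ℝ × ℝ => -(p.2 - α / lm)) (γ₁.prod γ₂) :=
    (((vg_gamma_integrable α lm hα hlm).comp_snd γ₁).sub (integrable_const _)).neg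
  have mS : MeasurableSet {p : ℝ × ℝ | t < μ₀ + p.1 - p.2} :=
    measurableSet_lt measurable_const (by fun_prop)
  have k1 : Integrable (fun p : ℝ × ℝ => if t - μ₀ + p.2 < p.1 then p.1 - α / lp else 0)
      (γ₁.prod γ₂) := by
    refine (j1.indicator mS).congr (Filter.Eventually.of_forall fun p => ?_)
    have : t < μ₀ + p.1 - p.2 ↔ t - μ₀ + p.2 < p.1 := by constructor <;> intro h <;> linarith
    simp [indicator, this]
  have k2 : Integrable (fun p : ℝ × ℝ => if p.2 < μ₀ + p.1 - t then -(p.2 - α / lm) else 0)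
      (γ₁.prod γ₂) := by
    refine (j2.indicator mS).congr (Filter.Eventually.of_forall fun p => ?_)
    have : t < μ₀ + p.1 - p.2 ↔ p.2 < μ₀ + p.1 - t := by constructor <;> intro h <;> linarith
    simp [indicator, this]
  have l1 := vg_int_pos (γ₁.prod γ₂) (α / lp) lp hlp (fun p : ℝ × ℝ => t - (μ₀ + p.1 - p.2)) (by fun_prop)
  have l2 := vg_int_neg (γ₁.prod γ₂) (α / lm) lm hlm (fun p : ℝ × ℝ => t - (μ₀ + p.1 - p.2)) (by fun_prop)
  have e1 : ∫ p : ℝ × ℝ, (if t - μ₀ + p.2 < p.1 then p.1 - α / lp else 0) ∂(γ₁.prod γ₂)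
      = ∫ p : ℝ × ℝ, (if 0 ≤ t - (μ₀ + p.1 - p.2) then
          α / lp * Real.exp (-lp * (t - (μ₀ + p.1 - p.2))) else 0) ∂(γ₁.prod γ₂) := by
    rw [integral_prod_symm _ k1, integral_prod_symm _ l1]
    congr 1; ext v
    simp only
    rw [vg_gamma_tail α lp (t - μ₀ + v) hα hlp]
    congr 1; ext u
    have : u ≤ t - μ₀ + v ↔ 0 ≤ t - (μ₀ + u - v) := by constructor <;> intro h <;> linarith
    simp only [this]
    rw [show t - μ₀ + v - u = t - (μ₀ + u - v) by ring]
  have e2 : ∫ p : ℝ × ℝ, (if p.2 < μ₀ + p.1 - t then -(p.2 - α / lm) else 0) ∂(γ₁.prod γ₂)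
      = ∫ p : ℝ × ℝ, (if t - (μ₀ + p.1 - p.2) ≤ 0 then
          α / lm * Real.exp (lm * (t - (μ₀ + p.1 - p.2))) else 0) ∂(γ₁.prod γ₂) := by
    rw [integral_prod _ k2, integral_prod _ l2]
    congr 1; ext u
    simp only
    rw [vg_gamma_tail' α lm (μ₀ + u - t) hα hlm]
    congr 1; ext v
    have : v ≤ μ₀ + u - t ↔ t - (μ₀ + u - v) ≤ 0 := by constructor <;> intro h <;> linarith
    simp only [this]
    rw [show -lm * (μ₀ + u - t - v) = lm * (t - (μ₀ + u - v)) by ring]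
  unfold vgf
  rw [integral_add l1 l2, ← e1, ← e2, ← integral_add k1 k2]
  congr 1; ext p
  have h1 : t < μ₀ + p.1 - p.2 ↔ t - μ₀ + p.2 < p.1 := by constructor <;> intro h <;> linarith
  have h2 : t < μ₀ + p.1 - p.2 ↔ p.2 < μ₀ + p.1 - t := by constructor <;> intro h <;> linarith
  simp only [← h1, ← h2]
  split_ifs <;> ring

lemma vg_map_add (ν : Measure ℝ) [IsProbabilityMeasure ν] (f : ℝ → ENNReal) (hf : Measurable f) 
    [SFinite (volume.withDensity f)] :
    (ν.prod (volume.withDensity f)).map (fun p => p.1 + p.2)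
      = volume.withDensity (fun t => ∫⁻ x, f (t - x) ∂ν) := by
  have hm : Measurable (fun t => ∫⁻ x, f (t - x) ∂ν) :=
    Measurable.lintegral_prod_right' (f := fun p : ℝ × ℝ => f (p.1 - p.2)) (by fun_prop)
  refine Measure.ext_of_lintegral _ fun φ hφ => ?_
  rw [lintegral_map hφ (by fun_prop), lintegral_prod _ (by fun_prop),
    lintegral_withDensity_eq_lintegral_mul _ hm hφ]
  have : ∀ x, ∫⁻ y, φ (x + y) ∂(volume.withDensity f) = ∫⁻ t, f (t - x) * φ t := by
    intro x
    rw [lintegral_withDensity_eq_lintegral_mul _ hf (by fun_prop)]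
    rw [← lintegral_add_right_eq_self (fun t => f (t - x) * φ t) x]
    simp [add_comm]
  simp only [this]
  rw [lintegral_lintegral_swap (by fun_prop)]
  congr 1; ext t
  simp only [Pi.mul_apply]
  rw [lintegral_mul_const _ (by fun_prop)]

lemma vg_fubini (ν : Measure ℝ) [IsProbabilityMeasure ν] (m : ℝ)
    (hX : Integrable (fun x : ℝ => x) ν) (hm : ∫ x, (x - m) ∂ν = 0) (D : ℝ → ℝ)
    (hD : ∀ t, ∫ x, (if t < x then x - m else 0) ∂ν = D t) (g' : ℝ → ℝ)
    (hg' : LocallyIntegrable g' volume) (hgD : Integrable (fun t => D t * g' t) volume) :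
    Integrable (fun x => (x - m) * ∫ t in m..x, g' t) ν ∧
      ∫ x, ((x - m) * ∫ t in m..x, g' t) ∂ν = ∫ t, D t * g' t := by
  have hXm : Integrable (fun x : ℝ => x - m) ν := hX.sub (integrable_const _)
  let k : ℝ → ℝ → ℝ := fun t x => (if t < x then x - m else 0) - (if t < m then x - m else 0)
  have kmeas : Measurable (fun p : ℝ × ℝ => k p.1 p.2) := by
    refine Measurable.sub ?_ ?_
    · exact Measurable.ite (measurableSet_lt measurable_fst measurable_snd) (by fun_prop) measurable_const
    · exact Measurable.ite (measurableSet_lt measurable_fst measurable_const) (by fun_prop) measurable_const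
  have knn : ∀ t x, 0 ≤ k t x := by
    intro t x
    simp only [k]
    split_ifs <;> linarith
  have i1 : ∀ t, Integrable (fun x => if t < x then x - m else 0) ν := by
    intro t
    refine (hXm.indicator (measurableSet_Ioi (a := t))).congr (Filter.Eventually.of_forall fun u => ?_)
    simp [indicator]
  have i2 : ∀ t, Integrable (fun x => if t < m then x - m else 0) ν := by
    intro t
    by_cases h : t < m
    · simpa [h] using hXm
    · simp [h]
  have kint : ∀ t, Integrable (k t) ν := fun t => (i1 t).sub (i2 t)
  have kI : ∀ t, ∫ x, k t x ∂ν = D t := by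
    intro t
    simp only [k]
    rw [integral_sub (i1 t) (i2 t), hD t]
    by_cases h : t < m
    · simp only [h, if_true, hm, sub_zero]
    · simp [h]
  have hprod : Integrable (fun p : ℝ × ℝ => k p.1 p.2 * g' p.1) (volume.prod ν) := by
    rw [integrable_prod_iff]
    · constructor
      · exact Filter.Eventually.of_forall fun t => (kint t).mul_const (g' t)
      · refine hgD.norm.congr (Filter.Eventually.of_forall fun t => ?_)
        simp only [norm_mul]
        rw [integral_mul_const]
        congr 1
        rw [← kI t, Real.norm_of_nonneg (integral_nonneg (knn t))]
        congr 1; ext x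
        rw [Real.norm_of_nonneg (knn t x)]
    · exact kmeas.aestronglyMeasurable.mul hg'.aestronglyMeasurable.comp_fst
  have inner : ∀ x, ∫ t, k t x * g' t = (x - m) * ∫ t in m..x, g' t := by
    intro x
    rcases le_total m x with h | h
    · rw [intervalIntegral.integral_of_le h, ← integral_Ico_eq_integral_Ioc, ← integral_const_mul,
        ← integral_indicator measurableSet_Ico]
      congr 1; ext t
      simp only [indicator, mem_Ico, k]
      split_ifs <;> first | ring1 | (exfalso; grind)
    · rw [intervalIntegral.integral_of_ge h, ← integral_Ico_eq_integral_Ioc, ← integral_neg,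
        ← integral_const_mul, ← integral_indicator measurableSet_Ico]
      congr 1; ext t
      simp only [indicator, mem_Ico, k]
      split_ifs <;> first | ring1 | (exfalso; grind)
  constructor
  · exact hprod.integral_prod_right.congr (Filter.Eventually.of_forall inner)
  · simp only [← inner]
    rw [← integral_integral_swap (f := fun t x => k t x * g' t) hprod]
    congr 1; ext t
    rw [integral_mul_const, kI]

/-- **Covariance identity for the variance-gamma distribution `VGD₀(μ₀, α, λ⁺, λ⁻)`.**
If `X = μ₀ + G₁ - G₂` with `G₁ ~ Ga(α, λ⁺)`, `G₂ ~ Ga(α, λ⁻)` independent, and `Y₁` is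
independent of `X` with the stated density, then
`Cov(X, g(X)) = (α(λ⁺² + λ⁻²)/(λ⁺²λ⁻²)) E[g'(X+Y₁)]`. -/
theorem covariance_identity_variance_gamma
    {Ω : Type*} [MeasureSpace Ω] [IsProbabilityMeasure (ℙ : Measure Ω)]
    (α lp lm μ₀ : ℝ) (hα : 0 < α) (hlp : 0 < lp) (hlm : 0 < lm)
    (G₁ G₂ Y₁ : Ω → ℝ) (hG₁ : Measurable G₁) (hG₂ : Measurable G₂) (hY₁ : Measurable Y₁)
    (hG₁law : Measure.map G₁ ℙ = gammaMeasure α lp)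
    (hG₂law : Measure.map G₂ ℙ = gammaMeasure α lm)
    (hGindep : IndepFun G₁ G₂ ℙ)
    -- X = μ₀ + G₁ - G₂ ~ VGD₀(μ₀, α, λ⁺, λ⁻)
    (X : Ω → ℝ) (hXdef : X = fun ω => μ₀ + G₁ ω - G₂ ω)
    -- Y₁ is independent of X and has the density f₁
    (hindep : IndepFun X Y₁ ℙ)
    (hY₁law : Measure.map Y₁ ℙ
      = volume.withDensity (fun y => ENNReal.ofReal
          ((lp ^ 2 * lm ^ 2 / (lp ^ 2 + lm ^ 2)) *
            (Ioi (0:ℝ)).indicator (fun y => Real.exp (-lp * y) / lp) y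
           + (lp ^ 2 * lm ^ 2 / (lp ^ 2 + lm ^ 2)) *
            (Iio (0:ℝ)).indicator (fun y => Real.exp (lm * y) / lm) y)))
    -- g is absolutely continuous with derivative g'
    (g g' : ℝ → ℝ)
    (hg'loc : LocallyIntegrable g' volume)
    (hg : ∀ x : ℝ, g x = g 0 + ∫ t in (0:ℝ)..x, g' t)
    -- integrability assumptions : E[|g'(X+Y₁)|] < ∞ and E[|X g(X)|] < ∞
    (hint1 : Integrable (fun ω => g' (X ω + Y₁ ω)) ℙ)
    (hint2 : Integrable (fun ω => X ω * g (X ω)) ℙ) :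
    (∫ ω, X ω * g (X ω) ∂ℙ) - (∫ ω, X ω ∂ℙ) * (∫ ω, g (X ω) ∂ℙ)
      = (α * (lp ^ 2 + lm ^ 2) / (lp ^ 2 * lm ^ 2)) * ∫ ω, g' (X ω + Y₁ ω) ∂ℙ := by
  have i1 := isProbabilityMeasure_gammaMeasure hα hlp
  have i2 := isProbabilityMeasure_gammaMeasure hα hlm
  have hX : Measurable X := by rw [hXdef]; fun_prop
  set m := μ₀ + α / lp - α / lm with hm
  set ν := Measure.map X ℙ with hν
  have iν : IsProbabilityMeasure ν := Measure.isProbabilityMeasure_map hX.aemeasurable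
  -- law of X as image of the product law
  have hνprod : ν = ((gammaMeasure α lp).prod (gammaMeasure α lm)).map
      (fun p : ℝ × ℝ => μ₀ + p.1 - p.2) := by
    have h := (indepFun_iff_map_prod_eq_prod_map_map hG₁.aemeasurable hG₂.aemeasurable).1 hGindep
    rw [hG₁law, hG₂law] at h
    rw [← h, Measure.map_map (by fun_prop) (by fun_prop), hν, hXdef]
    rfl
  have hpm : Measurable (fun p : ℝ × ℝ => μ₀ + p.1 - p.2) := by fun_prop
  have q1 := (vg_gamma_integrable α lp hα hlp).comp_fst (gammaMeasure α lm)
  have q2 := (vg_gamma_integrable α lm hα hlm).comp_snd (gammaMeasure α lp)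
  have hνint : Integrable (fun x : ℝ => x) ν := by
    rw [hνprod, integrable_map_measure (by fun_prop) hpm.aemeasurable]
    exact ((integrable_const μ₀).add q1).sub q2
  have mean : ∀ r : ℝ, 0 < r → ∫ u, u ∂(gammaMeasure α r) = α / r := by
    intro r hr
    have := isProbabilityMeasure_gammaMeasure hα hr
    have h := vg_gamma_mean α r hα hr
    rw [integral_sub (vg_gamma_integrable α r hα hr) (integrable_const _)] at h
    simp at h
    linarith
  have q0 : Integrable (fun p : ℝ × ℝ => μ₀ + p.1) ((gammaMeasure α lp).prod (gammaMeasure α lm)) :=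
    (integrable_const μ₀).add q1
  have hνmean' : ∫ x, x ∂ν = m := by
    rw [hνprod, integral_map hpm.aemeasurable (by fun_prop),
      integral_sub q0 q2, integral_add (integrable_const μ₀) q1,
      integral_fun_fst (fun u : ℝ => u), integral_fun_snd (fun u : ℝ => u), mean lp hlp, mean lm hlm]
    simp [hm]
  have hνmean : ∫ x, (x - m) ∂ν = 0 := by
    rw [integral_sub hνint (integrable_const _), hνmean']; simp
  let D : ℝ → ℝ := fun t => ∫ x, vgf α lp lm (t - x) ∂ν
  have hfm := vgf_meas α lp lm
  have hD : ∀ t, ∫ x, (if t < x then x - m else 0) ∂ν = D t := by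
    intro t
    simp only [D]
    rw [hνprod, integral_map hpm.aemeasurable, integral_map hpm.aemeasurable]
    · exact vg_tail α lp lm μ₀ t hα hlp hlm
    · exact (hfm.comp (measurable_const.sub measurable_id)).aestronglyMeasurable
    · exact (Measurable.ite measurableSet_Ioi (by fun_prop) measurable_const).aestronglyMeasurable
  set C := α * (lp ^ 2 + lm ^ 2) / (lp ^ 2 * lm ^ 2) with hC
  have hCpos : 0 < C := by positivity
  have hYlaw : Measure.map Y₁ ℙ = volume.withDensity
      (fun y => ENNReal.ofReal (C⁻¹ * vgf α lp lm y)) := by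
    rw [hY₁law]
    apply withDensity_congr_ae
    filter_upwards [Measure.ae_ne volume (0:ℝ)] with y hy
    congr 1
    rcases lt_or_gt_of_ne hy with h | h
    · simp [indicator, vgf, h, h.le, h.not_ge, h.le.not_gt, hC]; field_simp
    · simp [indicator, vgf, h, h.le, h.not_ge, h.le.not_gt, hC]; field_simp
  have iY : IsProbabilityMeasure (Measure.map Y₁ ℙ) :=
    Measure.isProbabilityMeasure_map hY₁.aemeasurable
  have hlaw : Measure.map (fun ω => X ω + Y₁ ω) ℙ
      = volume.withDensity (fun t => ENNReal.ofReal (C⁻¹ * D t)) := by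
    have h := (indepFun_iff_map_prod_eq_prod_map_map hX.aemeasurable hY₁.aemeasurable).1 hindep
    have h2 : Measure.map (fun ω => X ω + Y₁ ω) ℙ
        = (ν.prod (Measure.map Y₁ ℙ)).map (fun p => p.1 + p.2) := by
      rw [hν, ← h, Measure.map_map (by fun_prop) (by fun_prop)]
      rfl
    rw [h2]
    rw [hYlaw] at iY ⊢
    rw [vg_map_add ν _ (by fun_prop)]
    congr 1; ext t
    rw [← ofReal_integral_eq_lintegral_ofReal, integral_const_mul]
    · exact (vgf_integrable ν α lp lm hlp hlm (fun x => t - x) (by fun_prop)).const_mul _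
    · exact Filter.Eventually.of_forall fun x =>
        mul_nonneg (inv_nonneg.2 hCpos.le) (vgf_nonneg α lp lm _ hα hlp hlm)
  have hDnn : ∀ t, 0 ≤ D t := fun t => integral_nonneg fun x => vgf_nonneg α lp lm _ hα hlp hlm
  have hDm : Measurable D := by
    have : StronglyMeasurable (fun p : ℝ × ℝ => vgf α lp lm (p.1 - p.2)) :=
      (hfm.comp (measurable_fst.sub measurable_snd)).stronglyMeasurable
    exact this.integral_prod_right'.measurable
  have hdens : Measurable (fun t => ENNReal.ofReal (C⁻¹ * D t)) := by fun_prop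
  have hS : Measurable (fun ω => X ω + Y₁ ω) := by fun_prop
  have hac : Measure.map (fun ω => X ω + Y₁ ω) ℙ ≪ volume := by
    rw [hlaw]; exact withDensity_absolutelyContinuous _ _
  have hg'm : AEStronglyMeasurable g' (Measure.map (fun ω => X ω + Y₁ ω) ℙ) :=
    hg'loc.aestronglyMeasurable.mono_ac hac
  have htr : ∀ t, (ENNReal.ofReal (C⁻¹ * D t)).toReal = C⁻¹ * D t := fun t =>
    ENNReal.toReal_ofReal (mul_nonneg (inv_nonneg.2 hCpos.le) (hDnn t))
  have hgD : Integrable (fun t => D t * g' t) volume := by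
    have h := (integrable_map_measure hg'm hS.aemeasurable).2 hint1
    rw [hlaw, integrable_withDensity_iff_integrable_smul' hdens (by simp)] at h
    refine (h.const_mul C).congr (Filter.Eventually.of_forall fun t => ?_)
    simp only [htr, smul_eq_mul]
    field_simp
  have hE : ∫ ω, g' (X ω + Y₁ ω) ∂ℙ = C⁻¹ * ∫ t, D t * g' t := by
    rw [← integral_map (φ := fun ω => X ω + Y₁ ω) hS.aemeasurable hg'm, hlaw,
      integral_withDensity_eq_integral_toReal_smul hdens (by simp), ← integral_const_mul]
    congr 1; ext t
    simp only [htr, smul_eq_mul]; ring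
  obtain ⟨F1, F2⟩ := vg_fubini ν m hνint hνmean D hD g' hg'loc hgD
  have hgm : ∀ x, ∫ t in m..x, g' t = g x - g m := by
    intro x
    have hi : ∀ a b : ℝ, IntervalIntegrable g' volume a b := fun a b =>
      (hg'loc.integrableOn_isCompact isCompact_uIcc).intervalIntegrable
    rw [hg x, hg m, ← intervalIntegral.integral_interval_sub_left (hi 0 x) (hi 0 m)]
    ring
  simp only [hgm] at F1 F2
  have hXint : Integrable X ℙ := hνint.comp_measurable hX
  have hXmean : ∫ ω, X ω ∂ℙ = m := by
    rw [← hνmean', hν, integral_map hX.aemeasurable (by fun_prop)]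
  have F1' : Integrable (fun ω => (X ω - m) * (g (X ω) - g m)) ℙ := F1.comp_measurable hX
  have F2' : ∫ ω, (X ω - m) * (g (X ω) - g m) ∂ℙ = ∫ t, D t * g' t := by
    rw [← F2, hν, integral_map hX.aemeasurable F1.aestronglyMeasurable]
  have hXm : Integrable (fun ω => (X ω - m) * g m) ℙ :=
    (hXint.sub (integrable_const _)).mul_const _
  have hXm0 : ∫ ω, (X ω - m) * g m ∂ℙ = 0 := by
    rw [integral_mul_const, integral_sub hXint (integrable_const _), hXmean]; simp
  have hmg : Integrable (fun ω => m * g (X ω)) ℙ := by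
    refine (hint2.sub (F1'.add hXm)).congr (Filter.Eventually.of_forall fun ω => ?_)
    simp only [Pi.sub_apply, Pi.add_apply]; ring
  rw [hXmean, hE, ← F2', ← integral_const_mul, ← integral_sub hint2 hmg]
  rw [← mul_assoc, mul_inv_cancel₀ hCpos.ne', one_mul]
  rw [← add_zero (∫ ω, (X ω - m) * (g (X ω) - g m) ∂ℙ), ← hXm0, ← integral_add F1' hXm]
  congr 1; ext ω; ring
end

section
/- Let X be a random variable with the CGMY(α, β, λ⁺, λ⁻) distribution, i.e. E[exp(itX)] = exp( ∫_ℝ (exp(itu) − 1) ν_cgmy(du) ) for all t ∈ ℝ, where ν_cgmy(du) = ( α u^{−1−β} e^{−λ⁺u} 1_{(0,∞)}(u) + α |u|^{−1−β} e^{−λ⁻|u|} 1_{(−∞,0)}(u) ) du with α, λ⁺, λ⁻ > 0 and β ∈ [0,1). Then for every absolutely continuous function g : ℝ → ℝ such that E[|X g(X)|] < ∞ and E[ ∫_ℝ |u g(X+u)| ν_cgmy(du) ] < ∞, one has E[X g(X)] = E[ ∫_ℝ u g(X+u) ν_cgmy(du) ]. -/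
open MeasureTheory ProbabilityTheory Set

namespace CGMYaux
open Filter Topology

/-- Iterated convolution powers of a measure. -/
noncomputable def convPow (ρ : Measure ℝ) : ℕ → Measure ℝ
  | 0 => Measure.dirac 0
  | n + 1 => (convPow ρ n).conv ρ

instance convPow_finite (ρ : Measure ℝ) [IsFiniteMeasure ρ] (n : ℕ) :
    IsFiniteMeasure (convPow ρ n) := by
  induction n with
  | zero => unfold convPow; infer_instance
  | succ n ih => unfold convPow; infer_instance

lemma charFun_convPow (ρ : Measure ℝ) [IsFiniteMeasure ρ] (n : ℕ) (t : ℝ) :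
    charFun (convPow ρ n) t = (charFun ρ t) ^ n := by
  induction n with
  | zero => simp [convPow, charFun_dirac]
  | succ n ih => rw [convPow, charFun_conv, ih, pow_succ]

lemma convPow_real_univ (ρ : Measure ℝ) [IsFiniteMeasure ρ] (n : ℕ) :
    (convPow ρ n).real univ = (ρ.real univ) ^ n := by
  have h := charFun_convPow ρ n 0
  rw [charFun_zero, charFun_zero] at h
  exact_mod_cast h

/-- compound Poisson distribution -/
noncomputable def CP (ρ : Measure ℝ) : Measure ℝ :=
  Measure.sum fun n : ℕ => ENNReal.ofReal (Real.exp (-ρ.real univ) / n.factorial) • convPow ρ n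

lemma hasSum_exp_mass (c : ℝ) :
    HasSum (fun n : ℕ => Real.exp (-c) / n.factorial * c ^ n) 1 := by
  have h := (NormedSpace.expSeries_div_hasSum_exp (𝔸 := ℝ) c).mul_left (Real.exp (-c))
  rw [← Real.exp_eq_exp_ℝ, ← Real.exp_add] at h
  simp only [neg_add_cancel, Real.exp_zero] at h
  refine h.congr_fun ?_ |> id
  intro n; ring

instance CP_prob (ρ : Measure ℝ) [IsFiniteMeasure ρ] : IsProbabilityMeasure (CP ρ) := by
  constructor
  have hs := hasSum_exp_mass (ρ.real univ)
  rw [CP, Measure.sum_apply _ MeasurableSet.univ]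
  have : ∀ n : ℕ, (ENNReal.ofReal (Real.exp (-ρ.real univ) / n.factorial) • convPow ρ n) univ
      = ENNReal.ofReal (Real.exp (-ρ.real univ) / n.factorial * (ρ.real univ) ^ n) := by
    intro n
    rw [Measure.smul_apply, smul_eq_mul, ENNReal.ofReal_mul (by positivity), ← convPow_real_univ,
      ofReal_measureReal]
  simp_rw [this]
  rw [← ENNReal.ofReal_tsum_of_nonneg (fun n => by positivity) hs.summable, hs.tsum_eq]
  simp

lemma integrable_cexp (ρ : Measure ℝ) [IsFiniteMeasure ρ] (t : ℝ) :
    Integrable (fun u : ℝ => Complex.exp (t * u * Complex.I)) ρ := by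
  refine (integrable_const (1 : ℝ)).mono (by fun_prop) ?_
  refine ae_of_all _ fun u => ?_
  rw [← Complex.ofReal_mul, Complex.norm_exp_ofReal_mul_I]; simp

lemma charFun_CP (ρ : Measure ℝ) [IsFiniteMeasure ρ] (t : ℝ) :
    charFun (CP ρ) t = Complex.exp (∫ u : ℝ, (Complex.exp (t * u * Complex.I) - 1) ∂ρ) := by
  have h1 := hasSum_integral_measure (f := fun u : ℝ => Complex.exp (t * u * Complex.I))
    (integrable_cexp (CP ρ) t)
  have h2 : ∀ n : ℕ, ∫ u : ℝ, Complex.exp (t * u * Complex.I)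
      ∂(ENNReal.ofReal (Real.exp (-ρ.real univ) / n.factorial) • convPow ρ n)
      = Complex.exp (-(ρ.real univ : ℂ)) * ((charFun ρ t) ^ n / n.factorial) := by
    intro n
    rw [integral_smul_measure, ← charFun_apply_real, charFun_convPow,
      ENNReal.toReal_ofReal (by positivity), Complex.real_smul]
    push_cast
    ring
  simp_rw [h2] at h1
  have h3 := (NormedSpace.expSeries_div_hasSum_exp (𝔸 := ℂ) (charFun ρ t)).mul_left
    (Complex.exp (-(ρ.real univ : ℂ)))
  rw [← Complex.exp_eq_exp_ℂ, ← Complex.exp_add] at h3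
  rw [charFun_apply_real]
  rw [show ∫ u : ℝ, Complex.exp (t * u * Complex.I) ∂(CP ρ) = _ from h1.unique h3]
  congr 1
  rw [integral_sub (integrable_cexp ρ t) (integrable_const _), charFun_apply_real]
  simp; ring

lemma le_CP (ρ : Measure ℝ) [IsFiniteMeasure ρ] :
    ENNReal.ofReal (Real.exp (-ρ.real univ)) • ρ ≤ CP ρ := by
  have := Measure.le_sum (fun n : ℕ =>
    ENNReal.ofReal (Real.exp (-ρ.real univ) / n.factorial) • convPow ρ n) 1
  simpa [convPow, CP] using this

lemma norm_cexp_sub_one_le (t u : ℝ) :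
    ‖Complex.exp (t * u * Complex.I) - 1‖ ≤ |t| * |u| := by
  have := Real.norm_exp_I_mul_ofReal_sub_one_le (x := t * u)
  rw [← abs_mul]
  rw [Real.norm_eq_abs] at this
  convert this using 3
  push_cast; ring_nf

lemma integrable_cexp_sub_one {ν : Measure ℝ} (hν : Integrable (fun u : ℝ => u) ν) (t : ℝ) :
    Integrable (fun u : ℝ => Complex.exp (t * u * Complex.I) - 1) ν := by
  refine (hν.norm.const_mul |t|).mono' (by fun_prop) (ae_of_all _ fun u => ?_)
  exact norm_cexp_sub_one_le t u

lemma hasDerivAt_psi {ν : Measure ℝ} (hν : Integrable (fun u : ℝ => u) ν) (t : ℝ) :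
    HasDerivAt (fun t : ℝ => ∫ u : ℝ, (Complex.exp (t * u * Complex.I) - 1) ∂ν)
      (∫ u : ℝ, (u * Complex.I * Complex.exp (t * u * Complex.I)) ∂ν) t := by
  refine (hasDerivAt_integral_of_dominated_loc_of_deriv_le (bound := fun u => ‖u‖)
    (F' := fun (t : ℝ) (u : ℝ) => (u * Complex.I * Complex.exp (t * u * Complex.I)))
    (s := univ) univ_mem ?_ (integrable_cexp_sub_one hν t) (by fun_prop) ?_ hν.norm ?_).2
  · exact Eventually.of_forall fun t => by fun_prop
  · refine ae_of_all _ fun u x _ => ?_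
    rw [norm_mul, ← Complex.ofReal_mul, Complex.norm_exp_ofReal_mul_I]; simp
  · refine ae_of_all _ fun u x _ => ?_
    have h : HasDerivAt (fun t : ℝ => (t : ℂ) * u * Complex.I) (u * Complex.I) x := by
      have := ((Complex.ofRealCLM.hasDerivAt (x := x)).mul_const (u * Complex.I : ℂ))
      simpa [mul_assoc] using this
    have := (h.cexp).sub_const 1
    convert this using 1
    ring

/-- Existence of the infinitely divisible law with finite-variation Lévy measure. -/
lemma exists_levy {ν : Measure ℝ} (hν : Integrable (fun u : ℝ => u) ν) :
    ∃ P : Measure ℝ, IsProbabilityMeasure P ∧ ∀ t : ℝ,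
      charFun P t = Complex.exp (∫ u : ℝ, (Complex.exp (t * u * Complex.I) - 1) ∂ν) := by
  let S : ℕ → Set ℝ := fun n => {u : ℝ | 1 / ((n : ℝ) + 1) < ‖u‖}
  have hSm : ∀ n, MeasurableSet (S n) := fun n => measurableSet_lt measurable_const (by fun_prop)
  have hfin : ∀ n, IsFiniteMeasure (ν.restrict (S n)) := by
    intro n
    refine ⟨?_⟩
    rw [Measure.restrict_apply_univ]
    exact hν.measure_norm_gt_lt_top (by positivity)
  let Q : ℕ → ProbabilityMeasure ℝ := fun n => ⟨CP (ν.restrict (S n)), inferInstance⟩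
  have hlim : ∀ t : ℝ, Tendsto (fun n => charFun (Q n : Measure ℝ) t) atTop
      (𝓝 (Complex.exp (∫ u : ℝ, (Complex.exp (t * u * Complex.I) - 1) ∂ν))) := by
    intro t
    have : (fun n => charFun (Q n : Measure ℝ) t) = fun n => Complex.exp
        (∫ u : ℝ, (S n).indicator (fun u : ℝ => Complex.exp (t * u * Complex.I) - 1) u ∂ν) := by
      funext n
      rw [integral_indicator (hSm n)]
      exact charFun_CP (ν.restrict (S n)) t
    rw [this]
    refine (Complex.continuous_exp.tendsto _).comp ?_
    refine tendsto_integral_of_dominated_convergence (fun u : ℝ => |t| * |u|) ?_ ?_ ?_ ?_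
    · intro n
      refine Measurable.aestronglyMeasurable ?_
      exact Measurable.indicator (by fun_prop) (hSm n)
    · exact (hν.norm.const_mul |t|)
    · intro n
      refine ae_of_all _ fun u => ?_
      exact (norm_indicator_le_norm_self (fun u : ℝ => Complex.exp (t * u * Complex.I) - 1) u).trans
        (norm_cexp_sub_one_le t u)
    · refine ae_of_all _ fun u => ?_
      rcases eq_or_ne u 0 with rfl | hu
      · simp [Set.indicator]
      · refine tendsto_const_nhds.congr' ?_
        have h0 := (tendsto_one_div_add_atTop_nhds_zero_nat (𝕜 := ℝ)).eventually_lt_const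
          (norm_pos_iff.mpr hu)
        filter_upwards [h0] with n hn
        rw [Set.indicator_of_mem (show u ∈ S n from hn)]
  have hcont : ContinuousAt (fun t : ℝ =>
      Complex.exp (∫ u : ℝ, (Complex.exp (t * u * Complex.I) - 1) ∂ν)) 0 :=
    ((hasDerivAt_psi hν 0).cexp).continuousAt
  have htight := isTightMeasureSet_of_tendsto_charFun (μ := fun n => (Q n : Measure ℝ)) hcont hlim
  have hcomp : IsCompact (closure (Set.range Q)) := by
    apply isCompact_closure_of_isTightMeasureSet
    convert htight using 1
    ext; simp
  obtain ⟨P, -, hP⟩ := hcomp.exists_mapClusterPt (f := (atTop : Filter ℕ)) (u := Q)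
    (by simp only [le_principal_iff, mem_map]
        exact Eventually.of_forall fun n => subset_closure (mem_range_self n))
  refine ⟨P, inferInstance, fun t => ?_⟩
  have hc : Continuous (fun R : ProbabilityMeasure ℝ => charFun (R : Measure ℝ) t) := by
    rw [continuous_iff_continuousAt]
    intro R
    have := (ProbabilityMeasure.tendsto_iff_forall_integral_rclike_tendsto ℂ).1
      (tendsto_id (α := ProbabilityMeasure ℝ) (x := 𝓝 R)) (BoundedContinuousFunction.innerProbChar t)
    simpa only [ContinuousAt, charFun_eq_integral_innerProbChar, id] using this
  have h1 : MapClusterPt (charFun (P : Measure ℝ) t) atTop (fun n => charFun (Q n : Measure ℝ) t) :=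
    MapClusterPt.continuousAt_comp (hu := hP) (f := fun R : ProbabilityMeasure ℝ => charFun (R : Measure ℝ) t)
      hc.continuousAt
  have h2 := hlim t
  exact eq_of_nhds_neBot (ClusterPt.mono h1 h2)
end CGMYaux

namespace CGMYaux
open Filter Topology

lemma one_sub_re_le {ν : Measure ℝ} (hν : Integrable (fun u : ℝ => u) ν)
    (hν2 : Integrable (fun u : ℝ => u ^ 2) ν) (t : ℝ) :
    1 - (Complex.exp (∫ u : ℝ, (Complex.exp (t * u * Complex.I) - 1) ∂ν)).re ≤
      t ^ 2 * ((∫ u : ℝ, u ^ 2 ∂ν) / 2 + (∫ u : ℝ, |u| ∂ν) ^ 2 / 2) := by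
  have hi := integrable_cexp_sub_one hν t
  set z := ∫ u : ℝ, (Complex.exp (t * u * Complex.I) - 1) ∂ν with hz
  have hre : z.re = ∫ u : ℝ, (Real.cos (t * u) - 1) ∂ν := by
    rw [hz, ← RCLike.re_eq_complex_re, ← integral_re hi]
    refine integral_congr_ae (ae_of_all _ fun u => ?_)
    simp only [RCLike.re_eq_complex_re, Complex.sub_re, Complex.one_re]
    rw [← Complex.ofReal_mul, Complex.exp_ofReal_mul_I_re]
  have hci : Integrable (fun u : ℝ => Real.cos (t * u) - 1) ν := by
    have := hi.re
    refine this.congr (ae_of_all _ fun u => ?_)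
    simp only [RCLike.re_eq_complex_re, Complex.sub_re, Complex.one_re]
    rw [← Complex.ofReal_mul, Complex.exp_ofReal_mul_I_re]
  have hre0 : z.re ≤ 0 := by
    rw [hre]
    exact integral_nonpos fun u => by simpa using Real.cos_le_one (t * u)
  have hre1 : -(t ^ 2 / 2 * ∫ u : ℝ, u ^ 2 ∂ν) ≤ z.re := by
    rw [hre, ← integral_const_mul, ← integral_neg]
    refine integral_mono (hν2.const_mul _).neg hci fun u => ?_
    have := Real.one_sub_sq_div_two_le_cos (x := t * u)
    simp only
    nlinarith
  have him : |z.im| ≤ |t| * ∫ u : ℝ, |u| ∂ν := by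
    refine (Complex.abs_im_le_norm z).trans ?_
    rw [hz, ← integral_const_mul]
    exact norm_integral_le_of_norm_le (hν.norm.const_mul |t|)
      (ae_of_all _ fun u => norm_cexp_sub_one_le t u)
  have him2 : z.im ^ 2 ≤ t ^ 2 * (∫ u : ℝ, |u| ∂ν) ^ 2 := by
    rw [← sq_abs z.im, ← sq_abs t, ← mul_pow]
    gcongr
  rw [Complex.exp_re]
  have e1 := Real.add_one_le_exp z.re
  have e2 : Real.exp z.re ≤ 1 := Real.exp_le_one_iff.2 hre0
  have e3 := Real.one_sub_sq_div_two_le_cos (x := z.im)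
  have e4 := Real.exp_pos z.re
  have e5 : Real.exp z.re * (1 - Real.cos z.im) ≤ 1 * (z.im ^ 2 / 2) := by
    apply mul_le_mul e2 (by linarith) (by linarith [Real.cos_le_one z.im]) zero_le_one
  nlinarith

lemma memLp_two {μ ν : Measure ℝ} [IsProbabilityMeasure μ]
    (hν : Integrable (fun u : ℝ => u) ν) (hν2 : Integrable (fun u : ℝ => u ^ 2) ν)
    (hcf : ∀ t : ℝ, charFun μ t =
      Complex.exp (∫ u : ℝ, (Complex.exp (t * u * Complex.I) - 1) ∂ν)) :
    Integrable (fun x : ℝ => x) μ := by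
  set C : ℝ := (∫ u : ℝ, u ^ 2 ∂ν) / 2 + (∫ u : ℝ, |u| ∂ν) ^ 2 / 2 with hC
  let s : ℕ → ℝ := fun n => 1 / ((n : ℝ) + 1)
  have hs : ∀ n, 0 < s n := fun n => by positivity
  let f : ℕ → ℝ → ENNReal := fun n x => ENNReal.ofReal ((1 - Real.cos (s n * x)) / s n ^ 2)
  have hfm : ∀ n, Measurable (f n) := fun n => by
    simp only [f]; fun_prop
  have hbound : ∀ n, ∫⁻ x, f n x ∂μ ≤ ENNReal.ofReal C := by
    intro n
    have hi : Integrable (fun x : ℝ => Real.cos (s n * x)) μ :=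
      (integrable_const (1 : ℝ)).mono (by fun_prop)
        (ae_of_all _ fun x => by simpa using Real.abs_cos_le_one _)
    have hi2 : Integrable (fun x : ℝ => (1 - Real.cos (s n * x)) / s n ^ 2) μ :=
      ((integrable_const (1 : ℝ)).sub hi).div_const _
    rw [← ofReal_integral_eq_lintegral_ofReal hi2
      (ae_of_all _ fun x => div_nonneg (by simpa using Real.cos_le_one _) (by positivity))]
    refine ENNReal.ofReal_le_ofReal ?_
    rw [integral_div, div_le_iff₀ (pow_pos (hs n) 2), integral_sub (integrable_const _) hi]
    have hre : ∫ x : ℝ, Real.cos (s n * x) ∂μ = (charFun μ (s n)).re := by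
      rw [charFun_apply_real, ← RCLike.re_eq_complex_re, ← integral_re (integrable_cexp μ (s n))]
      refine integral_congr_ae (ae_of_all _ fun u => ?_)
      simp only [RCLike.re_eq_complex_re]
      rw [← Complex.ofReal_mul, Complex.exp_ofReal_mul_I_re]
    rw [hre, hcf]
    have := one_sub_re_le hν hν2 (s n)
    simp only [integral_const, probReal_univ, smul_eq_mul, mul_one]
    rw [← hC] at this
    linarith
  have hlow : ∀ x : ℝ, ENNReal.ofReal (2 / Real.pi ^ 2 * x ^ 2) ≤
      liminf (fun n => f n x) atTop := by
    intro x
    refine le_liminf_of_le (by isBoundedDefault) ?_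
    have ht : Tendsto (fun n : ℕ => s n * |x|) atTop (𝓝 (0 * |x|)) :=
      (tendsto_one_div_add_atTop_nhds_zero_nat (𝕜 := ℝ)).mul_const _
    rw [zero_mul] at ht
    filter_upwards [ht.eventually_lt_const Real.pi_pos] with n hn
    refine ENNReal.ofReal_le_ofReal ?_
    rw [le_div_iff₀ (pow_pos (hs n) 2)]
    have := Real.cos_le_one_sub_mul_cos_sq (x := s n * x)
      (by rw [abs_mul, abs_of_pos (hs n)]; exact hn.le)
    rw [mul_pow] at this
    linarith
  have hfin : ∫⁻ x : ℝ, ENNReal.ofReal (2 / Real.pi ^ 2 * x ^ 2) ∂μ < ⊤ := by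
    calc _ ≤ ∫⁻ x, liminf (fun n => f n x) atTop ∂μ := lintegral_mono hlow
      _ ≤ liminf (fun n => ∫⁻ x, f n x ∂μ) atTop := lintegral_liminf_le hfm
      _ ≤ ENNReal.ofReal C := by
        refine liminf_le_of_frequently_le' (Frequently.of_forall hbound)
      _ < ⊤ := ENNReal.ofReal_lt_top
  have hint : Integrable (fun x : ℝ => 2 / Real.pi ^ 2 * x ^ 2) μ :=
    ⟨by fun_prop, by
      rw [hasFiniteIntegral_iff_ofReal (ae_of_all _ fun x => by positivity)]; exact hfin⟩
  have hint2 : Integrable (fun x : ℝ => x ^ 2) μ := by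
    refine (hint.const_mul (Real.pi ^ 2 / 2)).congr (ae_of_all _ fun x => ?_)
    have := Real.pi_ne_zero
    simp only
    field_simp
  refine ((integrable_const (1:ℝ)).add hint2).mono' (by fun_prop) (ae_of_all _ fun x => ?_)
  simp only [Real.norm_eq_abs, Pi.add_apply]
  nlinarith [sq_abs x, sq_nonneg (|x| - 1), abs_nonneg x]

lemma integral_cexp_identity {μ ν : Measure ℝ} [IsProbabilityMeasure μ]
    (hν : Integrable (fun u : ℝ => u) ν) (hμ : Integrable (fun u : ℝ => u) μ)
    (hcf : ∀ t : ℝ, charFun μ t =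
      Complex.exp (∫ u : ℝ, (Complex.exp (t * u * Complex.I) - 1) ∂ν)) (t : ℝ) :
    ∫ x : ℝ, x * Complex.exp (t * x * Complex.I) ∂μ =
      charFun μ t * ∫ x : ℝ, x * Complex.exp (t * x * Complex.I) ∂ν := by
  have h1 := hasDerivAt_psi hμ t
  have h2 := (hasDerivAt_psi hν t).cexp
  have h3 : (fun t : ℝ => ∫ u : ℝ, (Complex.exp (t * u * Complex.I) - 1) ∂μ) =
      fun t : ℝ => Complex.exp (∫ u : ℝ, (Complex.exp (t * u * Complex.I) - 1) ∂ν) - 1 := by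
    funext t
    rw [← hcf, integral_sub (integrable_cexp μ t) (integrable_const _), charFun_apply_real]
    simp
  rw [h3] at h1
  have h4 := h1.unique (h2.sub_const 1)
  rw [← hcf] at h4
  have h5 : ∀ m : Measure ℝ, ∫ u : ℝ, (u * Complex.I * Complex.exp (t * u * Complex.I)) ∂m =
      Complex.I * ∫ u : ℝ, (u * Complex.exp (t * u * Complex.I)) ∂m := by
    intro m
    rw [← integral_const_mul]
    congr 1; funext u; ring
  rw [h5, h5] at h4
  apply mul_left_cancel₀ Complex.I_ne_zero
  rw [h4]; ring

lemma finite_wd {m : Measure ℝ} (hm : Integrable (fun u : ℝ => u) m) :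
    IsFiniteMeasure (m.withDensity fun u => ENNReal.ofReal u) :=
  isFiniteMeasure_withDensity_ofReal hm.2

lemma finite_wd_neg {m : Measure ℝ} (hm : Integrable (fun u : ℝ => u) m) :
    IsFiniteMeasure (m.withDensity fun u => ENNReal.ofReal (-u)) :=
  isFiniteMeasure_withDensity_ofReal hm.neg.2

lemma toReal_sub (x : ℝ) :
    (ENNReal.ofReal x).toReal - (ENNReal.ofReal (-x)).toReal = x := by
  rcases le_total 0 x with h | h
  · rw [ENNReal.toReal_ofReal h, ENNReal.ofReal_of_nonpos (by linarith)]; simp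
  · rw [ENNReal.ofReal_of_nonpos h, ENNReal.toReal_ofReal (by linarith)]; simp

lemma charFun_wd_sub {m : Measure ℝ} (hm : Integrable (fun u : ℝ => u) m) (t : ℝ) :
    charFun (m.withDensity fun u => ENNReal.ofReal u) t
      - charFun (m.withDensity fun u => ENNReal.ofReal (-u)) t
      = ∫ x : ℝ, x * Complex.exp (t * x * Complex.I) ∂m := by
  have f1 := finite_wd hm
  have f2 := finite_wd_neg hm
  have i1 := integrable_cexp (m.withDensity fun u => ENNReal.ofReal u) t
  have i2 := integrable_cexp (m.withDensity fun u => ENNReal.ofReal (-u)) t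
  rw [integrable_withDensity_iff_integrable_smul' (by fun_prop) (by simp)] at i1 i2
  rw [charFun_apply_real, charFun_apply_real,
    integral_withDensity_eq_integral_toReal_smul (by fun_prop) (by simp),
    integral_withDensity_eq_integral_toReal_smul (by fun_prop) (by simp), ← integral_sub i1 i2]
  congr 1; funext x
  rw [← sub_smul, toReal_sub, Complex.real_smul]

lemma charFun_add' (m n : Measure ℝ) [IsFiniteMeasure m] [IsFiniteMeasure n] (t : ℝ) :
    charFun (m + n) t = charFun m t + charFun n t := by
  simp only [charFun_apply_real]
  rw [integral_add_measure (integrable_cexp m t) (integrable_cexp n t)]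

lemma measure_identity {μ ν : Measure ℝ} [IsProbabilityMeasure μ]
    (hν : Integrable (fun u : ℝ => u) ν) (hμ : Integrable (fun u : ℝ => u) μ)
    (hcf : ∀ t : ℝ, charFun μ t =
      Complex.exp (∫ u : ℝ, (Complex.exp (t * u * Complex.I) - 1) ∂ν)) :
    (μ.withDensity fun u => ENNReal.ofReal u)
        + μ.conv (ν.withDensity fun u => ENNReal.ofReal (-u)) =
      (μ.withDensity fun u => ENNReal.ofReal (-u))
        + μ.conv (ν.withDensity fun u => ENNReal.ofReal u) := by
  have f1 := finite_wd hμ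
  have f2 := finite_wd_neg hμ
  have f3 := finite_wd hν
  have f4 := finite_wd_neg hν
  apply Measure.ext_of_charFun
  funext t
  rw [charFun_add', charFun_add', charFun_conv, charFun_conv]
  have h := integral_cexp_identity hν hμ hcf t
  rw [← charFun_wd_sub hμ, ← charFun_wd_sub hν] at h
  linear_combination h

lemma stein_general {μ ν : Measure ℝ} [IsProbabilityMeasure μ] [SFinite ν]
    (hν : Integrable (fun u : ℝ => u) ν) (hμ : Integrable (fun u : ℝ => u) μ)
    (hcf : ∀ t : ℝ, charFun μ t =
      Complex.exp (∫ u : ℝ, (Complex.exp (t * u * Complex.I) - 1) ∂ν))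
    (g : ℝ → ℝ) (hg : Measurable g) (h1 : Integrable (fun x => x * g x) μ)
    (h2 : Integrable (fun p : ℝ × ℝ => p.2 * g (p.1 + p.2)) (μ.prod ν)) :
    ∫ x, x * g x ∂μ = ∫ x, ∫ u, u * g (x + u) ∂ν ∂μ := by
  rw [integral_integral (f := fun x u => u * g (x + u)) h2]
  have key := congrArg (fun m : Measure ℝ => ∫ x, g x ∂m) (measure_identity hν hμ hcf)
  have pw : ∀ x y : ℝ, ‖(ENNReal.ofReal x).toReal * y‖ ≤ ‖x * y‖ := by
    intro x y
    rw [norm_mul, norm_mul]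
    gcongr
    rcases le_total 0 x with h | h
    · rw [ENNReal.toReal_ofReal h]
    · rw [ENNReal.ofReal_of_nonpos h]; simp
  have a1 : Integrable (fun x => (ENNReal.ofReal x).toReal * g x) μ :=
    h1.mono (by fun_prop) (ae_of_all _ fun x => pw x (g x))
  have a2 : Integrable (fun x => (ENNReal.ofReal (-x)).toReal * g x) μ :=
    h1.mono (by fun_prop) (ae_of_all _ fun x => by simpa using pw (-x) (g x))
  have a3 : Integrable (fun p : ℝ × ℝ => (ENNReal.ofReal p.2).toReal * g (p.1 + p.2)) (μ.prod ν) :=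
    h2.mono (by fun_prop) (ae_of_all _ fun x => pw _ _)
  have a4 : Integrable (fun p : ℝ × ℝ => (ENNReal.ofReal (-p.2)).toReal * g (p.1 + p.2))
      (μ.prod ν) :=
    h2.mono (by fun_prop) (ae_of_all _ fun x => by simpa using pw (-x.2) (g (x.1 + x.2)))
  have b1 : Integrable g (μ.withDensity fun u => ENNReal.ofReal u) :=
    (integrable_withDensity_iff_integrable_smul' (by fun_prop) (by simp)).2 a1
  have b2 : Integrable g (μ.withDensity fun u => ENNReal.ofReal (-u)) :=
    (integrable_withDensity_iff_integrable_smul' (by fun_prop) (by simp)).2 a2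
  have c : ∀ f : ℝ → ENNReal, Measurable f → (∀ x, f x < ⊤) →
      Integrable (fun p : ℝ × ℝ => (f p.2).toReal * g (p.1 + p.2)) (μ.prod ν) →
      Integrable g (μ.conv (ν.withDensity f)) ∧ ∫ x, g x ∂(μ.conv (ν.withDensity f)) =
        ∫ p : ℝ × ℝ, (f p.2).toReal * g (p.1 + p.2) ∂(μ.prod ν) := by
    intro f hf hft hi
    have hm : Measurable (fun p : ℝ × ℝ => f p.2) := hf.comp measurable_snd
    rw [Measure.conv, prod_withDensity_right hf]
    constructor
    · rw [integrable_map_measure hg.aestronglyMeasurable (by fun_prop),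
        integrable_withDensity_iff_integrable_smul' hm (by simp [hft])]
      exact hi
    · rw [integral_map (by fun_prop) hg.aestronglyMeasurable,
        integral_withDensity_eq_integral_toReal_smul hm (by simp [hft])]
      rfl
  obtain ⟨b3, e3⟩ := c (fun u => ENNReal.ofReal u) (by fun_prop) (by simp) a3
  obtain ⟨b4, e4⟩ := c (fun u => ENNReal.ofReal (-u)) (by fun_prop) (by simp) a4
  rw [integral_add_measure b1 b4, integral_add_measure b2 b3, e3, e4,
    integral_withDensity_eq_integral_toReal_smul (by fun_prop) (by simp),
    integral_withDensity_eq_integral_toReal_smul (by fun_prop) (by simp)] at key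
  simp only [smul_eq_mul] at key
  have s1 : ∫ x, x * g x ∂μ = ∫ x, (ENNReal.ofReal x).toReal * g x ∂μ
      - ∫ x, (ENNReal.ofReal (-x)).toReal * g x ∂μ := by
    rw [← integral_sub a1 a2]
    congr 1; funext x
    rw [← sub_mul, toReal_sub]
  have s2 : ∫ p : ℝ × ℝ, p.2 * g (p.1 + p.2) ∂(μ.prod ν) =
      ∫ p : ℝ × ℝ, (ENNReal.ofReal p.2).toReal * g (p.1 + p.2) ∂(μ.prod ν)
      - ∫ p : ℝ × ℝ, (ENNReal.ofReal (-p.2)).toReal * g (p.1 + p.2) ∂(μ.prod ν) := by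
    rw [← integral_sub a3 a4]
    congr 1; funext x
    rw [← sub_mul, toReal_sub]
  linarith
end CGMYaux

namespace CGMYaux
open Filter Topology

lemma exists_shift {μ ν : Measure ℝ} [IsProbabilityMeasure μ]
    (hν : Integrable (fun u : ℝ => u) ν)
    (hcf : ∀ t : ℝ, charFun μ t =
      Complex.exp (∫ u : ℝ, (Complex.exp (t * u * Complex.I) - 1) ∂ν))
    (h : ℝ → ENNReal) (hm : Measurable h) (hfin : ∫⁻ x, h x ∂μ < ⊤) :
    ∃ z : ℝ, ∫⁻ u in {u : ℝ | 1 < ‖u‖}, h (z + u) ∂ν < ⊤ := by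
  set S : Set ℝ := {u : ℝ | 1 < ‖u‖} with hS
  have hSm : MeasurableSet S := measurableSet_lt measurable_const (by fun_prop)
  have : IsFiniteMeasure (ν.restrict S) := by
    refine ⟨?_⟩
    rw [Measure.restrict_apply_univ]
    exact hν.measure_norm_gt_lt_top one_pos
  obtain ⟨P, hP, hPc⟩ := exists_levy (ν := ν.restrict Sᶜ) hν.restrict
  have hμ : μ = P.conv (CP (ν.restrict S)) := by
    apply Measure.ext_of_charFun
    funext t
    rw [charFun_conv, hPc, charFun_CP, hcf, ← Complex.exp_add, add_comm,
      integral_add_compl hSm (integrable_cexp_sub_one hν t)]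
  rw [hμ, Measure.lintegral_conv hm] at hfin
  have hae := ae_lt_top (by fun_prop) hfin.ne
  obtain ⟨z, hz⟩ := hae.exists
  refine ⟨z, ?_⟩
  set c := ENNReal.ofReal (Real.exp (-(ν.restrict S).real univ)) with hc
  have hc0 : c ≠ 0 := by
    rw [hc]; simp [Real.exp_pos]
  have hle : c * ∫⁻ u in S, h (z + u) ∂ν ≤ ∫⁻ u, h (z + u) ∂(CP (ν.restrict S)) := by
    rw [← smul_eq_mul, ← lintegral_smul_measure]
    exact lintegral_mono' (le_CP _) le_rfl
  exact ENNReal.lt_top_of_mul_ne_top_right (hle.trans_lt hz).ne hc0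

/-- The CGMY density. -/
noncomputable def dens (α β lp lm : ℝ) (u : ℝ) : ℝ :=
  (Ioi (0:ℝ)).indicator (fun u => α * u ^ (-1 - β) * Real.exp (-lp * u)) u
    + (Iio (0:ℝ)).indicator (fun u => α * |u| ^ (-1 - β) * Real.exp (-lm * |u|)) u

lemma dens_pos {α β lp lm u : ℝ} (hu : 0 < u) :
    dens α β lp lm u = α * |u| ^ (-1 - β) * Real.exp (-lp * |u|) := by
  have : ¬ u < 0 := not_lt.2 hu.le
  simp [dens, hu, abs_of_pos hu, this]

lemma dens_neg {α β lp lm u : ℝ} (hu : u < 0) :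
    dens α β lp lm u = α * |u| ^ (-1 - β) * Real.exp (-lm * |u|) := by
  have : ¬ 0 < u := not_lt.2 hu.le
  simp [dens, hu, this]

lemma dens_nonneg {α β lp lm : ℝ} (hα : 0 < α) (u : ℝ) : 0 ≤ dens α β lp lm u := by
  rcases lt_trichotomy u 0 with h | h | h
  · rw [dens_neg h]; positivity
  · simp [dens, h]
  · rw [dens_pos h]; positivity

lemma dens_measurable (α β lp lm : ℝ) : Measurable (dens α β lp lm) := by
  unfold dens
  refine Measurable.add ?_ ?_
  · exact Measurable.indicator (by fun_prop) measurableSet_Ioi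
  · exact Measurable.indicator (by fun_prop) measurableSet_Iio

lemma one_side {α β l q : ℝ} (hl : 0 < l) (hq : β < q) :
    IntegrableOn (fun u : ℝ => |u| ^ q * (α * |u| ^ (-1 - β) * Real.exp (-l * |u|))) (Ioi 0) := by
  have h : IntegrableOn (fun u : ℝ => α * (u ^ (q - 1 - β) * Real.exp (-l * u ^ (1:ℝ)))) (Ioi 0) :=
    (integrableOn_rpow_mul_exp_neg_mul_rpow (s := q - 1 - β) (p := 1) (b := l)
      (by linarith) one_pos hl).const_mul α
  refine h.congr_fun (fun u hu => ?_) measurableSet_Ioi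
  have hu' : (0:ℝ) < u := hu
  simp only [Real.rpow_one, abs_of_pos hu']
  rw [show q - 1 - β = q + (-1 - β) by ring, Real.rpow_add hu']
  ring

lemma integrable_rpow_dens {α β lp lm q : ℝ} (hlp : 0 < lp) (hlm : 0 < lm) (hq : β < q) :
    Integrable (fun u : ℝ => |u| ^ q * dens α β lp lm u) := by
  have h1 : IntegrableOn (fun u : ℝ => |u| ^ q * dens α β lp lm u) (Ioi 0) :=
    (one_side (α := α) hlp hq).congr_fun (fun u hu => by simp only [dens_pos (show 0 < u from hu)])
      measurableSet_Ioi
  have h2 : IntegrableOn (fun u : ℝ => |u| ^ q * dens α β lp lm u) (Iio 0) := by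
    have h := (one_side (α := α) hlm hq)
    rw [← neg_zero] at h
    refine h.comp_neg_Iio.congr_fun (fun u hu => ?_) measurableSet_Iio
    simp only [dens_neg (show u < 0 from hu), abs_neg]
  rw [← integrableOn_univ, ← Iic_union_Ioi (a := (0:ℝ)), integrableOn_union]
  exact ⟨(integrableOn_Iic_iff_integrableOn_Iio enorm_ne_top).2 h2, h1⟩

lemma kernel_compare {α β l v w D : ℝ} (hα : 0 < α) (hβ : 0 ≤ β) (hl : 0 < l) (hv : 0 < v)
    (hw : 0 < w) (h3 : w ≤ 3 * v) (hD : |w - v| ≤ D) :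
    α * v ^ (-1 - β) * Real.exp (-l * v) ≤
      (3 ^ (1 + β) * Real.exp (l * D)) * (α * w ^ (-1 - β) * Real.exp (-l * w)) := by
  have e1 : v ^ (-1 - β) ≤ 3 ^ (1 + β) * w ^ (-1 - β) := by
    calc v ^ (-1 - β) ≤ (w / 3) ^ (-1 - β) :=
          Real.rpow_le_rpow_of_nonpos (by positivity) (by linarith) (by linarith)
      _ = 3 ^ (1 + β) * w ^ (-1 - β) := by
          rw [Real.div_rpow hw.le (by norm_num), show -1 - β = -(1 + β) by ring,
            Real.rpow_neg (by norm_num : (0:ℝ) ≤ 3)]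
          field_simp
  have e2 : Real.exp (-l * v) ≤ Real.exp (l * D) * Real.exp (-l * w) := by
    rw [← Real.exp_add]
    apply Real.exp_le_exp.2
    nlinarith [le_abs_self (w - v)]
  calc α * v ^ (-1 - β) * Real.exp (-l * v)
      ≤ α * (3 ^ (1 + β) * w ^ (-1 - β)) * (Real.exp (l * D) * Real.exp (-l * w)) := by gcongr
    _ = _ := by ring

lemma dens_compare {α β lp lm x z y : ℝ} (hα : 0 < α) (hβ : 0 ≤ β) (hlp : 0 < lp) (hlm : 0 < lm)
    (hy : 2 * (|x| + |z|) + 2 < |y|) :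
    dens α β lp lm (y - x) ≤
      (3 ^ (1 + β) * Real.exp ((lp + lm) * |x - z|)) * dens α β lp lm (y - z) := by
  have ax := abs_le.1 (le_refl |x|)
  have az := abs_le.1 (le_refl |z|)
  have a0 := abs_nonneg x
  have b0 := abs_nonneg z
  have c0 := abs_nonneg (x - z)
  have key : ∀ l, 0 < l → l ≤ lp + lm → 0 < |y - x| → 0 < |y - z| → |y - z| ≤ 3 * |y - x| →
      α * |y - x| ^ (-1 - β) * Real.exp (-l * |y - x|) ≤
      (3 ^ (1 + β) * Real.exp ((lp + lm) * |x - z|)) *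
        (α * |y - z| ^ (-1 - β) * Real.exp (-l * |y - z|)) := by
    intro l hl hl2 hv hw h3
    refine (kernel_compare (D := |x - z|) hα hβ hl hv hw h3 ?_).trans ?_
    · refine (abs_abs_sub_abs_le_abs_sub _ _).trans ?_
      rw [show y - z - (y - x) = x - z by ring]
    · gcongr
  rcases le_or_gt 0 y with h | h
  · rw [abs_of_nonneg h] at hy
    have hv : 0 < y - x := by linarith
    have hw : 0 < y - z := by linarith
    rw [dens_pos hv, dens_pos hw]
    refine key lp hlp (by linarith) (abs_pos_of_pos hv) (abs_pos_of_pos hw) ?_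
    rw [abs_of_pos hv, abs_of_pos hw]; linarith
  · rw [abs_of_neg h] at hy
    have hv : y - x < 0 := by linarith
    have hw : y - z < 0 := by linarith
    rw [dens_neg hv, dens_neg hw]
    refine key lm hlm (by linarith) (abs_pos_of_neg hv) (abs_pos_of_neg hw) ?_
    rw [abs_of_neg hv, abs_of_neg hw]; linarith

lemma transfer {α β lp lm : ℝ} (hα : 0 < α) (hβ : β ∈ Ico (0:ℝ) 1) (hlp : 0 < lp) (hlm : 0 < lm)
    {g : ℝ → ℝ} (hg : Continuous g) (z : ℝ)
    (hz : Integrable (fun u : ℝ => {u : ℝ | 1 < ‖u‖}.indicator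
      (fun u => |(z + u) * g (z + u)| * dens α β lp lm u) u)) (x : ℝ) :
    Integrable (fun u : ℝ => u * g (x + u) * dens α β lp lm u) := by
  have hdm := dens_measurable α β lp lm
  have hgm := hg.measurable
  have h1 := hz.comp_sub_right z
  have h2 := (integrable_rpow_dens (α := α) (q := 1) hlp hlm hβ.2).comp_sub_right x
  suffices h : Integrable (fun y : ℝ => (y - x) * g y * dens α β lp lm (y - x)) by
    have := h.comp_add_left x
    simpa using this
  set R := 2 * (|x| + |z|) + 2 with hR
  obtain ⟨M, hM⟩ := (isCompact_Icc (a := -R) (b := R)).exists_bound_of_continuousOn hg.continuousOn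
  set C := (3 ^ (1 + β) * Real.exp ((lp + lm) * |x - z|)) with hC
  have hC0 : 0 ≤ C := by positivity
  refine ((h1.const_mul (2 * C)).add (h2.const_mul |M|)).mono' (by fun_prop)
    (ae_of_all _ fun y => ?_)
  simp only [Pi.add_apply, Real.norm_eq_abs, Real.rpow_one, add_sub_cancel, abs_mul]
  rw [abs_of_nonneg (dens_nonneg hα (y - x))]
  have hd := dens_nonneg (β := β) (lp := lp) (lm := lm) hα (y - x)
  have hdz := dens_nonneg (β := β) (lp := lp) (lm := lm) hα (y - z)
  rcases le_or_gt |y| R with h | h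
  · have hb := hM y (abs_le.1 h)
    have hi : 0 ≤ {u : ℝ | 1 < |u|}.indicator
      (fun u => |z + u| * |g (z + u)| * dens α β lp lm u) (y - z) :=
      Set.indicator_nonneg (fun u _ => mul_nonneg (by positivity) (dens_nonneg hα u)) _
    have : |y - x| * |g y| * dens α β lp lm (y - x) ≤
        |M| * (|y - x| * dens α β lp lm (y - x)) := by
      rw [mul_comm |y - x|, mul_assoc]
      exact mul_le_mul_of_nonneg_right (hb.trans (le_abs_self M)) (by positivity)
    have h5 := mul_nonneg (mul_nonneg zero_le_two hC0) hi
    linarith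
  · have hmem : y - z ∈ {u : ℝ | 1 < |u|} := by
      have := abs_sub_abs_le_abs_sub y z
      have := abs_nonneg x
      have := abs_nonneg z
      simp only [mem_ofPred_eq]
      linarith
    rw [Set.indicator_of_mem hmem]
    have hcmp := dens_compare (α := α) (β := β) (lp := lp) (lm := lm) hα hβ.1 hlp hlm h
    have h3 : |y - x| ≤ 2 * |y| := by
      have := abs_sub y x
      have := abs_nonneg x
      have := abs_nonneg z
      linarith
    have h4 : 0 ≤ |M| * (|y - x| * dens α β lp lm (y - x)) := by positivity
    have h5 : |y - x| * |g y| * dens α β lp lm (y - x) ≤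
        2 * |y| * |g y| * (C * dens α β lp lm (y - z)) := by
      gcongr
    simp only [add_sub_cancel]
    linarith
end CGMYaux

/-- **Stein-type identity for the CGMY distribution.**
If `X ~ CGMY(α, β, λ⁺, λ⁻)`, i.e. `E[e^{itX}] = exp(∫ (e^{itu} - 1) ν_cgmy(du))` with
`ν_cgmy(du) = (α u^{-1-β} e^{-λ⁺u} 1_{(0,∞)}(u) + α |u|^{-1-β} e^{-λ⁻|u|} 1_{(-∞,0)}(u)) du`,
then `E[X g(X)] = E[∫ u g(X+u) ν_cgmy(du)]`. -/
theorem stein_identity_CGMY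
    {Ω : Type*} [MeasureSpace Ω] [IsProbabilityMeasure (ℙ : Measure Ω)]
    (α β lp lm : ℝ) (hα : 0 < α) (hlp : 0 < lp) (hlm : 0 < lm)
    (hβ : β ∈ Ico (0:ℝ) 1)
    (X : Ω → ℝ) (hX : Measurable X)
    -- the CGMY Lévy measure
    (ν : Measure ℝ)
    (hν : ν = volume.withDensity (fun u => ENNReal.ofReal
        ((Ioi (0:ℝ)).indicator (fun u => α * u ^ (-1 - β) * Real.exp (-lp * u)) u
          + (Iio (0:ℝ)).indicator (fun u => α * |u| ^ (-1 - β) * Real.exp (-lm * |u|)) u)))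
    -- X ~ CGMY(α, β, λ⁺, λ⁻)
    (hcf : ∀ t : ℝ,
      ∫ ω, Complex.exp (Complex.I * t * X ω) ∂ℙ
        = Complex.exp (∫ u : ℝ, (Complex.exp (Complex.I * t * u) - 1) ∂ν))
    -- g is absolutely continuous with derivative g'
    (g g' : ℝ → ℝ)
    (hg'loc : LocallyIntegrable g' volume)
    (hg : ∀ x : ℝ, g x = g 0 + ∫ t in (0:ℝ)..x, g' t)
    -- integrability assumptions
    (hint1 : Integrable (fun ω => X ω * g (X ω)) ℙ)
    (hint2 : Integrable (fun ω => ∫ u : ℝ, |u * g (X ω + u)| ∂ν) ℙ) :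
    ∫ ω, X ω * g (X ω) ∂ℙ = ∫ ω, (∫ u : ℝ, u * g (X ω + u) ∂ν) ∂ℙ := by
  have hcont : Continuous g := by
    have h : Continuous (fun x => g 0 + ∫ t in (0:ℝ)..x, g' t) :=
      continuous_const.add (intervalIntegral.continuous_primitive
        (fun a b => (hg'loc.integrableOn_isCompact isCompact_uIcc).intervalIntegrable) 0)
    exact h.congr fun x => (hg x).symm
  have hgm : Measurable g := hcont.measurable
  have hν' : ν = volume.withDensity
      (fun u => ENNReal.ofReal (CGMYaux.dens α β lp lm u)) := hν
  clear hν
  have hdm := CGMYaux.dens_measurable α β lp lm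
  have hd0 := CGMYaux.dens_nonneg (β := β) (lp := lp) (lm := lm) hα
  have hiff : ∀ f : ℝ → ℝ, Integrable f ν ↔
      Integrable (fun u => f u * CGMYaux.dens α β lp lm u) := by
    intro f
    rw [hν', integrable_withDensity_iff_integrable_smul' (by fun_prop) (by simp)]
    refine integrable_congr (ae_of_all _ fun u => ?_)
    simp only [ENNReal.toReal_ofReal (hd0 u), smul_eq_mul, mul_comm]
  have : SFinite ν := by rw [hν']; infer_instance
  have hν1 : Integrable (fun u : ℝ => u) ν := by
    rw [hiff]
    refine (CGMYaux.integrable_rpow_dens (α := α) (q := 1) hlp hlm hβ.2).mono (by fun_prop)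
      (ae_of_all _ fun u => ?_)
    simp
  have hν2 : Integrable (fun u : ℝ => u ^ 2) ν := by
    rw [hiff]
    refine (CGMYaux.integrable_rpow_dens (α := α) (β := β) (q := 2) hlp hlm
      (by linarith [hβ.2])).mono (by fun_prop) (ae_of_all _ fun u => ?_)
    simp
  set μ : Measure ℝ := (ℙ : Measure Ω).map X with hμ
  have : IsProbabilityMeasure μ := Measure.isProbabilityMeasure_map hX.aemeasurable
  have hcf' : ∀ t : ℝ, charFun μ t =
      Complex.exp (∫ u : ℝ, (Complex.exp (t * u * Complex.I) - 1) ∂ν) := by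
    intro t
    rw [charFun_apply_real, hμ, integral_map hX.aemeasurable (by fun_prop)]
    have h := hcf t
    have e : ∀ x : ℝ, Complex.I * t * x = t * x * Complex.I := fun x => by ring
    simp_rw [e] at h
    exact h
  have hμ1 : Integrable (fun x : ℝ => x) μ := CGMYaux.memLp_two hν1 hν2 hcf'
  have h1 : Integrable (fun x => x * g x) μ := by
    rw [hμ, integrable_map_measure (by fun_prop) hX.aemeasurable]
    exact hint1
  obtain ⟨z, hz⟩ := CGMYaux.exists_shift hν1 hcf' (fun x => ‖x * g x‖ₑ) (by fun_prop) h1.2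
  have hS : MeasurableSet {u : ℝ | 1 < ‖u‖} := measurableSet_lt measurable_const (by fun_prop)
  have hzi : Integrable (fun u : ℝ => {u : ℝ | 1 < ‖u‖}.indicator
      (fun u => |(z + u) * g (z + u)| * CGMYaux.dens α β lp lm u) u) := by
    have ha : IntegrableOn (fun u => (z + u) * g (z + u)) {u : ℝ | 1 < ‖u‖} ν :=
      ⟨by fun_prop, hz⟩
    have hb := (hiff _).1 ((integrable_indicator_iff hS).2 (show IntegrableOn
      (fun u => ‖(z + u) * g (z + u)‖) {u : ℝ | 1 < ‖u‖} ν from Integrable.norm ha))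
    refine hb.congr (ae_of_all _ fun u => ?_)
    by_cases hu : u ∈ {u : ℝ | 1 < ‖u‖}
    · simp only [Set.indicator_of_mem hu]
      rfl
    · simp only [Set.indicator_of_notMem hu, zero_mul]
  have hinner : ∀ x : ℝ, Integrable (fun u => u * g (x + u)) ν := fun x =>
    (hiff _).2 (CGMYaux.transfer hα hβ hlp hlm hcont z hzi x)
  have hjm : StronglyMeasurable (fun p : ℝ × ℝ => p.2 * g (p.1 + p.2)) :=
    Measurable.stronglyMeasurable (by fun_prop)
  have h2 : Integrable (fun p : ℝ × ℝ => p.2 * g (p.1 + p.2)) (μ.prod ν) := by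
    rw [integrable_prod_iff hjm.aestronglyMeasurable]
    refine ⟨ae_of_all _ hinner, ?_⟩
    have hsm : StronglyMeasurable (fun x : ℝ => ∫ u, ‖u * g (x + u)‖ ∂ν) :=
      hjm.norm.integral_prod_right
    rw [hμ, integrable_map_measure hsm.aestronglyMeasurable hX.aemeasurable]
    exact hint2
  have hfin := CGMYaux.stein_general hν1 hμ1 hcf' g hgm h1 h2
  have hsm : StronglyMeasurable (fun x : ℝ => ∫ u, u * g (x + u) ∂ν) := hjm.integral_prod_right
  rw [hμ, integral_map hX.aemeasurable (by fun_prop),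
    integral_map hX.aemeasurable hsm.aestronglyMeasurable] at hfin
  exact hfin
end
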